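/- There exist constants c, C > 0 such that for every weakly differentiable f : ℝ² → ℝ with ∫_{ℝ²} (1+|y|²) f² < ∞ and ∫_{ℝ²} |∇f|²/U < ∞, one has ∫_{ℝ²} U |∇(f/U − Ψ_f)|² ≥ c ∫_{ℝ²} |∇f|²/U − C (⟨f, ΛU⟩² + ⟨f, ∂_{y₁}U⟩² + ⟨f, ∂_{y₂}U⟩²). -/

import Mathlib

open MeasureTheory
open scoped RealInnerProductSpace

noncomputable section

abbrev E2 : Type := EuclideanSpace ℝ (Fin 2)

/-- The stationary state `U(y) = 8 / (1 + |y|²)²`. -/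
def U2 (y : E2) : ℝ := 8 / (1 + ‖y‖ ^ 2) ^ 2

/-- The 2D Poisson field `Ψ_g(x) = −(1/2π) ∫ log|x−y| g(y) dy`. -/
def Psi (g : E2 → ℝ) (x : E2) : ℝ :=
  -(1 / (2 * Real.pi)) * ∫ y : E2, Real.log ‖x - y‖ * g y

/-- The scaling operator `Λf(y) = 2 f(y) + y·∇f(y)`. -/
def Lam (f : E2 → ℝ) (y : E2) : ℝ := 2 * f y + ⟪y, gradient f y⟫

/-- Partial derivative in the `i`-th coordinate direction. -/
def pd (i : Fin 2) (f : E2 → ℝ) (y : E2) : ℝ := fderiv ℝ f y (EuclideanSpace.single i 1)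

/-- The rescaled stationary state `U_ν(y) = ν⁻² U(y/ν)`. -/
def Unu (ν : ℝ) (y : E2) : ℝ := (1 / ν ^ 2) * U2 ((1 / ν) • y)

open scoped ENNReal

/-- weight -/
def sC (z : ℂ) : ℝ := 1 + ‖z‖ ^ 2

lemma sC_one_le (z : ℂ) : 1 ≤ sC z := by unfold sC; nlinarith [sq_nonneg ‖z‖]
lemma sC_pos (z : ℂ) : 0 < sC z := lt_of_lt_of_le one_pos (sC_one_le z)
lemma sC_ne (z : ℂ) : sC z ≠ 0 := (sC_pos z).ne'
lemma sC_cont : Continuous sC := by unfold sC; fun_prop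
lemma sC_eq (z : ℂ) : sC z = 1 + z.re ^ 2 + z.im ^ 2 := by
  unfold sC; rw [Complex.sq_norm, Complex.normSq_apply]; ring
lemma norm_le_sC (z : ℂ) : ‖z‖ ≤ sC z := by unfold sC; nlinarith [sq_nonneg (‖z‖ - 1), norm_nonneg z]

lemma integrable_sC_rpow {r : ℝ} (hr : 1 < r) : Integrable (fun z : ℂ => (sC z) ^ (-r)) := by
  have := integrable_rpow_neg_one_add_norm_sq (E := ℂ) (μ := volume) (r := 2 * r)
    (by rw [Complex.finrank_real_complex]; push_cast; linarith)
  refine this.congr (Filter.Eventually.of_forall fun z => ?_)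
  simp only [sC]; congr 1; ring

lemma integrable_sC_pow {k : ℕ} (hk : 2 ≤ k) : Integrable (fun z : ℂ => ((sC z) ^ k)⁻¹) := by
  have := integrable_sC_rpow (r := k) (by have : (2:ℝ) ≤ k := by exact_mod_cast hk
                                          linarith)
  refine this.congr (Filter.Eventually.of_forall fun z => ?_)
  simp only [Real.rpow_neg (sC_pos z).le, Real.rpow_natCast]

lemma integrableOn_norm_inv : IntegrableOn (fun z : ℂ => ‖z‖⁻¹) (Metric.ball 0 1) := by
  have := (integrableOn_fun_norm_addHaar (E := ℂ) (μ := volume) (f := fun r : ℝ => r⁻¹) (r := 1))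
  rw [this, Complex.finrank_real_complex]
  have h1 : IntegrableOn (fun _ : ℝ => (1:ℝ)) (Set.Ioo 0 1) := by simp
  refine h1.congr_fun (fun y hy => ?_) measurableSet_Ioo
  have : y ≠ 0 := hy.1.ne'
  simp [this]

/-- the basic kernel dominating function -/
lemma kern_le (x y : ℂ) : ‖x - y‖⁻¹ * (sC y)⁻¹ ≤
    (Metric.ball (0:ℂ) 1).indicator (fun z => ‖z‖⁻¹) (x - y) +
      2 * (sC (x - y) ^ (-(3/2 : ℝ)) + sC y ^ (-(3/2 : ℝ))) := by
  have hsy := sC_pos y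
  have hst := sC_pos (x - y)
  have h1 : (sC y)⁻¹ ≤ 1 := inv_le_one_of_one_le₀ (sC_one_le y)
  have hp : 0 ≤ 2 * (sC (x - y) ^ (-(3/2 : ℝ)) + sC y ^ (-(3/2 : ℝ))) := by positivity
  by_cases h : x - y ∈ Metric.ball (0:ℂ) 1
  · rw [Set.indicator_of_mem h]
    have : ‖x - y‖⁻¹ * (sC y)⁻¹ ≤ ‖x - y‖⁻¹ * 1 := by gcongr
    linarith
  · rw [Set.indicator_of_notMem h, zero_add]
    have hn : 1 ≤ ‖x - y‖ := by simpa using h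
    have h2 : ‖x - y‖⁻¹ ≤ 2 * sC (x - y) ^ (-(1/2 : ℝ)) := by
      rw [Real.rpow_neg hst.le, ← Real.sqrt_eq_rpow, inv_le_comm₀ (by linarith) (by positivity)]
      rw [mul_inv, inv_inv]
      have : Real.sqrt (sC (x - y)) ≤ 2 * ‖x - y‖ := by
        apply Real.sqrt_le_iff.2
        constructor
        · positivity
        · unfold sC; nlinarith
      linarith
    have e : ∀ s : ℝ, 0 < s → s ^ (-(3/2:ℝ)) = s ^ (-(1/2:ℝ)) * s⁻¹ := by
      intro s hs
      rw [← Real.rpow_neg_one s, ← Real.rpow_add hs]; norm_num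
    have h3 : sC (x - y) ^ (-(1/2 : ℝ)) * (sC y)⁻¹ ≤
        (sC (x - y) ^ (-(3/2 : ℝ)) + sC y ^ (-(3/2 : ℝ))) := by
      rcases le_total (sC (x - y)) (sC y) with hle | hle
      · have : (sC y)⁻¹ ≤ (sC (x-y))⁻¹ := by gcongr
        have h4 : sC (x - y) ^ (-(1/2 : ℝ)) * (sC y)⁻¹ ≤ sC (x - y) ^ (-(3/2 : ℝ)) := by
          rw [e _ hst]; gcongr
        have : 0 ≤ sC y ^ (-(3/2 : ℝ)) := by positivity
        linarith
      · have h5 : sC (x - y) ^ (-(1/2 : ℝ)) ≤ sC y ^ (-(1/2 : ℝ)) :=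
          Real.rpow_le_rpow_of_nonpos hsy hle (by norm_num)
        have h4 : sC (x - y) ^ (-(1/2 : ℝ)) * (sC y)⁻¹ ≤ sC y ^ (-(3/2 : ℝ)) := by
          rw [e _ hsy]; gcongr
        have : 0 ≤ sC (x-y) ^ (-(3/2 : ℝ)) := by positivity
        linarith
    calc ‖x - y‖⁻¹ * (sC y)⁻¹ ≤ (2 * sC (x - y) ^ (-(1/2 : ℝ))) * (sC y)⁻¹ := by gcongr
      _ = 2 * (sC (x - y) ^ (-(1/2 : ℝ)) * (sC y)⁻¹) := by ring
      _ ≤ _ := by gcongr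

lemma kern_bound : ∃ C0 : ℝ, 0 < C0 ∧ ∀ x : ℂ,
    Integrable (fun y : ℂ => ‖x - y‖⁻¹ * (sC y)⁻¹) ∧
    ∫ y : ℂ, ‖x - y‖⁻¹ * (sC y)⁻¹ ≤ C0 := by
  have i1 : Integrable ((Metric.ball (0:ℂ) 1).indicator (fun z => ‖z‖⁻¹)) :=
    (integrable_indicator_iff measurableSet_ball).2 integrableOn_norm_inv
  have i2 : Integrable (fun z : ℂ => sC z ^ (-(3/2 : ℝ))) := integrable_sC_rpow (by norm_num)
  set J := (Metric.ball (0:ℂ) 1).indicator (fun z => ‖z‖⁻¹) with hJ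
  set S := (fun z : ℂ => sC z ^ (-(3/2 : ℝ))) with hS
  have hJ0 : 0 ≤ ∫ z, J z := integral_nonneg fun z => by
    rw [hJ]; exact Set.indicator_nonneg (fun _ _ => by positivity) _
  have hS0 : 0 ≤ ∫ z, S z := integral_nonneg fun z => Real.rpow_nonneg (sC_pos z).le _
  refine ⟨(∫ z, J z) + 2 * ((∫ z, S z) + ∫ z, S z) + 1, by positivity, fun x => ?_⟩
  have i1' : Integrable (fun y => J (x - y)) := i1.comp_sub_left x
  have i2' : Integrable (fun y => S (x - y)) := i2.comp_sub_left x
  have i23 : Integrable (fun y => 2 * (S (x - y) + S y)) := (i2'.add i2).const_mul 2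
  have i3 : Integrable (fun y => J (x - y) + 2 * (S (x - y) + S y)) := i1'.add i23
  have hint : Integrable (fun y : ℂ => ‖x - y‖⁻¹ * (sC y)⁻¹) := by
    refine i3.mono' ?_ (Filter.Eventually.of_forall fun y => ?_)
    · have := sC_cont
      have : Measurable sC := this.measurable
      fun_prop
    · rw [Real.norm_of_nonneg (by have := sC_pos y; positivity)]
      exact kern_le x y
  refine ⟨hint, ?_⟩
  have := integral_mono hint i3 (fun y => kern_le x y)
  rw [integral_add i1' i23, integral_const_mul, integral_add i2' i2,
    integral_sub_left_eq_self J volume x, integral_sub_left_eq_self S volume x] at this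
  linarith

lemma cs_lint {X : Type*} [MeasurableSpace X] (μ : Measure X) {a b : X → ℝ≥0∞}
    (ha : AEMeasurable a μ) (hb : AEMeasurable b μ) :
    (∫⁻ x, a x * b x ∂μ) ^ 2 ≤ (∫⁻ x, a x ^ 2 ∂μ) * ∫⁻ x, b x ^ 2 ∂μ := by
  have h := ENNReal.lintegral_mul_le_Lp_mul_Lq μ (p := 2) (q := 2)
    (Real.HolderConjugate.two_two) ha hb
  have h2 := pow_le_pow_left' h 2
  refine h2.trans (le_of_eq ?_)
  rw [mul_pow, ← ENNReal.rpow_natCast, ← ENNReal.rpow_natCast, ← ENNReal.rpow_mul,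
    ← ENNReal.rpow_mul]
  norm_num

/-- Schur-type bound. -/
lemma KL_lint : ∃ C0 : ℝ, 0 < C0 ∧ ∀ h : ℂ → ℝ≥0∞, Measurable h →
    ∫⁻ x : ℂ, ENNReal.ofReal (sC x)⁻¹ * (∫⁻ y, h y * ENNReal.ofReal ‖x - y‖⁻¹) ^ 2 ≤
      ENNReal.ofReal C0 * ∫⁻ y, ENNReal.ofReal (sC y) * h y ^ 2 := by
  obtain ⟨C, hC, hk⟩ := kern_bound
  have hsm : Measurable sC := sC_cont.measurable
  have hk' : ∀ x, ∫⁻ y, ENNReal.ofReal (‖x - y‖⁻¹ * (sC y)⁻¹) ≤ ENNReal.ofReal C := by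
    intro x
    rw [← ofReal_integral_eq_lintegral_ofReal (hk x).1
      (Filter.Eventually.of_forall fun y => by have := sC_pos y; positivity)]
    exact ENNReal.ofReal_le_ofReal (hk x).2
  refine ⟨C * C, by positivity, fun h hh => ?_⟩
  have step : ∀ x, (∫⁻ y, h y * ENNReal.ofReal ‖x - y‖⁻¹) ^ 2 ≤
      ENNReal.ofReal C * ∫⁻ y, (ENNReal.ofReal (sC y) * h y ^ 2) * ENNReal.ofReal ‖x - y‖⁻¹ := by
    intro x
    have e1 : ∀ y, h y * ENNReal.ofReal ‖x - y‖⁻¹ =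
        (h y * ENNReal.ofReal (√(sC y * ‖x - y‖⁻¹))) *
          ENNReal.ofReal (√(‖x - y‖⁻¹ * (sC y)⁻¹)) := by
      intro y
      have := sC_pos y
      rw [mul_assoc, ← ENNReal.ofReal_mul (by positivity), ← Real.sqrt_mul (by positivity)]
      congr 2
      rw [show sC y * ‖x - y‖⁻¹ * (‖x - y‖⁻¹ * (sC y)⁻¹) = ‖x - y‖⁻¹ ^ 2 by field_simp]
      rw [Real.sqrt_sq (by positivity)]
    simp_rw [e1]
    refine (cs_lint volume (by fun_prop) (by fun_prop)).trans ?_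
    rw [mul_comm]
    gcongr with y
    · refine le_trans (le_of_eq ?_) (hk' x)
      congr 1; ext y
      have := sC_pos y
      rw [← ENNReal.ofReal_pow (by positivity), Real.sq_sqrt (by positivity)]
    · have := sC_pos y
      rw [mul_pow, ← ENNReal.ofReal_pow (by positivity), Real.sq_sqrt (by have := sC_pos y; positivity),
        ENNReal.ofReal_mul (sC_pos y).le]
      ring_nf
      exact le_rfl
  calc _ ≤ ∫⁻ x : ℂ, ENNReal.ofReal (sC x)⁻¹ * (ENNReal.ofReal C *
          ∫⁻ y, (ENNReal.ofReal (sC y) * h y ^ 2) * ENNReal.ofReal ‖x - y‖⁻¹) := by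
        gcongr with x; exact step x
    _ = ENNReal.ofReal C * ∫⁻ x : ℂ, ∫⁻ y, (ENNReal.ofReal (sC y) * h y ^ 2) *
          ENNReal.ofReal (‖y - x‖⁻¹ * (sC x)⁻¹) := by
        rw [← lintegral_const_mul' _ _ ENNReal.ofReal_ne_top]
        congr 1; ext x
        rw [mul_left_comm]
        congr 1
        rw [← lintegral_const_mul' _ _ ENNReal.ofReal_ne_top]
        congr 1; ext y
        rw [ENNReal.ofReal_mul (by positivity), norm_sub_rev]; ring
    _ = ENNReal.ofReal C * ∫⁻ y, (ENNReal.ofReal (sC y) * h y ^ 2) *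
          ∫⁻ x : ℂ, ENNReal.ofReal (‖y - x‖⁻¹ * (sC x)⁻¹) := by
        congr 1
        rw [lintegral_lintegral_swap (by fun_prop)]
        congr 1; ext y
        rw [lintegral_const_mul _ (by fun_prop)]
    _ ≤ ENNReal.ofReal C * ∫⁻ y, (ENNReal.ofReal (sC y) * h y ^ 2) * ENNReal.ofReal C := by
        gcongr with y; exact hk' y
    _ = _ := by
        rw [lintegral_mul_const _ (by fun_prop), ENNReal.ofReal_mul hC.le]; ring

/-- Cauchy transform (without 1/π) -/
def CT (h : ℂ → ℂ) (x : ℂ) : ℂ := ∫ y, h y / (x - y)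

lemma CT_enorm_le (h : ℂ → ℂ) (x : ℂ) :
    ‖CT h x‖ₑ ≤ ∫⁻ y, ‖h y‖ₑ * ENNReal.ofReal ‖x - y‖⁻¹ := by
  refine (enorm_integral_le_lintegral_enorm _).trans (le_of_eq ?_)
  congr 1; ext y
  rw [div_eq_mul_inv, enorm_mul]
  congr 1
  rw [← ofReal_norm, norm_inv]

lemma CT_meas (h : ℂ → ℂ) (hh : Measurable h) : AEStronglyMeasurable (CT h) volume := by
  have : StronglyMeasurable (fun p : ℂ × ℂ => h p.2 / (p.1 - p.2)) := by
    apply Measurable.stronglyMeasurable; fun_prop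
  exact this.integral_prod_right.aestronglyMeasurable

lemma int_ae_of_lint_sq {h : ℂ → ℂ} (hi : Integrable (fun y => sC y * ‖h y‖ ^ 2)) :
    (∫⁻ y, ENNReal.ofReal (sC y) * ‖h y‖ₑ ^ 2) = ENNReal.ofReal (∫ y, sC y * ‖h y‖ ^ 2) := by
  rw [ofReal_integral_eq_lintegral_ofReal hi
      (Filter.Eventually.of_forall fun y => by have := sC_pos y; positivity)]
  congr 1; ext y
  rw [ENNReal.ofReal_mul (sC_pos y).le, ENNReal.ofReal_pow (norm_nonneg _), ofReal_norm]

lemma KL : ∃ C0 : ℝ, 0 < C0 ∧ ∀ h : ℂ → ℂ, Measurable h →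
    Integrable (fun y => sC y * ‖h y‖ ^ 2) →
    (∀ᵐ x : ℂ, Integrable (fun y => h y / (x - y))) ∧
    Integrable (fun x => (sC x)⁻¹ * ‖CT h x‖ ^ 2) ∧
    ∫ x, (sC x)⁻¹ * ‖CT h x‖ ^ 2 ≤ C0 * ∫ y, sC y * ‖h y‖ ^ 2 := by
  obtain ⟨C, hC, hk⟩ := KL_lint
  refine ⟨C, hC, fun h hh hi => ?_⟩
  have hsm : Measurable sC := sC_cont.measurable
  have key := hk (fun y => ‖h y‖ₑ) (by fun_prop)
  rw [int_ae_of_lint_sq hi, ← ENNReal.ofReal_mul hC.le] at key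
  have hm : Measurable (fun x => ∫⁻ y, ‖h y‖ₑ * ENNReal.ofReal ‖x - y‖⁻¹) := by
    apply Measurable.lintegral_prod_right' (f := fun p : ℂ × ℂ => ‖h p.2‖ₑ * ENNReal.ofReal ‖p.1 - p.2‖⁻¹)
    fun_prop
  have bd : ∫⁻ x, ENNReal.ofReal ((sC x)⁻¹ * ‖CT h x‖ ^ 2) ≤
      ENNReal.ofReal (C * ∫ y, sC y * ‖h y‖ ^ 2) := by
    refine le_trans ?_ key
    gcongr with x
    rw [ENNReal.ofReal_mul (by have := sC_pos x; positivity), ENNReal.ofReal_pow (norm_nonneg _),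
      ofReal_norm]
    gcongr
    exact CT_enorm_le h x
  have meas : AEStronglyMeasurable (fun x => (sC x)⁻¹ * ‖CT h x‖ ^ 2) volume := by
    have := CT_meas h hh
    have h2 : AEStronglyMeasurable (fun x => (sC x)⁻¹) volume := hsm.inv.aestronglyMeasurable
    exact h2.mul (this.norm.pow 2)
  have nn : ∀ x, 0 ≤ (sC x)⁻¹ * ‖CT h x‖ ^ 2 := fun x => by have := sC_pos x; positivity
  have hint : Integrable (fun x => (sC x)⁻¹ * ‖CT h x‖ ^ 2) := by
    refine ⟨meas, ?_⟩
    rw [hasFiniteIntegral_iff_ofReal (Filter.Eventually.of_forall nn)]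
    exact bd.trans_lt ENNReal.ofReal_lt_top
  refine ⟨?_, hint, ?_⟩
  · have fin := ae_lt_top (by fun_prop) (key.trans_lt ENNReal.ofReal_lt_top).ne
    filter_upwards [fin] with x hx
    refine ⟨by apply Measurable.aestronglyMeasurable; fun_prop, ?_⟩
    have h3 : (∫⁻ y, ‖h y‖ₑ * ENNReal.ofReal ‖x - y‖⁻¹) < ⊤ := by
      by_contra hcon
      rw [not_lt, top_le_iff] at hcon
      rw [hcon] at hx
      have : ENNReal.ofReal (sC x)⁻¹ ≠ 0 := by
        simp [sC_pos x]
      simp [ENNReal.mul_top this] at hx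
    refine lt_of_le_of_lt (le_of_eq ?_) h3
    congr 1; ext y
    change ‖h y / (x - y)‖ₑ = _
    rw [div_eq_mul_inv, enorm_mul]
    congr 1
    rw [← ofReal_norm, norm_inv]
  · rw [← ENNReal.ofReal_le_ofReal_iff (by
      apply mul_nonneg hC.le
      exact integral_nonneg fun y => by have := sC_pos y; positivity)]
    rw [ofReal_integral_eq_lintegral_ofReal hint (Filter.Eventually.of_forall nn)]
    exact bd

lemma seg_pt (α : ℂ → ℂ) (hα : ContDiff ℝ 1 α) (x y : ℂ) :
    ‖α x - α y‖ₑ ^ 2 ≤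
      ∫⁻ t in Set.Ioc (0:ℝ) 1, ‖x - y‖ₑ ^ 2 * ‖fderiv ℝ α (y + t • (x - y))‖ₑ ^ 2 := by
  have hd : Differentiable ℝ α := hα.differentiable (by norm_num)
  have hc : Continuous (fderiv ℝ α) := hα.continuous_fderiv (by norm_num)
  have hc2 : Continuous (fun t : ℝ => fderiv ℝ α (y + t • (x - y)) (x - y)) := by
    fun_prop
  have ftc : ∫ t in (0:ℝ)..1, fderiv ℝ α (y + t • (x - y)) (x - y) = α x - α y := by
    have h := intervalIntegral.integral_eq_sub_of_hasDerivAt (a := 0) (b := 1)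
      (f := fun t : ℝ => α (y + t • (x - y)))
      (f' := fun t : ℝ => fderiv ℝ α (y + t • (x - y)) (x - y)) (fun t _ => by
        have h1 : HasDerivAt (fun t : ℝ => y + t • (x - y)) (x - y) t := by
          have := ((hasDerivAt_id t).smul_const (x - y)).const_add y
          simpa using this
        exact (hd _).hasFDerivAt.comp_hasDerivAt t h1) (hc2.intervalIntegrable _ _)
    rw [h]; simp
  rw [intervalIntegral.integral_of_le zero_le_one] at ftc
  have h1 : ‖α x - α y‖ₑ ≤ ∫⁻ t in Set.Ioc (0:ℝ) 1,
      (‖x - y‖ₑ * ‖fderiv ℝ α (y + t • (x - y))‖ₑ) * 1 := by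
    rw [← ftc]
    refine (enorm_integral_le_lintegral_enorm _).trans ?_
    gcongr with t
    rw [mul_one, mul_comm]
    exact ContinuousLinearMap.le_opENorm _ _
  have h2 := pow_le_pow_left' h1 2
  have hm : Measurable (fun t : ℝ => ‖x - y‖ₑ * ‖fderiv ℝ α (y + t • (x - y))‖ₑ) := by
    have : Continuous (fun t : ℝ => fderiv ℝ α (y + t • (x - y))) := by fun_prop
    have := this.measurable
    fun_prop
  refine h2.trans ((cs_lint _ hm.aemeasurable aemeasurable_const).trans (le_of_eq ?_))
  simp [mul_pow]

lemma seg_weight (x y : ℂ) (t : ℝ) (h0 : 0 ≤ t) (h1 : t ≤ 1) :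
    ((sC x) ^ 6)⁻¹ * ((sC y) ^ 6)⁻¹ * ‖x - y‖ ^ 2 ≤
      2 * ((sC (y + t • (x - y))) ^ 3)⁻¹ * ((sC y) ^ 2)⁻¹ ∧
    ((sC x) ^ 6)⁻¹ * ((sC y) ^ 6)⁻¹ * ‖x - y‖ ^ 2 ≤
      2 * ((sC (y + t • (x - y))) ^ 3)⁻¹ * ((sC x) ^ 2)⁻¹ := by
  set p := y + t • (x - y) with hp
  have hx := sC_one_le x
  have hy := sC_one_le y
  have hpp := sC_one_le p
  have hd : ‖x - y‖ ^ 2 ≤ 2 * (sC x * sC y) := by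
    have := norm_sub_le x y
    have h3 : ‖x - y‖ ^ 2 ≤ (‖x‖ + ‖y‖) ^ 2 := by gcongr
    unfold sC
    nlinarith [sq_nonneg (‖x‖ - ‖y‖), mul_nonneg (sq_nonneg ‖x‖) (sq_nonneg ‖y‖)]
  have hps : sC p ≤ sC x * sC y := by
    have : ‖p‖ ≤ t * ‖x‖ + (1 - t) * ‖y‖ := by
      have e : p = t • x + (1 - t) • y := by rw [hp]; simp only [Complex.real_smul]; push_cast; ring
      rw [e]
      refine (norm_add_le _ _).trans ?_
      rw [norm_smul, norm_smul, Real.norm_of_nonneg h0, Real.norm_of_nonneg (by linarith)]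
    have h4 : ‖p‖ ^ 2 ≤ (t * ‖x‖ + (1 - t) * ‖y‖) ^ 2 := by gcongr
    have h5 : (t * ‖x‖ + (1 - t) * ‖y‖) ^ 2 ≤ t * ‖x‖ ^ 2 + (1 - t) * ‖y‖ ^ 2 := by
      nlinarith [mul_nonneg (mul_nonneg h0 (sub_nonneg.2 h1)) (sq_nonneg (‖x‖ - ‖y‖))]
    have h6 : t * ‖x‖ ^ 2 ≤ ‖x‖ ^ 2 := by nlinarith [sq_nonneg ‖x‖]
    have h7 : (1 - t) * ‖y‖ ^ 2 ≤ ‖y‖ ^ 2 := by nlinarith [sq_nonneg ‖y‖]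
    unfold sC
    nlinarith [mul_nonneg (sq_nonneg ‖x‖) (sq_nonneg ‖y‖)]
  generalize sC x = X at *
  generalize sC y = Y at *
  generalize sC p = P at *
  have hX : 0 < X := by linarith
  have hY : 0 < Y := by linarith
  have hP : 0 < P := by linarith
  have main : (X ^ 6)⁻¹ * (Y ^ 6)⁻¹ * ‖x - y‖ ^ 2 ≤ 2 * (X ^ 5 * Y ^ 5)⁻¹ := by
    calc (X ^ 6)⁻¹ * (Y ^ 6)⁻¹ * ‖x - y‖ ^ 2 ≤ (X ^ 6)⁻¹ * (Y ^ 6)⁻¹ * (2 * (X * Y)) := by gcongr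
      _ = _ := by field_simp
  have hX2 : 1 ≤ X ^ 2 := one_le_pow₀ hx
  have hY2 : 1 ≤ Y ^ 2 := one_le_pow₀ hy
  have hP3 : P ^ 3 ≤ X ^ 3 * Y ^ 3 := by rw [← mul_pow]; gcongr
  constructor
  · refine main.trans ?_
    rw [mul_assoc, ← mul_inv]
    refine mul_le_mul_of_nonneg_left (inv_anti₀ (by positivity) ?_) (by norm_num)
    calc P ^ 3 * Y ^ 2 ≤ (X ^ 3 * Y ^ 3) * Y ^ 2 := by gcongr
      _ = X ^ 3 * Y ^ 5 * 1 := by ring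
      _ ≤ X ^ 3 * Y ^ 5 * X ^ 2 := by gcongr
      _ = _ := by ring
  · refine main.trans ?_
    rw [mul_assoc, ← mul_inv]
    refine mul_le_mul_of_nonneg_left (inv_anti₀ (by positivity) ?_) (by norm_num)
    calc P ^ 3 * X ^ 2 ≤ (X ^ 3 * Y ^ 3) * X ^ 2 := by gcongr
      _ = X ^ 5 * Y ^ 3 * 1 := by ring
      _ ≤ X ^ 5 * Y ^ 3 * Y ^ 2 := by gcongr
      _ = _ := by ring

lemma cov_lint (H : ℂ → ℝ≥0∞) (hH : Measurable H) (t : ℝ) (ht : 1/2 ≤ t) (c : ℂ) :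
    ∫⁻ x, H (c + t • x) ≤ 4 * ∫⁻ x, H x := by
  have ht0 : t ≠ 0 := by linarith
  have h1 : ∫⁻ x, H (c + t • x) = ∫⁻ x, H (c + x) ∂(Measure.map (fun x : ℂ => t • x) volume) := by
    rw [lintegral_map (by fun_prop) (by fun_prop)]
  rw [h1]
  have := Measure.map_addHaar_smul (volume : Measure ℂ) ht0
  rw [this, lintegral_smul_measure, lintegral_add_left_eq_self (μ := volume) H c,
    Complex.finrank_real_complex]
  simp only [smul_eq_mul]
  gcongr
  have : |(t ^ 2)⁻¹| ≤ 4 := by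
    rw [abs_of_nonneg (by positivity)]
    rw [inv_le_comm₀ (by positivity) (by norm_num)]
    nlinarith
  calc ENNReal.ofReal |(t ^ 2)⁻¹| ≤ ENNReal.ofReal 4 := ENNReal.ofReal_le_ofReal this
    _ = 4 := by norm_num

def W6 (x : ℂ) : ℝ≥0∞ := ENNReal.ofReal ((sC x) ^ 6)⁻¹
def W2 (x : ℂ) : ℝ≥0∞ := ENNReal.ofReal ((sC x) ^ 2)⁻¹
def W3 (x : ℂ) : ℝ≥0∞ := ENNReal.ofReal ((sC x) ^ 3)⁻¹
lemma mW6 : Measurable W6 := by have := sC_cont.measurable; unfold W6; fun_prop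
lemma mW2 : Measurable W2 := by have := sC_cont.measurable; unfold W2; fun_prop
lemma mW3 : Measurable W3 := by have := sC_cont.measurable; unfold W3; fun_prop

lemma seg_double (α : ℂ → ℂ) (hα : ContDiff ℝ 1 α) :
    ∫⁻ y, ∫⁻ x, W6 x * W6 y * ‖α x - α y‖ₑ ^ 2 ≤
      8 * (∫⁻ y, W2 y) * ∫⁻ p, W3 p * ‖fderiv ℝ α p‖ₑ ^ 2 := by
  have hc : Continuous (fderiv ℝ α) := hα.continuous_fderiv (by norm_num)
  have hcm := hc.measurable
  have h6 := mW6
  have h3 := mW3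
  have h2 := mW2
  set G : ℂ → ℝ≥0∞ := fun p => W3 p * ‖fderiv ℝ α p‖ₑ ^ 2 with hG
  have hGm : Measurable G := by fun_prop
  set T : ℝ → ℂ → ℂ → ℝ≥0∞ := fun t y x => W6 x * W6 y * (‖x - y‖ₑ ^ 2 *
    ‖fderiv ℝ α (y + t • (x - y))‖ₑ ^ 2) with hT
  have mT : Measurable (fun q : (ℂ × ℂ) × ℝ => T q.2 q.1.1 q.1.2) := by
    simp only [hT]
    have : Continuous (fun q : (ℂ × ℂ) × ℝ => fderiv ℝ α (q.1.1 + q.2 • (q.1.2 - q.1.1))) := by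
      fun_prop
    have := this.measurable
    fun_prop
  have wt : ∀ t ∈ Set.Ioc (0:ℝ) 1, ∀ x y, T t y x ≤ 2 * W2 y * G (y + t • (x - y)) ∧
      T t y x ≤ 2 * W2 x * G (y + t • (x - y)) := by
    intro t ht x y
    have := seg_weight x y t ht.1.le ht.2
    have px := sC_pos x
    have py := sC_pos y
    have pp := sC_pos (y + t • (x - y))
    have e : W6 x * W6 y * ‖x - y‖ₑ ^ 2 = ENNReal.ofReal
        (((sC x) ^ 6)⁻¹ * ((sC y) ^ 6)⁻¹ * ‖x - y‖ ^ 2) := by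
      rw [ENNReal.ofReal_mul (by positivity), ENNReal.ofReal_mul (by positivity),
        ENNReal.ofReal_pow (by positivity), ofReal_norm]; rfl
    have e2 : ∀ z, 2 * W3 (y + t • (x - y)) * W2 z = ENNReal.ofReal
        (2 * ((sC (y + t • (x - y))) ^ 3)⁻¹ * ((sC z) ^ 2)⁻¹) := by
      intro z
      have := sC_pos z
      rw [ENNReal.ofReal_mul (by positivity), ENNReal.ofReal_mul (by positivity)]
      simp [W3, W2]
    constructor
    · calc T t y x = (W6 x * W6 y * ‖x - y‖ₑ ^ 2) * ‖fderiv ℝ α (y + t • (x - y))‖ₑ ^ 2 := by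
            simp only [hT]; ring
        _ ≤ (2 * W3 (y + t • (x - y)) * W2 y) * ‖fderiv ℝ α (y + t • (x - y))‖ₑ ^ 2 := by
            rw [e, e2]; gcongr ?_ * _; exact ENNReal.ofReal_le_ofReal this.1
        _ = _ := by simp only [hG]; ring
    · calc T t y x = (W6 x * W6 y * ‖x - y‖ₑ ^ 2) * ‖fderiv ℝ α (y + t • (x - y))‖ₑ ^ 2 := by
            simp only [hT]; ring
        _ ≤ (2 * W3 (y + t • (x - y)) * W2 x) * ‖fderiv ℝ α (y + t • (x - y))‖ₑ ^ 2 := by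
            rw [e, e2]; gcongr ?_ * _; exact ENNReal.ofReal_le_ofReal this.2
        _ = _ := by simp only [hG]; ring
  have each : ∀ t ∈ Set.Ioc (0:ℝ) 1, ∫⁻ y, ∫⁻ x, T t y x ≤ 8 * (∫⁻ y, W2 y) * ∫⁻ p, G p := by
    intro t ht
    have mcomp : Measurable (fun q : ℂ × ℂ => G (q.1 + t • (q.2 - q.1))) := by fun_prop
    rcases le_total (1/2) t with h | h
    · calc ∫⁻ y, ∫⁻ x, T t y x ≤ ∫⁻ y, ∫⁻ x, 2 * W2 y * G (y + t • (x - y)) := by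
            gcongr with y x; exact (wt t ht x y).1
        _ ≤ ∫⁻ y, 2 * W2 y * (4 * ∫⁻ p, G p) := by
            gcongr with y
            rw [lintegral_const_mul _ (by fun_prop)]
            gcongr
            have := cov_lint G hGm t h (y - t • y)
            refine le_trans (le_of_eq ?_) this
            congr 1; ext x; congr 1; rw [smul_sub]; ring
        _ = _ := by
            rw [lintegral_mul_const _ (by fun_prop), lintegral_const_mul _ (by fun_prop)]; ring
    · calc ∫⁻ y, ∫⁻ x, T t y x ≤ ∫⁻ y, ∫⁻ x, 2 * W2 x * G (y + t • (x - y)) := by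
            gcongr with y x; exact (wt t ht x y).2
        _ = ∫⁻ x, ∫⁻ y, 2 * W2 x * G (y + t • (x - y)) := by
            rw [lintegral_lintegral_swap]; fun_prop
        _ ≤ ∫⁻ x, 2 * W2 x * (4 * ∫⁻ p, G p) := by
            gcongr with x
            rw [lintegral_const_mul _ (by fun_prop)]
            gcongr
            have := cov_lint G hGm (1 - t) (by linarith) (t • x)
            refine le_trans (le_of_eq ?_) this
            congr 1; ext y; congr 1; simp only [Complex.real_smul]; push_cast; ring
        _ = _ := by
            rw [lintegral_mul_const _ (by fun_prop), lintegral_const_mul _ (by fun_prop)]; ring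
  calc ∫⁻ y, ∫⁻ x, W6 x * W6 y * ‖α x - α y‖ₑ ^ 2
      ≤ ∫⁻ y, ∫⁻ x, ∫⁻ t in Set.Ioc (0:ℝ) 1, T t y x := by
        gcongr with y x
        refine (mul_le_mul_right (seg_pt α hα x y) _).trans (le_of_eq ?_)
        refine (lintegral_const_mul _ ?_).symm
        have : Continuous (fun t : ℝ => fderiv ℝ α (y + t • (x - y))) := by fun_prop
        have := this.measurable
        fun_prop
    _ = ∫⁻ t in Set.Ioc (0:ℝ) 1, ∫⁻ y, ∫⁻ x, T t y x := by
        have m1 : Measurable (fun q : ℂ × ℂ × ℝ => T q.2.2 q.1 q.2.1) :=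
          mT.comp (g := fun q : (ℂ × ℂ) × ℝ => T q.2 q.1.1 q.1.2)
            (f := fun q : ℂ × ℂ × ℝ => ((q.1, q.2.1), q.2.2)) (by fun_prop)
        have m2 : Measurable (fun q : (ℂ × ℝ) × ℂ => T q.1.2 q.1.1 q.2) :=
          mT.comp (g := fun q : (ℂ × ℂ) × ℝ => T q.2 q.1.1 q.1.2)
            (f := fun q : (ℂ × ℝ) × ℂ => ((q.1.1, q.2), q.1.2)) (by fun_prop)
        rw [← lintegral_lintegral_swap (f := fun y t => ∫⁻ x, T t y x)]
        · congr 1; ext y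
          rw [lintegral_lintegral_swap (f := fun x t => T t y x)]
          exact (m1.comp (f := fun q : ℂ × ℝ => (y, q.1, q.2)) (by fun_prop)).aemeasurable
        · exact (Measurable.lintegral_prod_right' m2).aemeasurable
    _ ≤ ∫⁻ t in Set.Ioc (0:ℝ) 1, 8 * (∫⁻ y, W2 y) * ∫⁻ p, G p :=
        setLIntegral_mono' measurableSet_Ioc each
    _ = _ := by simp

lemma SP : ∃ C : ℝ, 0 < C ∧ ∀ α : ℂ → ℂ, ContDiff ℝ 1 α →
    Integrable (fun z => ((sC z) ^ 3)⁻¹ * ‖fderiv ℝ α z‖ ^ 2) →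
    ∃ a : ℂ, Integrable (fun z => ((sC z) ^ 6)⁻¹ * ‖α z - a‖ ^ 2) ∧
      ∫ z, ((sC z) ^ 6)⁻¹ * ‖α z - a‖ ^ 2 ≤ C * ∫ z, ((sC z) ^ 3)⁻¹ * ‖fderiv ℝ α z‖ ^ 2 := by
  have I2 := integrable_sC_pow (k := 2) le_rfl
  have I6 := integrable_sC_pow (k := 6) (by norm_num)
  have pos : ∀ k : ℕ, 2 ≤ k → 0 < ∫ z, ((sC z) ^ k)⁻¹ := by
    intro k hk
    rw [integral_pos_iff_support_of_nonneg (fun z => by have := sC_pos z; positivity)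
      (integrable_sC_pow hk)]
    have : Function.support (fun z => ((sC z) ^ k)⁻¹) = Set.univ := by
      ext z; simp [(sC_pos z).ne']
    rw [this]; simp
  set w2 := ∫ z, ((sC z) ^ 2)⁻¹ with hw2
  set w6 := ∫ z, ((sC z) ^ 6)⁻¹ with hw6
  have p2 : 0 < w2 := pos 2 le_rfl
  have p6 : 0 < w6 := pos 6 (by norm_num)
  have e2 : ∫⁻ z, W2 z = ENNReal.ofReal w2 := by
    rw [hw2, ofReal_integral_eq_lintegral_ofReal I2
      (Filter.Eventually.of_forall fun y => by have := sC_pos y; positivity)]; rfl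
  have e6 : ∫⁻ z, W6 z = ENNReal.ofReal w6 := by
    rw [hw6, ofReal_integral_eq_lintegral_ofReal I6
      (Filter.Eventually.of_forall fun y => by have := sC_pos y; positivity)]; rfl
  refine ⟨8 * w2 / w6, by positivity, fun α hα hi => ?_⟩
  have key := seg_double α hα
  set R := ∫ z, ((sC z) ^ 3)⁻¹ * ‖fderiv ℝ α z‖ ^ 2 with hR
  have eR : ∫⁻ p, W3 p * ‖fderiv ℝ α p‖ₑ ^ 2 = ENNReal.ofReal R := by
    rw [hR, ofReal_integral_eq_lintegral_ofReal hi
      (Filter.Eventually.of_forall fun y => by have := sC_pos y; positivity)]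
    congr 1; ext y
    have := sC_pos y
    rw [ENNReal.ofReal_mul (by positivity), ENNReal.ofReal_pow (by positivity), ofReal_norm]; rfl
  have R0 : 0 ≤ R := integral_nonneg fun y => by have := sC_pos y; positivity
  have hαm := hα.continuous.measurable
  have h6 := mW6
  set Φ : ℂ → ℝ≥0∞ := fun y => ∫⁻ x, W6 x * ‖α x - α y‖ₑ ^ 2 with hΦ
  have mΦ : Measurable Φ := by
    apply Measurable.lintegral_prod_right' (f := fun p : ℂ × ℂ => W6 p.2 * ‖α p.2 - α p.1‖ₑ ^ 2)
    fun_prop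
  have key2 : ∫⁻ y, W6 y * Φ y ≤ ENNReal.ofReal (8 * w2 * R) := by
    refine le_trans (le_of_eq ?_) (key.trans (le_of_eq ?_))
    · congr 1; ext y
      rw [hΦ]; simp only
      rw [← lintegral_const_mul _ (by fun_prop)]
      congr 1; ext x; ring
    · rw [e2, eR, ENNReal.ofReal_mul (by positivity), ENNReal.ofReal_mul (by positivity)]; simp
  have ex : ∃ y, Φ y ≤ ENNReal.ofReal (8 * w2 / w6 * R) := by
    by_contra hcon
    push Not at hcon
    have hlt : ∫⁻ y, W6 y * ENNReal.ofReal (8 * w2 / w6 * R) < ∫⁻ y, W6 y * Φ y := by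
      apply lintegral_strict_mono
      · exact NeZero.ne _
      · fun_prop
      · rw [lintegral_mul_const _ h6, e6]
        exact ENNReal.mul_ne_top ENNReal.ofReal_ne_top ENNReal.ofReal_ne_top
      · refine Filter.Eventually.of_forall fun y => ?_
        have hy : 0 < sC y := sC_pos y
        refine (ENNReal.mul_lt_mul_iff_right ?_ ?_).2 (hcon y)
        · simp only [W6, ne_eq, ENNReal.ofReal_eq_zero, not_le]; positivity
        · exact ENNReal.ofReal_ne_top
    rw [lintegral_mul_const _ h6, e6, ← ENNReal.ofReal_mul p6.le] at hlt
    have := hlt.trans_le key2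
    rw [show w6 * (8 * w2 / w6 * R) = 8 * w2 * R by field_simp] at this
    exact lt_irrefl _ this
  obtain ⟨y, hy⟩ := ex
  refine ⟨α y, ?_⟩
  have nn : ∀ z, 0 ≤ ((sC z) ^ 6)⁻¹ * ‖α z - α y‖ ^ 2 := fun z => by have := sC_pos z; positivity
  have eΦ : ∫⁻ z, ENNReal.ofReal (((sC z) ^ 6)⁻¹ * ‖α z - α y‖ ^ 2) = Φ y := by
    rw [hΦ]; congr 1; ext z
    have := sC_pos z
    rw [ENNReal.ofReal_mul (by positivity), ENNReal.ofReal_pow (by positivity), ofReal_norm]; rfl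
  have hint : Integrable (fun z => ((sC z) ^ 6)⁻¹ * ‖α z - α y‖ ^ 2) := by
    refine ⟨?_, ?_⟩
    · have := sC_cont.measurable
      apply Measurable.aestronglyMeasurable; fun_prop
    · rw [hasFiniteIntegral_iff_ofReal (Filter.Eventually.of_forall nn), eΦ]
      exact hy.trans_lt ENNReal.ofReal_lt_top
  refine ⟨hint, ?_⟩
  rw [← ENNReal.ofReal_le_ofReal_iff (by positivity),
    ofReal_integral_eq_lintegral_ofReal hint (Filter.Eventually.of_forall nn), eΦ]
  exact hy

lemma int_sC_pow (k : ℕ) (hk : 1 ≤ k) : ∫ z, ((sC z) ^ (k + 1))⁻¹ = Real.pi / k := by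
  have h := integral_fun_norm_addHaar (volume : Measure ℂ)
    (fun r : ℝ => (((1 + r ^ 2) ^ (k + 1))⁻¹ : ℝ))
  have hk0 : (k : ℝ) ≠ 0 := by positivity
  have h2 : ∫ y in Set.Ioi (0:ℝ), y * ((1 + y ^ 2) ^ (k + 1))⁻¹ = 0 - (-(1 / (2 * k) : ℝ)) := by
    have e : (-(1 / (2 * k) : ℝ)) = (fun y : ℝ => (-(1 / (2 * k)) * ((1 + y ^ 2) ^ k)⁻¹ : ℝ)) 0 := by simp
    rw [e]
    refine integral_Ioi_of_hasDerivAt_of_nonneg' (g := fun y : ℝ => (-(1 / (2 * k)) * ((1 + y ^ 2) ^ k)⁻¹ : ℝ)) (a := 0) ?_ ?_ ?_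
    · intro x _
      have hx : 0 < 1 + x ^ 2 := by positivity
      have h1 : HasDerivAt (fun y : ℝ => 1 + y ^ 2) (2 * x) x := by
        simpa using (hasDerivAt_pow 2 x).const_add 1
      have h3 := ((h1.pow k).inv (pow_pos hx k).ne').const_mul (-(1 / (2 * k) : ℝ))
      refine h3.congr_deriv ?_
      obtain ⟨m, rfl⟩ : ∃ m, k = m + 1 := ⟨k - 1, by omega⟩
      simp only [Nat.add_sub_cancel, Pi.pow_apply]
      field_simp
      ring
    · intro x hx
      have : 0 < x := hx
      positivity
    · have h3 : Filter.Tendsto (fun y : ℝ => (1 + y ^ 2) ^ k) Filter.atTop Filter.atTop := by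
        apply (Filter.tendsto_pow_atTop (by omega)).comp
        exact Filter.tendsto_atTop_add_const_left _ _ (Filter.tendsto_pow_atTop (by norm_num))
      have := (h3.inv_tendsto_atTop).const_mul (-(1 / (2 * k) : ℝ))
      simpa using this
  have h4 : (volume : Measure ℂ).real (Metric.ball 0 1) = Real.pi := by
    simp [Measure.real, Complex.volume_ball]
  simp only [Complex.finrank_real_complex, h4, smul_eq_mul] at h
  have : ∀ z, ((sC z) ^ (k + 1))⁻¹ = ((1 + ‖z‖ ^ 2) ^ (k + 1))⁻¹ := fun z => rfl
  simp_rw [this]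
  rw [h]
  norm_num at h2 ⊢
  rw [h2]
  field_simp

def dbar (H : ℂ → ℂ) (z : ℂ) : ℂ := (fderiv ℝ H z 1 + Complex.I * fderiv ℝ H z Complex.I) / 2

def kE (ε : ℝ) (t : ℂ) : ℂ := (starRingEnd ℂ) t * (((‖t‖ ^ 2 + ε ^ 2)⁻¹ : ℝ) : ℂ)

lemma kE_hasFDerivAt (ε : ℝ) (hε : 0 < ε) (t : ℂ) :
    HasFDerivAt (kE ε) (((starRingEnd ℂ) t) • (Complex.ofRealCLM.comp
        ((-((‖t‖ ^ 2 + ε ^ 2) ^ 2)⁻¹) • (2 • innerSL ℝ t)))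
      + (((‖t‖ ^ 2 + ε ^ 2)⁻¹ : ℝ) : ℂ) • (Complex.conjCLE : ℂ →L[ℝ] ℂ)) t := by
  have hD : ‖t‖ ^ 2 + ε ^ 2 ≠ 0 := by positivity
  have h1 : HasFDerivAt (fun t : ℂ => ‖t‖ ^ 2 + ε ^ 2) (2 • innerSL ℝ t) t :=
    ((hasStrictFDerivAt_norm_sq t).hasFDerivAt).add_const _
  have h2 := (hasDerivAt_inv hD).comp_hasFDerivAt t h1
  have h3 := (Complex.ofRealCLM.hasFDerivAt).comp t h2
  have h4 : HasFDerivAt (fun t : ℂ => (starRingEnd ℂ) t) (Complex.conjCLE : ℂ →L[ℝ] ℂ) t :=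
    Complex.conjCLE.hasFDerivAt
  exact h4.mul h3

lemma kE_fderiv (ε : ℝ) (hε : 0 < ε) (t v : ℂ) :
    fderiv ℝ (kE ε) t v = (starRingEnd ℂ) v * (((‖t‖ ^ 2 + ε ^ 2)⁻¹ : ℝ) : ℂ)
      - (starRingEnd ℂ) t * ((((‖t‖ ^ 2 + ε ^ 2) ^ 2)⁻¹ * (2 * (t.re * v.re + t.im * v.im)) : ℝ) : ℂ) := by
  rw [(kE_hasFDerivAt ε hε t).fderiv]
  simp [Complex.inner, innerSL_apply_apply]
  ring

lemma kE_dbar (ε : ℝ) (hε : 0 < ε) (t : ℂ) :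
    dbar (kE ε) t = ((ε ^ 2 * ((‖t‖ ^ 2 + ε ^ 2) ^ 2)⁻¹ : ℝ) : ℂ) := by
  have hD : ‖t‖ ^ 2 + ε ^ 2 ≠ 0 := by positivity
  have hn : ‖t‖ ^ 2 = t.re ^ 2 + t.im ^ 2 := by
    rw [Complex.sq_norm, Complex.normSq_apply]; ring
  unfold dbar
  rw [kE_fderiv ε hε, kE_fderiv ε hε]
  set D := ‖t‖ ^ 2 + ε ^ 2 with hDD
  have : ε ^ 2 = D - (t.re ^ 2 + t.im ^ 2) := by rw [hDD, hn]; ring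
  rw [this]
  have h2 : ((2:ℂ)) = ((2:ℝ):ℂ) := by norm_num
  rw [div_eq_mul_inv, h2, ← Complex.ofReal_inv]
  apply Complex.ext <;> simp only [Complex.add_re, Complex.add_im, Complex.sub_re, Complex.sub_im,
    Complex.mul_re, Complex.mul_im, Complex.ofReal_re, Complex.ofReal_im, Complex.I_re, Complex.I_im,
    Complex.conj_re, Complex.conj_im, Complex.one_re, Complex.one_im] <;> field_simp <;> ring

lemma kE_norm_le (ε : ℝ) (hε : 0 < ε) (t : ℂ) : ‖kE ε t‖ ≤ ‖t‖⁻¹ := by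
  unfold kE
  rw [norm_mul, RCLike.norm_conj, Complex.norm_real, Real.norm_of_nonneg (by positivity)]
  rcases eq_or_ne t 0 with rfl | h
  · simp
  · have : 0 < ‖t‖ := norm_pos_iff.2 h
    rw [← div_eq_mul_inv, div_le_iff₀ (by positivity)]
    have : ‖t‖⁻¹ * ‖t‖ ^ 2 = ‖t‖ := by field_simp
    have : 0 ≤ ‖t‖⁻¹ * ε ^ 2 := by positivity
    nlinarith

lemma kE_fderiv_le (ε : ℝ) (hε : 0 < ε) (hε1 : ε ≤ 1) (t v : ℂ) :
    ‖fderiv ℝ (kE ε) t v‖ ≤ 3 * (ε ^ 2)⁻¹ * (sC t)⁻¹ * ‖v‖ := by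
  rw [kE_fderiv ε hε]
  have hD : 0 < ‖t‖ ^ 2 + ε ^ 2 := by positivity
  have hDs : ε ^ 2 * sC t ≤ ‖t‖ ^ 2 + ε ^ 2 := by
    unfold sC
    have : ε ^ 2 ≤ 1 := pow_le_one₀ hε.le hε1
    nlinarith [sq_nonneg ‖t‖]
  have hin : |t.re * v.re + t.im * v.im| ≤ ‖t‖ * ‖v‖ := by
    have := abs_real_inner_le_norm t v
    simpa [Complex.inner, mul_comm] using this
  set D := ‖t‖ ^ 2 + ε ^ 2 with hDD
  have hs := sC_pos t
  calc _ ≤ ‖v‖ * D⁻¹ + ‖t‖ * ((D ^ 2)⁻¹ * (2 * (‖t‖ * ‖v‖))) := by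
        refine (norm_sub_le _ _).trans ?_
        rw [norm_mul, norm_mul, RCLike.norm_conj, RCLike.norm_conj, Complex.norm_real,
          Complex.norm_real, Real.norm_of_nonneg (by positivity : 0 ≤ D⁻¹), Real.norm_eq_abs,
          abs_mul, abs_mul, abs_of_nonneg (by positivity : 0 ≤ (D ^ 2)⁻¹), abs_two]
        gcongr
    _ = (D⁻¹ + 2 * (‖t‖ ^ 2 * D⁻¹) * D⁻¹) * ‖v‖ := by field_simp
    _ ≤ (D⁻¹ + 2 * 1 * D⁻¹) * ‖v‖ := by
        gcongr
        rw [← div_eq_mul_inv, div_le_one hD, hDD]; nlinarith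
    _ = 3 * D⁻¹ * ‖v‖ := by ring
    _ ≤ 3 * (ε ^ 2 * sC t)⁻¹ * ‖v‖ := by gcongr
    _ = _ := by rw [mul_inv]; ring

lemma dbar_norm_le (H : ℂ → ℂ) (z : ℂ) : ‖dbar H z‖ ≤ ‖fderiv ℝ H z‖ := by
  unfold dbar
  have h1 := (fderiv ℝ H z).le_opNorm 1
  have h2 := (fderiv ℝ H z).le_opNorm Complex.I
  simp at h1 h2
  rw [norm_div]
  have := norm_add_le (fderiv ℝ H z 1) (Complex.I * fderiv ℝ H z Complex.I)
  rw [norm_mul] at this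
  simp at this ⊢
  linarith

lemma kern_zero : Integrable (fun t : ℂ => ‖t‖⁻¹ * (sC t)⁻¹) := by
  obtain ⟨C, _, h⟩ := kern_bound
  simpa using (h 0).1

lemma CP (H : ℂ → ℂ) (hH : ContDiff ℝ 1 H) (K : ℝ) (h1 : ∀ z, ‖H z‖ ≤ K * (sC z)⁻¹)
    (h2 : ∀ z, ‖fderiv ℝ H z‖ ≤ K * (sC z)⁻¹) :
    ∫ t, dbar H t / t = - (Real.pi * H 0) := by
  have hK : 0 ≤ K := by
    have := (norm_nonneg _).trans (h1 0)
    simpa [sC] using this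
  have hd : Differentiable ℝ H := hH.differentiable (by norm_num)
  have hc : Continuous (fderiv ℝ H) := hH.continuous_fderiv (by norm_num)
  have hcH := hH.continuous
  have hdb : Continuous (dbar H) := by unfold dbar; fun_prop
  have kc : ∀ ε : ℝ, 0 < ε → Continuous (kE ε) := fun ε hε => by
    exact continuous_iff_continuousAt.2 fun t => (kE_hasFDerivAt ε hε t).continuousAt
  have kdc : ∀ ε : ℝ, 0 < ε → ∀ v, Continuous (fun t => fderiv ℝ (kE ε) t v) := fun ε hε v => by
    have : (fun t => fderiv ℝ (kE ε) t v) = _ := funext fun t => kE_fderiv ε hε t v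
    rw [this]
    have : ∀ t : ℂ, ‖t‖ ^ 2 + ε ^ 2 ≠ 0 := fun t => by positivity
    have h3 : ∀ t : ℂ, (‖t‖ ^ 2 + ε ^ 2) ^ 2 ≠ 0 := fun t => by positivity
    have := Complex.continuous_re
    have := Complex.continuous_im
    have c1 : Continuous fun t : ℂ => (‖t‖ ^ 2 + ε ^ 2)⁻¹ := Continuous.inv₀ (by fun_prop) (by assumption)
    have c2 : Continuous fun t : ℂ => ((‖t‖ ^ 2 + ε ^ 2) ^ 2)⁻¹ := Continuous.inv₀ (by fun_prop) h3
    have c3 := Complex.continuous_ofReal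
    have c4 := Complex.continuous_conj
    fun_prop
  -- integration by parts
  have ibp : ∀ ε : ℝ, 0 < ε → ε ≤ 1 → ∫ t, kE ε t * dbar H t =
      - ∫ t, ((ε ^ 2 * ((‖t‖ ^ 2 + ε ^ 2) ^ 2)⁻¹ : ℝ) : ℂ) * H t := by
    intro ε hε hε1
    have i1 : ∀ v, Integrable (fun t => fderiv ℝ (kE ε) t v * H t) := by
      intro v
      refine Integrable.mono' ((integrable_sC_pow (k := 2) le_rfl).const_mul
        (3 * (ε ^ 2)⁻¹ * ‖v‖ * K)) ?_ (Filter.Eventually.of_forall fun t => ?_)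
      · exact ((kdc ε hε v).mul hcH).aestronglyMeasurable
      · have hs := sC_pos t
        rw [norm_mul]
        calc _ ≤ (3 * (ε ^ 2)⁻¹ * (sC t)⁻¹ * ‖v‖) * (K * (sC t)⁻¹) := by
              gcongr
              · exact kE_fderiv_le ε hε hε1 t v
              · exact h1 t
          _ = _ := by field_simp
    have i2 : ∀ v, Integrable (fun t => kE ε t * fderiv ℝ H t v) := by
      intro v
      refine Integrable.mono' (kern_zero.const_mul (K * ‖v‖)) ?_
        (Filter.Eventually.of_forall fun t => ?_)
      · exact ((kc ε hε).mul (by fun_prop)).aestronglyMeasurable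
      · have hs := sC_pos t
        rw [norm_mul]
        calc _ ≤ ‖t‖⁻¹ * ((K * (sC t)⁻¹) * ‖v‖) := by
              gcongr
              · exact kE_norm_le ε hε t
              · exact ((fderiv ℝ H t).le_opNorm v).trans (by gcongr; exact h2 t)
          _ = _ := by ring
    have i3 : Integrable (fun t => kE ε t * H t) := by
      refine Integrable.mono' (kern_zero.const_mul K) ?_
        (Filter.Eventually.of_forall fun t => ?_)
      · exact ((kc ε hε).mul (by fun_prop)).aestronglyMeasurable
      · have hs := sC_pos t
        rw [norm_mul]
        calc _ ≤ ‖t‖⁻¹ * (K * (sC t)⁻¹) := by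
              gcongr
              · exact kE_norm_le ε hε t
              · exact h1 t
          _ = _ := by ring
    have ib : ∀ v, ∫ t, kE ε t * fderiv ℝ H t v = - ∫ t, fderiv ℝ (kE ε) t v * H t := fun v =>
      integral_mul_fderiv_eq_neg_fderiv_mul_of_integrable (i1 v) (i2 v) i3
        (fun t _ => (kE_hasFDerivAt ε hε t).differentiableAt) (fun t _ => hd t)
    have e1 : ∀ t, kE ε t * dbar H t = (1/2) * (kE ε t * fderiv ℝ H t 1) +
        (Complex.I / 2) * (kE ε t * fderiv ℝ H t Complex.I) := fun t => by unfold dbar; ring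
    have e2 : ∀ t, ((ε ^ 2 * ((‖t‖ ^ 2 + ε ^ 2) ^ 2)⁻¹ : ℝ) : ℂ) * H t =
        (1/2) * (fderiv ℝ (kE ε) t 1 * H t) + (Complex.I / 2) * (fderiv ℝ (kE ε) t Complex.I * H t) :=
      fun t => by rw [← kE_dbar ε hε]; unfold dbar; ring
    simp_rw [e1, e2]
    rw [integral_add ((i2 1).const_mul _) ((i2 _).const_mul _),
      integral_add ((i1 1).const_mul _) ((i1 _).const_mul _)]
    simp_rw [integral_const_mul]
    rw [ib, ib]; ring
  -- scaling
  have sc : ∀ ε : ℝ, 0 < ε → ∫ t, ((ε ^ 2 * ((‖t‖ ^ 2 + ε ^ 2) ^ 2)⁻¹ : ℝ) : ℂ) * H t =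
      ∫ u, ((((sC u) ^ 2)⁻¹ : ℝ) : ℂ) * H (ε • u) := by
    intro ε hε
    have := Measure.integral_comp_smul (volume : Measure ℂ)
      (fun t : ℂ => ((ε ^ 2 * ((‖t‖ ^ 2 + ε ^ 2) ^ 2)⁻¹ : ℝ) : ℂ) * H t) ε
    rw [Complex.finrank_real_complex, abs_of_nonneg (by positivity)] at this
    have h3 : ∫ t, ((ε ^ 2 * ((‖t‖ ^ 2 + ε ^ 2) ^ 2)⁻¹ : ℝ) : ℂ) * H t = (ε ^ 2) • ((ε ^ 2)⁻¹ •
        ∫ t, ((ε ^ 2 * ((‖t‖ ^ 2 + ε ^ 2) ^ 2)⁻¹ : ℝ) : ℂ) * H t) := by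
      rw [smul_smul, mul_inv_cancel₀ (by positivity), one_smul]
    rw [h3, ← this, ← integral_smul]
    congr 1; ext u
    rw [Complex.real_smul, ← mul_assoc, ← Complex.ofReal_mul]
    congr 2
    rw [norm_smul, Real.norm_of_nonneg hε.le]
    have : sC u ≠ 0 := sC_ne u
    have e : (ε * ‖u‖) ^ 2 + ε ^ 2 = ε ^ 2 * sC u := by unfold sC; ring
    rw [e]; field_simp
  set e : ℕ → ℝ := fun n => 1 / ((n : ℝ) + 1) with he
  have e0 : ∀ n, 0 < e n := fun n => by simp only [he]; positivity
  have e1 : ∀ n, e n ≤ 1 := fun n => by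
    simp only [he]; rw [div_le_one (by positivity)]; linarith [(Nat.cast_nonneg n : (0:ℝ) ≤ n)]
  have et : Filter.Tendsto e Filter.atTop (nhds 0) := tendsto_one_div_add_atTop_nhds_zero_nat
  have L1 : Filter.Tendsto (fun n => ∫ t, kE (e n) t * dbar H t) Filter.atTop
      (nhds (∫ t, dbar H t / t)) := by
    refine tendsto_integral_of_dominated_convergence (fun t => ‖t‖⁻¹ * (K * (sC t)⁻¹)) ?_ ?_ ?_ ?_
    · exact fun n => ((kc _ (e0 n)).mul hdb).aestronglyMeasurable
    · refine (kern_zero.const_mul K).congr (Filter.Eventually.of_forall fun t => ?_)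
      simp only; ring
    · refine fun n => Filter.Eventually.of_forall fun t => ?_
      rw [norm_mul]
      gcongr
      · exact kE_norm_le _ (e0 n) t
      · exact (dbar_norm_le H t).trans (h2 t)
    · have h0 : ∀ᵐ t : ℂ, t ≠ 0 := by
        simp [ae_iff, measure_singleton]
      filter_upwards [h0] with t ht
      have hne : ‖t‖ ^ 2 + (0:ℝ) ^ 2 ≠ 0 := by simpa using ht
      have h3 : Filter.Tendsto (fun n => kE (e n) t) Filter.atTop (nhds (kE 0 t)) := by
        unfold kE
        refine Filter.Tendsto.const_mul _ ?_
        refine (Complex.continuous_ofReal.tendsto _).comp ?_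
        exact ((et.pow 2).const_add _).inv₀ hne
      have h4 : kE 0 t = t⁻¹ := by
        unfold kE
        rw [Complex.inv_def, Complex.normSq_eq_norm_sq]; simp
      rw [h4] at h3
      have := h3.mul_const (dbar H t)
      rwa [div_eq_inv_mul]
  have L2 : Filter.Tendsto (fun n => ∫ u, ((((sC u) ^ 2)⁻¹ : ℝ) : ℂ) * H (e n • u)) Filter.atTop
      (nhds (∫ u, ((((sC u) ^ 2)⁻¹ : ℝ) : ℂ) * H 0)) := by
    refine tendsto_integral_of_dominated_convergence (fun t => K * ((sC t) ^ 2)⁻¹) ?_ ?_ ?_ ?_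
    · intro n
      have := sC_cont
      have c3 := Complex.continuous_ofReal
      have : Continuous fun u => ((sC u) ^ 2)⁻¹ := Continuous.inv₀ (by fun_prop)
        (fun u => pow_ne_zero _ (sC_ne u))
      apply Continuous.aestronglyMeasurable; fun_prop
    · exact (integrable_sC_pow le_rfl).const_mul K
    · refine fun n => Filter.Eventually.of_forall fun t => ?_
      have hs := sC_pos t
      rw [norm_mul, Complex.norm_real, Real.norm_of_nonneg (by positivity), mul_comm]
      gcongr
      refine (h1 _).trans ?_
      have : (sC (e n • t))⁻¹ ≤ 1 := inv_le_one_of_one_le₀ (sC_one_le _)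
      nlinarith
    · refine Filter.Eventually.of_forall fun t => Filter.Tendsto.const_mul _ ?_
      have : Filter.Tendsto (fun n => e n • t) Filter.atTop (nhds 0) := by
        simpa using et.smul_const t
      exact (hcH.tendsto 0).comp this
  have L3 : (∫ u, ((((sC u) ^ 2)⁻¹ : ℝ) : ℂ) * H 0) = Real.pi * H 0 := by
    rw [integral_mul_const, integral_complex_ofReal, int_sC_pow 1 le_rfl]; simp
  rw [L3] at L2
  refine tendsto_nhds_unique L1 ?_
  refine L2.neg.congr fun n => ?_
  rw [ibp _ (e0 n) (e1 n), sc _ (e0 n)]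

lemma locInt_inv : LocallyIntegrable (fun t : ℂ => t⁻¹) volume := by
  have h1 : LocallyIntegrable (fun t : ℂ => t⁻¹ * ((sC t : ℝ) : ℂ)⁻¹) volume := by
    apply Integrable.locallyIntegrable
    refine kern_zero.mono' ?_ (Filter.Eventually.of_forall fun t => ?_)
    · have := sC_cont.measurable
      apply Measurable.aestronglyMeasurable; fun_prop
    · rw [norm_mul, norm_inv, norm_inv, Complex.norm_real, Real.norm_of_nonneg (sC_pos t).le]
  rw [locallyIntegrable_iff] at h1 ⊢
  intro k hk
  have c : Continuous (fun t => ((sC t : ℝ) : ℂ)) := Complex.continuous_ofReal.comp sC_cont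
  have := (h1 k hk).mul_continuousOn (c.continuousOn) hk
  refine this.congr_fun (fun t _ => ?_) hk.measurableSet
  have : ((sC t : ℝ) : ℂ) ≠ 0 := by exact_mod_cast sC_ne t
  field_simp

lemma CT_conv (h : ℂ → ℂ) : CT h = convolution (fun t : ℂ => t⁻¹) h (ContinuousLinearMap.mul ℝ ℂ) volume := by
  ext x
  rw [convolution_def]
  unfold CT
  rw [← integral_sub_left_eq_self _ volume x]
  congr 1; ext t
  simp [div_eq_inv_mul]

lemma CT_contDiff (h : ℂ → ℂ) (hs : HasCompactSupport h) (hh : ContDiff ℝ 1 h) : ContDiff ℝ 1 (CT h) := by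
  rw [CT_conv]
  exact hs.contDiff_convolution_right (n := 1) (ContinuousLinearMap.mul ℝ ℂ) locInt_inv hh

lemma CT_fderiv (h : ℂ → ℂ) (hs : HasCompactSupport h) (hh : ContDiff ℝ 1 h) (x v : ℂ) :
    fderiv ℝ (CT h) x v = CT (fun y => fderiv ℝ h y v) x := by
  have := hs.hasFDerivAt_convolution_right (ContinuousLinearMap.mul ℝ ℂ) locInt_inv hh x
  rw [← CT_conv] at this
  rw [this.fderiv, convolution_precompR_apply _ locInt_inv (hs.fderiv ℝ)
    (hh.continuous_fderiv (by norm_num)), CT_conv]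

lemma kern_int (h : ℂ → ℂ) (hc : Continuous h) (K : ℝ) (hK : ∀ z, ‖h z‖ ≤ K * (sC z)⁻¹) (x : ℂ) :
    Integrable (fun y => h y / (x - y)) := by
  obtain ⟨C, _, hk⟩ := kern_bound
  refine ((hk x).1.const_mul K).mono' ?_ (Filter.Eventually.of_forall fun t => ?_)
  · have := hc.measurable
    apply Measurable.aestronglyMeasurable; fun_prop
  · rw [norm_div, div_eq_mul_inv]
    calc _ ≤ (K * (sC t)⁻¹) * ‖x - t‖⁻¹ := by gcongr; exact hK t
      _ = _ := by ring

lemma cs_bound (h : ℂ → ℂ) (hs : HasCompactSupport h) (hc : Continuous h) :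
    ∃ K : ℝ, 0 < K ∧ ∀ z, ‖h z‖ * (1 + ‖z‖) ≤ K * (sC z)⁻¹ := by
  have h1 : HasCompactSupport (fun z => h z * (((1 + ‖z‖) * sC z : ℝ) : ℂ)) := hs.mul_right
  have c := sC_cont
  have c3 := Complex.continuous_ofReal
  obtain ⟨K, hK⟩ := h1.exists_bound_of_continuous (by fun_prop)
  refine ⟨max K 1, by positivity, fun z => ?_⟩
  have := hK z
  have hp := sC_pos z
  rw [norm_mul, Complex.norm_real, Real.norm_of_nonneg (by positivity)] at this
  rw [← div_eq_mul_inv, le_div_iff₀ hp]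
  calc _ = ‖h z‖ * ((1 + ‖z‖) * sC z) := by ring
    _ ≤ _ := this.trans (le_max_left _ _)

lemma cs_bound' (h : ℂ → ℂ) (hs : HasCompactSupport h) (hc : Continuous h) :
    ∃ K : ℝ, 0 < K ∧ ∀ z, ‖h z‖ ≤ K * (sC z)⁻¹ := by
  obtain ⟨K, hK, h'⟩ := cs_bound h hs hc
  refine ⟨K, hK, fun z => le_trans ?_ (h' z)⟩
  nlinarith [norm_nonneg z, mul_nonneg (norm_nonneg (h z)) (norm_nonneg z)]

lemma CT_decay (h : ℂ → ℂ) (hs : HasCompactSupport h) (hc : Continuous h) :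
    ∃ K : ℝ, 0 < K ∧ ∀ x, (1 + ‖x‖) * ‖CT h x‖ ≤ K := by
  obtain ⟨K, hK, hb⟩ := cs_bound h hs hc
  obtain ⟨C, hC, hk⟩ := kern_bound
  have hi : Integrable (fun y => ‖h y‖) := (hc.integrable_of_hasCompactSupport hs).norm
  refine ⟨K * C + ∫ y, ‖h y‖ , by have : 0 ≤ ∫ y, ‖h y‖ := integral_nonneg fun y => norm_nonneg _
                                  positivity, fun x => ?_⟩
  calc (1 + ‖x‖) * ‖CT h x‖ ≤ (1 + ‖x‖) * ∫ y, ‖h y / (x - y)‖ := by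
        gcongr; exact norm_integral_le_integral_norm _
    _ = ∫ y, (1 + ‖x‖) * ‖h y / (x - y)‖ := (integral_const_mul _ _).symm
    _ ≤ ∫ y, (K * (‖x - y‖⁻¹ * (sC y)⁻¹) + ‖h y‖) := by
        refine integral_mono_of_nonneg (Filter.Eventually.of_forall fun y => by positivity)
          (((hk x).1.const_mul K).add hi) (Filter.Eventually.of_forall fun y => ?_)
        simp only
        rw [norm_div, div_eq_mul_inv]
        have h1 : (1 + ‖x‖) * ‖x - y‖⁻¹ ≤ (1 + ‖y‖) * ‖x - y‖⁻¹ + 1 := by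
          rcases eq_or_ne (x - y) 0 with h0 | h0
          · rw [h0]; simp
          · have h0 : 0 < ‖x - y‖ := norm_pos_iff.2 h0
            have : ‖x‖ ≤ ‖x - y‖ + ‖y‖ := by simpa using norm_add_le (x - y) y
            have e : (1 + ‖y‖) * ‖x - y‖⁻¹ + 1 = (1 + ‖y‖ + ‖x - y‖) * ‖x - y‖⁻¹ := by field_simp
            rw [e]; gcongr ?_ * _; linarith
        calc (1 + ‖x‖) * (‖h y‖ * ‖x - y‖⁻¹) = ‖h y‖ * ((1 + ‖x‖) * ‖x - y‖⁻¹) := by ring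
          _ ≤ ‖h y‖ * ((1 + ‖y‖) * ‖x - y‖⁻¹ + 1) := by gcongr
          _ = (‖h y‖ * (1 + ‖y‖)) * ‖x - y‖⁻¹ + ‖h y‖ := by ring
          _ ≤ (K * (sC y)⁻¹) * ‖x - y‖⁻¹ + ‖h y‖ := by gcongr ?_ * _ + _; exact hb y
          _ = _ := by ring
    _ = K * (∫ y, ‖x - y‖⁻¹ * (sC y)⁻¹) + ∫ y, ‖h y‖ := by
        rw [integral_add ((hk x).1.const_mul K) hi, integral_const_mul]
    _ ≤ _ := by gcongr; exact (hk x).2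

lemma sC_shift (x z : ℂ) : (sC (x + z))⁻¹ ≤ 2 * sC x * (sC z)⁻¹ := by
  have h1 := sC_pos (x + z)
  have h2 := sC_pos z
  rw [← div_eq_mul_inv, inv_eq_one_div, div_le_div_iff₀ h1 h2]
  have : ‖z‖ ≤ ‖x + z‖ + ‖x‖ := by
    have := norm_sub_le (x + z) x
    simpa using this
  have h3 : ‖z‖ ^ 2 ≤ (‖x + z‖ + ‖x‖) ^ 2 := by gcongr
  unfold sC
  nlinarith [sq_nonneg (‖x + z‖ - ‖x‖), mul_nonneg (sq_nonneg ‖x‖) (sq_nonneg ‖x + z‖)]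

lemma CPx (H : ℂ → ℂ) (hH : ContDiff ℝ 1 H) (K : ℝ) (h1 : ∀ z, ‖H z‖ ≤ K * (sC z)⁻¹)
    (h2 : ∀ z, ‖fderiv ℝ H z‖ ≤ K * (sC z)⁻¹) (x : ℂ) :
    CT (dbar H) x = Real.pi * H x := by
  have hK : 0 ≤ K := by
    have := (norm_nonneg _).trans (h1 0)
    simpa [sC] using this
  have hf : ∀ z, fderiv ℝ (fun z => H (x + z)) z = fderiv ℝ H (x + z) := fun z => fderiv_comp_add_left x
  have := CP (fun z => H (x + z)) (by fun_prop) (K * (2 * sC x))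
    (fun z => (h1 _).trans (by rw [mul_assoc]; gcongr; exact sC_shift x z))
    (fun z => by rw [hf]; exact (h2 _).trans (by rw [mul_assoc]; gcongr; exact sC_shift x z))
  simp only [add_zero] at this
  have e : CT (dbar H) x = - ∫ t, dbar (fun z => H (x + z)) t / t := by
    unfold CT
    rw [← integral_add_left_eq_self _ x, ← integral_neg]
    congr 1; ext t
    unfold dbar
    rw [hf]
    simp [div_neg]
  rw [e, this]; ring

def dzz (H : ℂ → ℂ) (z : ℂ) : ℂ := (fderiv ℝ H z 1 - Complex.I * fderiv ℝ H z Complex.I) / 2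

lemma rl_decomp (L : ℂ →L[ℝ] ℂ) (v : ℂ) :
    L v = v.re • L 1 + v.im • L Complex.I := by
  rw [← map_smul, ← map_smul, ← map_add]
  congr 1
  apply Complex.ext <;> simp

lemma fderiv_decomp (H : ℂ → ℂ) (z v : ℂ) :
    fderiv ℝ H z v = dzz H z * v + dbar H z * (starRingEnd ℂ) v := by
  rw [rl_decomp, dzz, dbar]
  generalize fderiv ℝ H z 1 = a
  generalize fderiv ℝ H z Complex.I = c
  apply Complex.ext <;> simp <;> ring

lemma CT_fderiv_decay (h : ℂ → ℂ) (hs : HasCompactSupport h) (hh : ContDiff ℝ 1 h) :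
    ∃ K : ℝ, 0 < K ∧ ∀ x, (1 + ‖x‖) * ‖fderiv ℝ (CT h) x‖ ≤ K := by
  have hc : Continuous (fderiv ℝ h) := hh.continuous_fderiv (by norm_num)
  obtain ⟨K1, p1, hK1⟩ := CT_decay _ (hs.fderiv_apply ℝ 1) (by fun_prop)
  obtain ⟨K2, p2, hK2⟩ := CT_decay _ (hs.fderiv_apply ℝ Complex.I) (by fun_prop)
  refine ⟨K1 + K2, by positivity, fun x => ?_⟩
  have hx : 0 < 1 + ‖x‖ := by positivity
  have a1 := hK1 x
  have a2 := hK2 x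
  rw [← CT_fderiv h hs hh] at a1 a2
  rw [mul_comm, ← le_div_iff₀ hx]
  refine ContinuousLinearMap.opNorm_le_bound _ (by positivity) fun v => ?_
  rw [rl_decomp]
  have e1 : ‖fderiv ℝ (CT h) x 1‖ ≤ K1 / (1 + ‖x‖) := by rw [le_div_iff₀ hx, mul_comm]; exact a1
  have e2 : ‖fderiv ℝ (CT h) x Complex.I‖ ≤ K2 / (1 + ‖x‖) := by rw [le_div_iff₀ hx, mul_comm]; exact a2
  refine (norm_add_le _ _).trans ?_
  rw [norm_smul, norm_smul, Real.norm_eq_abs, Real.norm_eq_abs, add_div, add_mul, mul_comm, mul_comm |v.im|]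
  gcongr
  · exact Complex.abs_re_le_norm v
  · exact Complex.abs_im_le_norm v

lemma CT_dbar (h : ℂ → ℂ) (hs : HasCompactSupport h) (hh : ContDiff ℝ 1 h) (x : ℂ) :
    dbar (CT h) x = Real.pi * h x := by
  have hc : Continuous (fderiv ℝ h) := hh.continuous_fderiv (by norm_num)
  have cc := hh.continuous
  have i : ∀ v, Integrable (fun y => fderiv ℝ h y v / (x - y)) := fun v => by
    obtain ⟨K, _, hK⟩ := cs_bound' _ (hs.fderiv_apply ℝ v) (by fun_prop)
    exact kern_int _ (by fun_prop) K hK x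
  obtain ⟨K1, p1, hK1⟩ := cs_bound' h hs cc
  have c2 : HasCompactSupport (fun z => ((‖fderiv ℝ h z‖ : ℝ) : ℂ)) := (hs.fderiv ℝ).norm.comp_left (g := Complex.ofReal) rfl
  obtain ⟨K2, p2, hK2⟩ := cs_bound' _ c2 (Complex.continuous_ofReal.comp hc.norm)
  have := CPx h hh (max K1 K2) (fun z => (hK1 z).trans (by have := sC_pos z; gcongr; exact le_max_left _ _))
    (fun z => by
      have h3 := hK2 z
      rw [Complex.norm_real, norm_norm] at h3
      exact h3.trans (by have := sC_pos z; gcongr; exact le_max_right _ _)) x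
  rw [← this, dbar, CT_fderiv h hs hh, CT_fderiv h hs hh]
  unfold CT
  rw [← integral_const_mul, ← integral_add (i 1) ((i _).const_mul _), div_eq_inv_mul, ← integral_const_mul]
  congr 1; ext y
  unfold dbar; ring

lemma CT_dzz (h : ℂ → ℂ) (hs : HasCompactSupport h) (hh : ContDiff ℝ 1 h) (x : ℂ) :
    dzz (CT h) x = CT (dzz h) x := by
  have hc : Continuous (fderiv ℝ h) := hh.continuous_fderiv (by norm_num)
  have i : ∀ v, Integrable (fun y => fderiv ℝ h y v / (x - y)) := fun v => by
    obtain ⟨K, _, hK⟩ := cs_bound' _ (hs.fderiv_apply ℝ v) (by fun_prop)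
    exact kern_int _ (by fun_prop) K hK x
  rw [dzz, CT_fderiv h hs hh, CT_fderiv h hs hh]
  unfold CT
  rw [← integral_const_mul, ← integral_sub (i 1) ((i _).const_mul _), div_eq_inv_mul, ← integral_const_mul]
  congr 1; ext y
  unfold dzz; ring

lemma kE_contDiff : ContDiff ℝ 1 (kE 1) := by
  unfold kE
  have h1 : ContDiff ℝ 1 (fun t : ℂ => (starRingEnd ℂ) t) := Complex.conjCLE.contDiff
  have h2 : ContDiff ℝ 1 (fun t : ℂ => (‖t‖ ^ 2 + 1 ^ 2)⁻¹) := by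
    apply ContDiff.inv
    · exact (contDiff_norm_sq ℝ).add contDiff_const
    · intro t; positivity
  exact h1.mul (Complex.ofRealCLM.contDiff.comp h2)

lemma kE_one_norm (t : ℂ) : ‖kE 1 t‖ = ‖t‖ * (sC t)⁻¹ := by
  unfold kE sC
  rw [norm_mul, RCLike.norm_conj, Complex.norm_real, Real.norm_of_nonneg (by positivity)]
  ring_nf

lemma kE_one_dbar (t : ℂ) : dbar (kE 1) t = (((sC t ^ 2)⁻¹ : ℝ) : ℂ) := by
  rw [kE_dbar 1 one_pos]; unfold sC; congr 1; ring

lemma dbar_mul (F G : ℂ → ℂ) (hF : Differentiable ℝ F) (hG : Differentiable ℝ G) (z : ℂ) :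
    dbar (fun z => F z * G z) z = F z * dbar G z + G z * dbar F z := by
  unfold dbar
  rw [fderiv_fun_mul (hF z) (hG z)]
  simp; ring

/-- `q` identity, scaled by π. -/
lemma q_identity (h : ℂ → ℂ) (hs : HasCompactSupport h) (hh : ContDiff ℝ 1 h) (x : ℂ) :
    dzz (CT h) x + 2 * kE 1 x * CT h x =
      CT (fun y => dzz h y + 2 * kE 1 y * h y +
        ((2 * (sC y ^ 2)⁻¹ * Real.pi⁻¹ : ℝ) : ℂ) * CT h y) x := by
  have hc : Continuous (fderiv ℝ h) := hh.continuous_fderiv (by norm_num)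
  have cc := hh.continuous
  have kc := kE_contDiff.continuous
  have Ac := CT_contDiff h hs hh
  have Acc := Ac.continuous
  have hA := Ac.differentiable (by norm_num)
  have hk := kE_contDiff.differentiable (by norm_num)
  obtain ⟨K1, p1, hK1⟩ := CT_decay h hs cc
  obtain ⟨K2, p2, hK2⟩ := CT_fderiv_decay h hs hh
  have e := CPx (fun z => kE 1 z * CT h z) (kE_contDiff.mul Ac) (3 * K1 + K2) (fun z => by
      have hs := sC_pos z
      rw [norm_mul, kE_one_norm]
      calc ‖z‖ * (sC z)⁻¹ * ‖CT h z‖ = (‖z‖ * ‖CT h z‖) * (sC z)⁻¹ := by ring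
        _ ≤ (3 * K1 + K2) * (sC z)⁻¹ := by
          gcongr
          nlinarith [hK1 z, norm_nonneg (CT h z)]) (fun z => by
      have hs := sC_pos z
      rw [fderiv_fun_mul (hk z) (hA z)]
      have n1 : ‖fderiv ℝ (kE 1) z‖ ≤ 3 * (sC z)⁻¹ := by
        refine ContinuousLinearMap.opNorm_le_bound _ (by positivity) fun v => ?_
        simpa using kE_fderiv_le 1 one_pos le_rfl z v
      refine (norm_add_le _ _).trans ?_
      rw [norm_smul, norm_smul, kE_one_norm]
      calc ‖z‖ * (sC z)⁻¹ * ‖fderiv ℝ (CT h) z‖ + ‖CT h z‖ * ‖fderiv ℝ (kE 1) z‖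
          ≤ (‖z‖ * ‖fderiv ℝ (CT h) z‖) * (sC z)⁻¹ + K1 * (3 * (sC z)⁻¹) := by
            have : ‖CT h z‖ ≤ K1 := by
              nlinarith [hK1 z, norm_nonneg (CT h z), mul_nonneg (norm_nonneg z) (norm_nonneg (CT h z))]
            have e : ‖z‖ * (sC z)⁻¹ * ‖fderiv ℝ (CT h) z‖ = (‖z‖ * ‖fderiv ℝ (CT h) z‖) * (sC z)⁻¹ := by ring
            rw [e]
            gcongr
        _ ≤ K2 * (sC z)⁻¹ + K1 * (3 * (sC z)⁻¹) := by
            gcongr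
            nlinarith [hK2 z, norm_nonneg (fderiv ℝ (CT h) z)]
        _ = _ := by ring) x
  have e2 : dbar (fun z => kE 1 z * CT h z) = fun z => Real.pi * (kE 1 z * h z) +
      (((sC z ^ 2)⁻¹ : ℝ) : ℂ) * CT h z := by
    ext z
    rw [dbar_mul _ _ hk hA, CT_dbar h hs hh, kE_one_dbar]; ring
  rw [e2] at e
  have pi0 : (Real.pi : ℂ) ≠ 0 := by exact_mod_cast Real.pi_ne_zero
  have e3 : kE 1 x * CT h x = (Real.pi : ℂ)⁻¹ * CT (fun z => Real.pi * (kE 1 z * h z) +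
      (((sC z ^ 2)⁻¹ : ℝ) : ℂ) * CT h z) x := by rw [e]; field_simp
  rw [mul_assoc, e3, CT_dzz h hs hh]
  have cdz : Continuous (dzz h) := by unfold dzz; fun_prop
  have csd : HasCompactSupport (dzz h) := by
    have : dzz h = fun z => (fderiv ℝ h z 1 - Complex.I * fderiv ℝ h z Complex.I) * 2⁻¹ := by
      ext z; rw [dzz, div_eq_mul_inv]
    rw [this]
    exact ((hs.fderiv_apply ℝ 1).sub ((hs.fderiv_apply ℝ Complex.I).mul_left)).mul_right
  have i1 : Integrable (fun y => dzz h y / (x - y)) := by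
    obtain ⟨K, _, hK⟩ := cs_bound' _ csd cdz
    exact kern_int _ cdz K hK x
  have csk : HasCompactSupport (fun z => Real.pi * (kE 1 z * h z)) := (hs.mul_left).mul_left
  have sc2 : Continuous (fun z => (((sC z ^ 2)⁻¹ : ℝ) : ℂ)) := by
    have := sC_cont
    refine Complex.continuous_ofReal.comp (Continuous.inv₀ (by fun_prop) fun z => pow_ne_zero _ (sC_ne z))
  have i2 : Integrable (fun y => (Real.pi * (kE 1 y * h y) + (((sC y ^ 2)⁻¹ : ℝ) : ℂ) * CT h y) / (x - y)) := by
    obtain ⟨K, _, hK⟩ := cs_bound' _ csk (by fun_prop)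
    refine kern_int _ (by fun_prop) (K + K1) (fun z => ?_) x
    refine (norm_add_le _ _).trans ?_
    rw [add_mul]
    refine add_le_add (hK z) ?_
    have hs := sC_pos z
    rw [norm_mul, Complex.norm_real, Real.norm_of_nonneg (by positivity), mul_comm]
    have : ‖CT h z‖ ≤ K1 := by
      nlinarith [hK1 z, norm_nonneg (CT h z), mul_nonneg (norm_nonneg z) (norm_nonneg (CT h z))]
    gcongr
    exact le_self_pow₀ (sC_one_le z) (by norm_num)
  have key : ∀ A : ℂ → ℂ, Integrable (fun y => (Real.pi * (kE 1 y * h y) +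
      (((sC y ^ 2)⁻¹ : ℝ) : ℂ) * A y) / (x - y)) →
      CT (dzz h) x + 2 * ((Real.pi : ℂ)⁻¹ * CT (fun z => Real.pi * (kE 1 z * h z) +
      (((sC z ^ 2)⁻¹ : ℝ) : ℂ) * A z) x) = CT (fun y => dzz h y + 2 * kE 1 y * h y +
        ((2 * (sC y ^ 2)⁻¹ * Real.pi⁻¹ : ℝ) : ℂ) * A y) x := by
    intro A i2
    unfold CT
    rw [← integral_const_mul, ← integral_const_mul, ← integral_add i1 ((i2.const_mul _).const_mul _)]
    congr 1; ext y
    push_cast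
    field_simp
    ring
  exact key _ i2

lemma cs_real {X : Type*} [MeasurableSpace X] (μ : Measure X) (u v : X → ℝ)
    (hu : Integrable (fun x => u x ^ 2) μ)
    (hv : Integrable (fun x => v x ^ 2) μ) (huv : Integrable (fun x => u x * v x) μ) :
    (∫ x, u x * v x ∂μ) ^ 2 ≤ (∫ x, u x ^ 2 ∂μ) * ∫ x, v x ^ 2 ∂μ := by
  have h : ∀ t : ℝ, 0 ≤ (∫ x, u x ^ 2 ∂μ) * (t * t) + (-2 * ∫ x, u x * v x ∂μ) * t + ∫ x, v x ^ 2 ∂μ := by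
    intro t
    have e : ∫ x, (t * u x - v x) ^ 2 ∂μ = (∫ x, u x ^ 2 ∂μ) * (t * t) + (-2 * ∫ x, u x * v x ∂μ) * t + ∫ x, v x ^ 2 ∂μ := by
      have : ∀ x, (t * u x - v x) ^ 2 = (u x ^ 2 * (t * t) + (u x * v x) * (-2 * t)) + v x ^ 2 := fun x => by ring
      simp_rw [this]
      rw [integral_add ((hu.mul_const _).fun_add (huv.mul_const _)) hv, integral_add (hu.mul_const _) (huv.mul_const _),
        integral_mul_const, integral_mul_const]
      ring
    rw [← e]
    exact integral_nonneg fun x => sq_nonneg _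
  have := discrim_le_zero h
  unfold discrim at this
  nlinarith

lemma sC_hasFDerivAt (z : ℂ) : HasFDerivAt sC (2 • innerSL ℝ z) z :=
  ((hasStrictFDerivAt_norm_sq z).hasFDerivAt).const_add _

lemma sC_fderiv_apply (z v : ℂ) : (2 • innerSL ℝ z : ℂ →L[ℝ] ℝ) v = 2 * (z.re * v.re + z.im * v.im) := by
  simp [Complex.inner, innerSL_apply_apply]
  ring

lemma sC_contDiff : ContDiff ℝ 1 sC := by
  unfold sC; exact contDiff_const.add (contDiff_norm_sq ℝ)

lemma int_fderiv_zero (h : ℂ → ℝ) (hs : HasCompactSupport h) (hh : ContDiff ℝ 1 h) (v : ℂ) :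
    ∫ z, fderiv ℝ h z v = 0 := by
  have hc : Continuous (fderiv ℝ h) := hh.continuous_fderiv (by norm_num)
  have := integral_mul_fderiv_eq_neg_fderiv_mul_of_integrable (μ := (volume : Measure ℂ)) (f := fun _ => (1:ℝ)) (g := h) (v := v)
    (by simp) (by simpa using (Continuous.integrable_of_hasCompactSupport (by fun_prop) (hs.fderiv_apply ℝ v)))
    (by simpa using (hh.continuous.integrable_of_hasCompactSupport hs)) (fun x _ => by fun_prop)
    (fun x _ => hh.differentiable (by norm_num) x)
  simpa using this

lemma sC_inv_hasFDerivAt (n : ℕ) (z : ℂ) :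
    HasFDerivAt (fun z => ((sC z) ^ n)⁻¹) ((-(n * (sC z)⁻¹ * ((sC z) ^ n)⁻¹)) • (2 • innerSL ℝ z : ℂ →L[ℝ] ℝ)) z := by
  have hp := sC_pos z
  have h := (((hasDerivAt_pow n (sC z)).inv (pow_pos hp n).ne')).comp_hasFDerivAt z (sC_hasFDerivAt z)
  refine h.congr_fderiv ?_
  congr 1
  rcases n with _ | m
  · simp
  · simp only [Nat.add_sub_cancel]; field_simp; ring

lemma sC_inv_cont (n : ℕ) : Continuous (fun z => ((sC z) ^ n)⁻¹) :=
  continuous_iff_continuousAt.2 fun z => (sC_inv_hasFDerivAt n z).continuousAt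

lemma sC_inv_contDiff (n : ℕ) : ContDiff ℝ 1 (fun z => ((sC z) ^ n)⁻¹) :=
  (sC_contDiff.pow n).inv fun z => pow_ne_zero _ (sC_ne z)

lemma hardy_piece (g : ℂ → ℝ) (hg : ContDiff ℝ 1 g) :
    ∀ (ℓ : ℂ →L[ℝ] ℝ) (v : ℂ), ∀ z, fderiv ℝ (fun z => ℓ z * (((sC z) ^ 3)⁻¹ * g z ^ 2)) z v =
    ℓ v * (((sC z) ^ 3)⁻¹ * g z ^ 2) - ℓ z * (6 * (z.re * v.re + z.im * v.im)) * (((sC z) ^ 4)⁻¹ * g z ^ 2)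
     + 2 * ℓ z * (((sC z) ^ 3)⁻¹ * g z * fderiv ℝ g z v) := by
  intro ℓ v z
  have hgz := (hg.differentiable (by norm_num) z).hasFDerivAt
  have h := ℓ.hasFDerivAt (x := z) |>.fun_mul ((sC_inv_hasFDerivAt 3 z).fun_mul (hgz.pow 2))
  rw [HasFDerivAt.fderiv h]
  have := sC_ne z
  simp only [ContinuousLinearMap.add_apply, ContinuousLinearMap.smul_apply, sC_fderiv_apply, smul_eq_mul]
  simp
  field_simp
  ring

lemma hardy_pt (g : ℂ → ℝ) (hg : ContDiff ℝ 1 g) (z : ℂ) :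
    fderiv ℝ (fun z => Complex.reCLM z * (((sC z) ^ 3)⁻¹ * g z ^ 2)) z 1 +
      fderiv ℝ (fun z => Complex.imCLM z * (((sC z) ^ 3)⁻¹ * g z ^ 2)) z Complex.I ≤
      ((-3) * (((sC z) ^ 3)⁻¹ * g z ^ 2) + 6 * (((sC z) ^ 4)⁻¹ * g z ^ 2) +
        ((sC z) ^ 2)⁻¹ * ‖fderiv ℝ g z‖ ^ 2) := by
  have piece := hardy_piece g hg
  simp only [piece]
  have hsz := sC_pos z
  simp only [Complex.reCLM_apply, Complex.imCLM_apply, Complex.one_re, Complex.one_im, Complex.I_re, Complex.I_im]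
  have hd : z.re * fderiv ℝ g z 1 + z.im * fderiv ℝ g z Complex.I = fderiv ℝ g z z := by
    have : z = z.re • (1:ℂ) + z.im • Complex.I := by apply Complex.ext <;> simp
    conv_rhs => arg 2; rw [this]
    rw [map_add, map_smul, map_smul]; simp
  have hd2 : |fderiv ℝ g z z| ≤ ‖fderiv ℝ g z‖ * ‖z‖ := (fderiv ℝ g z).le_opNorm z
  have hsq : (fderiv ℝ g z z) ^ 2 ≤ ‖fderiv ℝ g z‖ ^ 2 * ‖z‖ ^ 2 := by
    rw [← mul_pow]; exact sq_le_sq' (by linarith [abs_le.1 hd2]) (abs_le.1 hd2).2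
  have e4 : ((sC z) ^ 3)⁻¹ = sC z * ((sC z) ^ 4)⁻¹ := by field_simp
  have e2 : ((sC z) ^ 2)⁻¹ = sC z ^ 2 * ((sC z) ^ 4)⁻¹ := by field_simp
  have hs' := sC_eq z
  have hn : ‖z‖ ^ 2 = sC z - 1 := by unfold sC; ring
  have W : 0 < ((sC z) ^ 4)⁻¹ := by positivity
  rw [e4, e2]
  rw [hn] at hsq
  generalize ((sC z) ^ 4)⁻¹ = w at *
  have : 2 * (g z * fderiv ℝ g z z) ≤ g z ^ 2 + fderiv ℝ g z z ^ 2 := by nlinarith [sq_nonneg (g z - fderiv ℝ g z z)]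
  have t1 : 2 * (sC z * (g z * fderiv ℝ g z z)) ≤ sC z * g z ^ 2 + sC z ^ 2 * ‖fderiv ℝ g z‖ ^ 2 := by
    have h1 : fderiv ℝ g z z ^ 2 ≤ sC z * ‖fderiv ℝ g z‖ ^ 2 := by nlinarith [sq_nonneg ‖fderiv ℝ g z‖]
    have h2 := mul_le_mul_of_nonneg_left (this.trans (add_le_add_right h1 _)) hsz.le
    nlinarith
  have t2 := mul_le_mul_of_nonneg_left t1 W.le
  rw [← hd] at t2
  have hxy : z.re ^ 2 + z.im ^ 2 = sC z - 1 := by rw [hs']; ring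
  have : z.im ^ 2 = sC z - 1 - z.re ^ 2 := by linarith
  have key : 6 * (z.re ^ 2 + z.im ^ 2) * (w * g z ^ 2) = 6 * (sC z - 1) * (w * g z ^ 2) := by rw [hxy]
  linarith [t2, key]

lemma hardy_abs (A B P Q R : ℂ → ℝ) (hA : Integrable A) (hB : Integrable B) (hP : Integrable P)
    (hQ : Integrable Q) (hR : Integrable R) (A0 : ∫ z, A z = 0) (B0 : ∫ z, B z = 0)
    (h : ∀ z, A z + B z ≤ (-3) * P z + 6 * Q z + R z) :
    3 * ∫ z, P z ≤ 6 * (∫ z, Q z) + ∫ z, R z := by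
  have le := integral_mono (hA.fun_add hB) (((hP.const_mul (-3)).fun_add (hQ.const_mul 6)).fun_add hR) h
  rw [integral_add hA hB, A0, B0] at le
  rw [integral_add ((hP.const_mul _).fun_add (hQ.const_mul _)) hR, integral_add (hP.const_mul _) (hQ.const_mul _),
    integral_const_mul, integral_const_mul] at le
  linarith

lemma hardy (g : ℂ → ℝ) (hs : HasCompactSupport g) (hg : ContDiff ℝ 1 g) :
    3 * ∫ z, ((sC z) ^ 3)⁻¹ * g z ^ 2 ≤ 6 * (∫ z, ((sC z) ^ 4)⁻¹ * g z ^ 2) +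
      ∫ z, ((sC z) ^ 2)⁻¹ * ‖fderiv ℝ g z‖ ^ 2 := by
  have hc : Continuous (fderiv ℝ g) := hg.continuous_fderiv (by norm_num)
  have cc := hg.continuous
  have c3 := sC_inv_cont 3
  have c4 := sC_inv_cont 4
  have c2 := sC_inv_cont 2
  have cre := Complex.continuous_re
  have cim := Complex.continuous_im
  have hs2 : HasCompactSupport (fun z => g z ^ 2) := by
    have : (fun z => g z ^ 2) = fun z => g z * g z := by ext; ring
    rw [this]; exact hs.mul_left
  have hsf : HasCompactSupport (fun z => ‖fderiv ℝ g z‖ ^ 2) := by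
    have : (fun z => ‖fderiv ℝ g z‖ ^ 2) = fun z => ‖fderiv ℝ g z‖ * ‖fderiv ℝ g z‖ := by ext; ring
    rw [this]; exact ((hs.fderiv ℝ).norm).mul_left
  have i3 : Integrable (fun z => ((sC z) ^ 3)⁻¹ * g z ^ 2) :=
    Continuous.integrable_of_hasCompactSupport (by fun_prop) hs2.mul_left
  have i4 : Integrable (fun z => ((sC z) ^ 4)⁻¹ * g z ^ 2) :=
    Continuous.integrable_of_hasCompactSupport (by fun_prop) hs2.mul_left
  have i2 : Integrable (fun z => ((sC z) ^ 2)⁻¹ * ‖fderiv ℝ g z‖ ^ 2) :=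
    Continuous.integrable_of_hasCompactSupport (by fun_prop) hsf.mul_left
  -- the two divergence pieces
  have j : ∀ (ℓ : ℂ →L[ℝ] ℝ) (v : ℂ), Integrable (fun z => fderiv ℝ (fun z => ℓ z * (((sC z) ^ 3)⁻¹ * g z ^ 2)) z v) := by
    intro ℓ v
    refine Continuous.integrable_of_hasCompactSupport ?_ (HasCompactSupport.fderiv_apply ℝ (hs2.mul_left.mul_left) v)
    have : ContDiff ℝ 1 (fun z => ℓ z * (((sC z) ^ 3)⁻¹ * g z ^ 2)) :=
      (ℓ.contDiff.mul ((sC_inv_contDiff 3).mul (hg.pow 2)))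
    have := this.continuous_fderiv (by norm_num)
    fun_prop
  have zz : ∀ (ℓ : ℂ →L[ℝ] ℝ) (v : ℂ), ∫ z, fderiv ℝ (fun z => ℓ z * (((sC z) ^ 3)⁻¹ * g z ^ 2)) z v = 0 :=
by
    intro ℓ v
    have h1 : ContDiff ℝ 1 (fun z => ℓ z * (((sC z) ^ 3)⁻¹ * g z ^ 2)) :=
      (ℓ.contDiff.mul ((sC_inv_contDiff 3).mul (hg.pow 2)))
    have h2 : HasCompactSupport (fun z => ℓ z * (((sC z) ^ 3)⁻¹ * g z ^ 2)) := hs2.mul_left.mul_left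
    exact int_fderiv_zero _ h2 h1 v
  exact hardy_abs _ _ _ _ _ (j Complex.reCLM 1) (j Complex.imCLM Complex.I) i3 i4 i2 (zz Complex.reCLM 1)
    (zz Complex.imCLM Complex.I) (fun z => hardy_pt g hg z)

def gG (f : ℂ → ℝ) (z : ℂ) : ℝ := f z * sC z ^ 2 / 8
def fC (f : ℂ → ℝ) (z : ℂ) : ℂ := (f z : ℂ)
def AA (f : ℂ → ℝ) (z : ℂ) : ℂ := ((Real.pi⁻¹ : ℝ) : ℂ) * CT (fC f) z
def QQ (f : ℂ → ℝ) (z : ℂ) : ℂ := ((Real.pi⁻¹ : ℝ) : ℂ) * (dzz (CT (fC f)) z + 2 * kE 1 z * CT (fC f) z)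
def LA (a : ℂ) : ℂ →L[ℝ] ℝ := Complex.reCLM.comp (ContinuousLinearMap.mul ℝ ℂ a)
def dW (f : ℂ → ℝ) (z : ℂ) : ℂ →L[ℝ] ℝ := fderiv ℝ (gG f) z + (1/2 : ℝ) • LA (AA f z)

lemma LA_apply (a v : ℂ) : LA a v = a.re * v.re - a.im * v.im := by
  simp [LA, Complex.mul_re]

lemma LA_norm (a : ℂ) : ‖LA a‖ ≤ ‖a‖ := by
  refine ContinuousLinearMap.opNorm_le_bound _ (norm_nonneg _) fun v => ?_
  have : LA a v = (a * v).re := rfl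
  rw [this, ← norm_mul, Real.norm_eq_abs]
  exact Complex.abs_re_le_norm _

lemma gG_hasFDerivAt (f : ℂ → ℝ) (z : ℂ) (hf : DifferentiableAt ℝ f z) :
    HasFDerivAt (gG f) ((sC z ^ 2 / 8) • fderiv ℝ f z + (f z * sC z / 2) • innerSL ℝ z) z := by
  have h := (hf.hasFDerivAt.fun_mul ((sC_hasFDerivAt z).pow 2)).mul_const (1/8 : ℝ)
  have e : gG f = fun y => f y * sC y ^ 2 * (1/8) := by ext; unfold gG; ring
  rw [e]
  refine h.congr_fderiv ?_
  ext v
  simp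
  ring

lemma gG_fderiv (f : ℂ → ℝ) (z : ℂ) (hf : DifferentiableAt ℝ f z) (v : ℂ) :
    fderiv ℝ (gG f) z v = sC z ^ 2 / 8 * fderiv ℝ f z v + f z * sC z / 2 * (z.re * v.re + z.im * v.im) := by
  rw [(gG_hasFDerivAt f z hf).fderiv]
  simp [Complex.inner]
  left; ring

lemma dW_apply (f : ℂ → ℝ) (z : ℂ) (hf : DifferentiableAt ℝ f z) (v : ℂ) :
    dW f z v = sC z ^ 2 / 8 * fderiv ℝ f z v + f z * sC z / 2 * (z.re * v.re + z.im * v.im)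
      + 1 / 2 * ((AA f z).re * v.re - (AA f z).im * v.im) := by
  simp only [dW, add_apply, smul_apply, smul_eq_mul, LA_apply, gG_fderiv f z hf]

lemma fC_fderiv (f : ℂ → ℝ) (z : ℂ) (hf : DifferentiableAt ℝ f z) (v : ℂ) :
    fderiv ℝ (fC f) z v = (fderiv ℝ f z v : ℂ) := by
  have := (Complex.ofRealCLM.hasFDerivAt (x := f z)).comp z hf.hasFDerivAt
  have h2 : HasFDerivAt (fC f) (Complex.ofRealCLM.comp (fderiv ℝ f z)) z := this
  rw [h2.fderiv]; simp

lemma fC_contDiff (f : ℂ → ℝ) (hf : ContDiff ℝ 1 f) : ContDiff ℝ 1 (fC f) :=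
  Complex.ofRealCLM.contDiff.comp hf

lemma fC_supp (f : ℂ → ℝ) (hs : HasCompactSupport f) : HasCompactSupport (fC f) :=
  hs.comp_left (g := fun x : ℝ => (x : ℂ)) (by simp)

lemma gG_supp (f : ℂ → ℝ) (hs : HasCompactSupport f) : HasCompactSupport (gG f) := by
  have : gG f = fun z => f z * (sC z ^ 2 / 8) := by ext; unfold gG; ring
  rw [this]; exact hs.mul_right

lemma gG_contDiff (f : ℂ → ℝ) (hf : ContDiff ℝ 1 f) : ContDiff ℝ 1 (gG f) :=
  (hf.mul (sC_contDiff.pow 2)).div_const 8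

lemma kE_re (z : ℂ) : (kE 1 z).re = z.re * (sC z)⁻¹ := by
  simp only [kE, sC, Complex.re_mul_ofReal, Complex.conj_re]; congr 2; ring
lemma kE_im (z : ℂ) : (kE 1 z).im = - z.im * (sC z)⁻¹ := by
  simp only [kE, sC, Complex.im_mul_ofReal, Complex.conj_im]; congr 2; ring

lemma F_norm (f : ℂ → ℝ) (z : ℂ) (hf : DifferentiableAt ℝ f z) :
    ‖dzz (fC f) z + 2 * kE 1 z * fC f z + ((2 * (sC z ^ 2)⁻¹ * Real.pi⁻¹ : ℝ) : ℂ) * CT (fC f) z‖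
      ≤ 8 * (sC z ^ 2)⁻¹ * ‖dW f z‖ := by
  have e : dzz (fC f) z + 2 * kE 1 z * fC f z + ((2 * (sC z ^ 2)⁻¹ * Real.pi⁻¹ : ℝ) : ℂ) * CT (fC f) z
      = ((4 * (sC z ^ 2)⁻¹ : ℝ) : ℂ) * ((dW f z 1 : ℂ) - Complex.I * (dW f z Complex.I : ℂ)) := by
    have h1 : ((2 * (sC z ^ 2)⁻¹ * Real.pi⁻¹ : ℝ) : ℂ) * CT (fC f) z = ((2 * (sC z ^ 2)⁻¹ : ℝ) : ℂ) * AA f z := by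
      unfold AA; push_cast; ring
    have := sC_ne z
    rw [h1, dzz, fC_fderiv f z hf, fC_fderiv f z hf, dW_apply f z hf, dW_apply f z hf, fC]
    obtain ⟨w, hw⟩ : ∃ w, w = (sC z ^ 2)⁻¹ := ⟨_, rfl⟩
    rw [← hw]
    apply Complex.ext
    · simp [kE_re, kE_im, pow_two]
      rw [hw]
      field_simp
      ring
    · simp [kE_re, kE_im, pow_two]
      rw [hw]
      field_simp
      ring
  rw [e, norm_mul, Complex.norm_real, Real.norm_of_nonneg (by have := sC_pos z; positivity)]
  have h1 : ‖(dW f z 1 : ℂ) - Complex.I * (dW f z Complex.I : ℂ)‖ ≤ 2 * ‖dW f z‖ := by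
    refine (norm_sub_le _ _).trans ?_
    have a := (dW f z).le_opNorm 1
    have b := (dW f z).le_opNorm Complex.I
    rw [norm_mul, Complex.norm_I, one_mul, Complex.norm_real, Complex.norm_real]
    simp at a b ⊢; linarith
  have := sC_pos z
  calc _ ≤ 4 * (sC z ^ 2)⁻¹ * (2 * ‖dW f z‖) := by gcongr
    _ = _ := by ring

lemma AA_contDiff (f : ℂ → ℝ) (hs : HasCompactSupport f) (hf : ContDiff ℝ 1 f) : ContDiff ℝ 1 (AA f) :=
  contDiff_const.mul (CT_contDiff _ (fC_supp f hs) (fC_contDiff f hf))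

lemma AA_fderiv (f : ℂ → ℝ) (hs : HasCompactSupport f) (hf : ContDiff ℝ 1 f) (z v : ℂ) :
    fderiv ℝ (AA f) z v = (QQ f z - 2 * kE 1 z * AA f z) * v + f z * (starRingEnd ℂ) v := by
  have hd := (CT_contDiff _ (fC_supp f hs) (fC_contDiff f hf)).differentiable (by norm_num) z
  have e : fderiv ℝ (AA f) z v = ((Real.pi⁻¹ : ℝ) : ℂ) * fderiv ℝ (CT (fC f)) z v := by
    have : HasFDerivAt (AA f) (((Real.pi⁻¹ : ℝ) : ℂ) • fderiv ℝ (CT (fC f)) z) z := hd.hasFDerivAt.const_mul _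
    rw [this.fderiv]; simp
  rw [e, fderiv_decomp, CT_dbar _ (fC_supp f hs) (fC_contDiff f hf), QQ, AA, fC]
  have : (Real.pi : ℂ) ≠ 0 := by exact_mod_cast Real.pi_ne_zero
  push_cast
  field_simp
  ring

lemma sq_add_le (a b c : ℝ) (h : c ≤ a + b) (hc : 0 ≤ c) : c ^ 2 ≤ 2 * a ^ 2 + 2 * b ^ 2 := by
  nlinarith [sq_nonneg (a - b)]

lemma sC_inv_le {m n : ℕ} (h : m ≤ n) (z : ℂ) : ((sC z) ^ n)⁻¹ ≤ ((sC z) ^ m)⁻¹ := by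
  have := sC_pos z
  exact inv_anti₀ (by positivity) (pow_le_pow_right₀ (sC_one_le z) h)

lemma dW_cont (f : ℂ → ℝ) (hs : HasCompactSupport f) (hf : ContDiff ℝ 1 f) : Continuous (dW f) := by
  have h1 := (gG_contDiff f hf).continuous_fderiv (by norm_num)
  have h2 := (AA_contDiff f hs hf).continuous
  have h3 : Continuous LA := by
    have : LA = fun a => (ContinuousLinearMap.compL ℝ ℂ ℂ ℝ Complex.reCLM) (ContinuousLinearMap.mul ℝ ℂ a) := rfl
    rw [this]; fun_prop
  unfold dW
  have h4 : Continuous (fun z => LA (AA f z)) := h3.comp h2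
  fun_prop

lemma dW_norm_le (f : ℂ → ℝ) (z : ℂ) : ‖dW f z‖ ≤ ‖fderiv ℝ (gG f) z‖ + 1/2 * ‖AA f z‖ := by
  unfold dW
  refine (norm_add_le _ _).trans ?_
  rw [norm_smul]
  have := LA_norm (AA f z)
  simp; linarith

lemma dg_norm_le (f : ℂ → ℝ) (z : ℂ) : ‖fderiv ℝ (gG f) z‖ ≤ ‖dW f z‖ + 1/2 * ‖AA f z‖ := by
  have : fderiv ℝ (gG f) z = dW f z - (1/2 : ℝ) • LA (AA f z) := by unfold dW; abel
  rw [this]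
  refine (norm_sub_le _ _).trans ?_
  rw [norm_smul]
  have := LA_norm (AA f z)
  simp; linarith

lemma step1 : ∃ C : ℝ, 0 < C ∧ ∀ f : ℂ → ℝ, HasCompactSupport f → ContDiff ℝ 1 f →
    Integrable (fun z => ((sC z) ^ 2)⁻¹ * ‖dW f z‖ ^ 2) ∧
    Integrable (fun z => (sC z)⁻¹ * ‖QQ f z‖ ^ 2) ∧
    ∫ z, (sC z)⁻¹ * ‖QQ f z‖ ^ 2 ≤ C * ∫ z, ((sC z) ^ 2)⁻¹ * ‖dW f z‖ ^ 2 ∧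
    Integrable (fun z => (sC z)⁻¹ * ‖AA f z‖ ^ 2) ∧
    ∫ z, (sC z)⁻¹ * ‖AA f z‖ ^ 2 ≤ C * ∫ z, sC z * f z ^ 2 := by
  obtain ⟨C0, hC0, KL⟩ := KL
  have hpi := Real.pi_pos
  refine ⟨Real.pi⁻¹ ^ 2 * C0 * 64 + Real.pi⁻¹ ^ 2 * C0, by positivity, fun f hs hf => ?_⟩
  have hcC := (fC_contDiff f hf).continuous
  have cf := hf.continuous
  have cA := (AA_contDiff f hs hf).continuous
  have cs := sC_cont
  have cdg := (gG_contDiff f hf).continuous_fderiv (by norm_num)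
  have c2 := sC_inv_cont 2
  have c1 : Continuous (fun z => (sC z)⁻¹) := by simpa using sC_inv_cont 1
  have hs2 : HasCompactSupport (fun z => f z ^ 2) := by
    have : (fun z => f z ^ 2) = fun z => f z * f z := by ext; ring
    rw [this]; exact hs.mul_left
  have i0 : Integrable (fun y => sC y * ‖fC f y‖ ^ 2) := by
    have : (fun y => sC y * ‖fC f y‖ ^ 2) = fun y => sC y * f y ^ 2 := by
      ext y; simp [fC]
    rw [this]
    exact Continuous.integrable_of_hasCompactSupport (by fun_prop) hs2.mul_left
  obtain ⟨-, k1, k2⟩ := KL (fC f) hcC.measurable i0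
  have eA : ∀ z, (sC z)⁻¹ * ‖AA f z‖ ^ 2 = Real.pi⁻¹ ^ 2 * ((sC z)⁻¹ * ‖CT (fC f) z‖ ^ 2) := by
    intro z; rw [AA, norm_mul, Complex.norm_real, Real.norm_of_nonneg (by positivity)]; ring
  have iA : Integrable (fun z => (sC z)⁻¹ * ‖AA f z‖ ^ 2) := by
    simp_rw [eA]; exact k1.const_mul _
  have idg : Integrable (fun z => ((sC z) ^ 2)⁻¹ * ‖fderiv ℝ (gG f) z‖ ^ 2) := by
    have hsf : HasCompactSupport (fun z => ‖fderiv ℝ (gG f) z‖ ^ 2) := by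
      have : (fun z => ‖fderiv ℝ (gG f) z‖ ^ 2) = fun z => ‖fderiv ℝ (gG f) z‖ * ‖fderiv ℝ (gG f) z‖ := by ext; ring
      rw [this]; exact (((gG_supp f hs).fderiv ℝ).norm).mul_left
    exact Continuous.integrable_of_hasCompactSupport (by fun_prop) hsf.mul_left
  have cdW := dW_cont f hs hf
  have iW : Integrable (fun z => ((sC z) ^ 2)⁻¹ * ‖dW f z‖ ^ 2) := by
    refine ((idg.const_mul 2).fun_add (iA.const_mul 2)).mono' (by
      apply Continuous.aestronglyMeasurable; fun_prop) (Filter.Eventually.of_forall fun z => ?_)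
    have hp := sC_pos z
    rw [Real.norm_of_nonneg (by positivity)]
    have h1 := sq_add_le _ _ _ (dW_norm_le f z) (norm_nonneg _)
    have h2 : ((sC z) ^ 2)⁻¹ ≤ (sC z)⁻¹ := by simpa using sC_inv_le (show 1 ≤ 2 by norm_num) z
    calc _ ≤ ((sC z) ^ 2)⁻¹ * (2 * ‖fderiv ℝ (gG f) z‖ ^ 2 + 2 * (1/2 * ‖AA f z‖)^2) := by gcongr
      _ = 2 * (((sC z) ^ 2)⁻¹ * ‖fderiv ℝ (gG f) z‖ ^ 2) + ((sC z) ^ 2)⁻¹ * (1/2 * ‖AA f z‖ ^2) := by ring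
      _ ≤ 2 * (((sC z) ^ 2)⁻¹ * ‖fderiv ℝ (gG f) z‖ ^ 2) + (sC z)⁻¹ * (2 * ‖AA f z‖ ^2) := by gcongr; norm_num
      _ = _ := by ring
  set F : ℂ → ℂ := fun y => dzz (fC f) y + 2 * kE 1 y * fC f y +
        ((2 * (sC y ^ 2)⁻¹ * Real.pi⁻¹ : ℝ) : ℂ) * CT (fC f) y with hF
  have cF : Continuous F := by
    have a1 := (fC_contDiff f hf).continuous_fderiv (by norm_num)
    have a2 := kE_contDiff.continuous
    have a3 := (CT_contDiff _ (fC_supp f hs) (fC_contDiff f hf)).continuous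
    rw [hF]
    unfold dzz
    fun_prop
  have Fb : ∀ y, sC y * ‖F y‖ ^ 2 ≤ 64 * (((sC y) ^ 2)⁻¹ * ‖dW f y‖ ^ 2) := by
    intro y
    have hp := sC_pos y
    have h1 := F_norm f y (hf.differentiable (by norm_num) y)
    have h3 : (sC y ^ 3)⁻¹ ≤ (sC y ^ 2)⁻¹ := sC_inv_le (by norm_num) y
    calc sC y * ‖F y‖ ^ 2 ≤ sC y * (8 * (sC y ^ 2)⁻¹ * ‖dW f y‖) ^ 2 := by gcongr
      _ = 64 * ((sC y ^ 3)⁻¹ * ‖dW f y‖ ^ 2) := by field_simp; ring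
      _ ≤ _ := by gcongr
  have iF : Integrable (fun y => sC y * ‖F y‖ ^ 2) := by
    refine (iW.const_mul 64).mono' (by apply Continuous.aestronglyMeasurable; fun_prop)
      (Filter.Eventually.of_forall fun y => ?_)
    have hp := sC_pos y
    rw [Real.norm_of_nonneg (by positivity)]; exact Fb y
  obtain ⟨-, q1, q2⟩ := KL F cF.measurable iF
  have eQ : ∀ z, (sC z)⁻¹ * ‖QQ f z‖ ^ 2 = Real.pi⁻¹ ^ 2 * ((sC z)⁻¹ * ‖CT F z‖ ^ 2) := by
    intro z
    rw [QQ, q_identity _ (fC_supp f hs) (fC_contDiff f hf), norm_mul, Complex.norm_real, Real.norm_of_nonneg (by positivity)]; ring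
  refine ⟨iW, ?_, ?_, iA, ?_⟩
  · simp_rw [eQ]; exact q1.const_mul _
  · simp_rw [eQ]; rw [integral_const_mul]
    have : ∫ y, sC y * ‖F y‖ ^ 2 ≤ 64 * ∫ z, ((sC z) ^ 2)⁻¹ * ‖dW f z‖ ^ 2 := by
      rw [← integral_const_mul]; exact integral_mono iF (iW.const_mul 64) Fb
    have nn : 0 ≤ ∫ z, ((sC z) ^ 2)⁻¹ * ‖dW f z‖ ^ 2 :=
      integral_nonneg fun z => by have := sC_pos z; positivity
    calc _ ≤ Real.pi⁻¹ ^ 2 * (C0 * (64 * ∫ z, ((sC z) ^ 2)⁻¹ * ‖dW f z‖ ^ 2)) := by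
          gcongr; exact q2.trans (by gcongr)
      _ = Real.pi⁻¹ ^ 2 * C0 * 64 * ∫ z, ((sC z) ^ 2)⁻¹ * ‖dW f z‖ ^ 2 := by ring
      _ ≤ _ := by
        gcongr
        have : 0 ≤ Real.pi⁻¹ ^ 2 * C0 := by positivity
        linarith
  · simp_rw [eA]; rw [integral_const_mul]
    have e : ∫ y, sC y * ‖fC f y‖ ^ 2 = ∫ y, sC y * f y ^ 2 := by
      congr 1; ext y; simp [fC]
    rw [e] at k2
    have nn : 0 ≤ ∫ z, sC z * f z ^ 2 :=
      integral_nonneg fun z => by have := sC_pos z; positivity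
    calc _ ≤ Real.pi⁻¹ ^ 2 * (C0 * ∫ z, sC z * f z ^ 2) := by gcongr
      _ = Real.pi⁻¹ ^ 2 * C0 * ∫ z, sC z * f z ^ 2 := by ring
      _ ≤ _ := by
        gcongr
        have : 0 ≤ Real.pi⁻¹ ^ 2 * C0 := by positivity
        linarith

def al3 (f : ℂ → ℝ) (z : ℂ) : ℝ := f z * sC z * (2 - sC z) / 8 + 1/2 * (z * AA f z).re
def alc (f : ℂ → ℝ) (z : ℂ) : ℂ := ((f z * sC z / 4 + 1/2 * (z * AA f z).re : ℝ) : ℂ) * z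
    - ((sC z / 4 : ℝ) : ℂ) * (starRingEnd ℂ) (AA f z)

lemma re_zA_hasFDerivAt (f : ℂ → ℝ) (hs : HasCompactSupport f) (hf : ContDiff ℝ 1 f) (z : ℂ) :
    ∃ L : ℂ →L[ℝ] ℝ, HasFDerivAt (fun z => (z * AA f z).re) L z ∧ ∀ v, L v = (v * AA f z + z * ((QQ f z - 2 * kE 1 z * AA f z) * v + f z * (starRingEnd ℂ) v)).re := by
  have h := (hasFDerivAt_id (𝕜 := ℝ) z).fun_mul ((AA_contDiff f hs hf).differentiable (by norm_num) z).hasFDerivAt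
  refine ⟨_, (Complex.reCLM.hasFDerivAt).comp z h, fun v => ?_⟩
  simp only [ContinuousLinearMap.comp_apply, add_apply, smul_apply, smul_eq_mul, AA_fderiv f hs hf]
  simp [Complex.mul_re]
  ring

lemma al3_fderiv (f : ℂ → ℝ) (hs : HasCompactSupport f) (hf : ContDiff ℝ 1 f) (z v : ℂ) :
    fderiv ℝ (al3 f) z v = dW f z v * (2 / sC z - 1) + 1/2 * (z * QQ f z * v).re := by
  obtain ⟨L, hL, hLv⟩ := re_zA_hasFDerivAt f hs hf z
  have hd := hf.differentiable (by norm_num) z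
  have h := (((hd.hasFDerivAt.fun_mul (sC_hasFDerivAt z)).fun_mul ((sC_hasFDerivAt z).const_sub 2)).mul_const (1/8 : ℝ)).fun_add
    (hL.const_mul (1/2 : ℝ))
  have e : al3 f = fun z => f z * sC z * (2 - sC z) * (1/8) + 1/2 * (z * AA f z).re := by
    ext; unfold al3; ring
  rw [e, h.fderiv, dW_apply f z hd]
  have hne := sC_ne z
  simp only [add_apply, smul_apply, smul_eq_mul, neg_apply, sC_fderiv_apply, hLv]
  simp [kE_re, kE_im]
  have hs := sC_eq z
  generalize sC z = s at *
  field_simp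
  rw [hs]; ring

lemma alc_fderiv (f : ℂ → ℝ) (hs : HasCompactSupport f) (hf : ContDiff ℝ 1 f) (z v : ℂ) :
    fderiv ℝ (alc f) z v = ((dW f z v * (2 / sC z) : ℝ) : ℂ) * z
      - ((sC z / 4 : ℝ) : ℂ) * (starRingEnd ℂ) (QQ f z * v)
      + ((1/2 * (z * QQ f z * v).re : ℝ) : ℂ) * z := by
  obtain ⟨L, hL, hLv⟩ := re_zA_hasFDerivAt f hs hf z
  have hd := hf.differentiable (by norm_num) z
  have h1 := ((hd.hasFDerivAt.fun_mul (sC_hasFDerivAt z)).mul_const (1/4 : ℝ)).fun_add (hL.const_mul (1/2 : ℝ))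
  have h2 := ((Complex.ofRealCLM.hasFDerivAt).comp z h1).mul (hasFDerivAt_id (𝕜 := ℝ) z)
  have h3 := (Complex.ofRealCLM.hasFDerivAt).comp z ((sC_hasFDerivAt z).mul_const (1/4 : ℝ))
  have h4 := (Complex.conjCLE : ℂ →L[ℝ] ℂ).hasFDerivAt.comp z ((AA_contDiff f hs hf).differentiable (by norm_num) z).hasFDerivAt
  have h := h2.sub (h3.mul h4)
  have e : fderiv ℝ (alc f) z = _ := HasFDerivAt.fderiv (h.congr_of_eventuallyEq (Filter.Eventually.of_forall fun w => by
    simp [alc]; ring))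
  rw [e, dW_apply f z hd]
  have hne := sC_ne z
  simp only [add_apply, sub_apply, smul_apply, smul_eq_mul, neg_apply, hLv, ContinuousLinearMap.comp_apply, 
    AA_fderiv f hs hf]
  have hs := sC_eq z
  clear e h h1 h2 h3 h4 hLv hL
  apply Complex.ext
  · simp [kE_re, kE_im, pow_two]
    generalize sC z = s at *
    field_simp
    rw [hs]; ring
  · simp [kE_re, kE_im, pow_two]
    generalize sC z = s at *
    field_simp
    rw [hs]; ring

lemma al3_norm (f : ℂ → ℝ) (hs : HasCompactSupport f) (hf : ContDiff ℝ 1 f) (z : ℂ) :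
    ‖fderiv ℝ (al3 f) z‖ ≤ ‖dW f z‖ + sC z * ‖QQ f z‖ := by
  have hp := sC_pos z
  have h1 := sC_one_le z
  refine ContinuousLinearMap.opNorm_le_bound _ (by positivity) fun v => ?_
  rw [al3_fderiv f hs hf]
  refine (norm_add_le _ _).trans ?_
  have a := (dW f z).le_opNorm v
  have b : |2 / sC z - 1| ≤ 1 := by
    rw [abs_le]; constructor
    · have : 0 ≤ 2 / sC z := by positivity
      linarith
    · have : 2 / sC z ≤ 2 := by rw [div_le_iff₀ hp]; linarith
      linarith
  have c := Complex.abs_re_le_norm (z * QQ f z * v)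
  rw [norm_mul, norm_mul] at c
  rw [norm_mul, norm_mul, Real.norm_eq_abs, Real.norm_eq_abs, Real.norm_eq_abs]
  have d := norm_le_sC z
  rw [Real.norm_eq_abs] at a
  have h12 : |(1/2:ℝ)| ≤ 1 := by rw [abs_of_pos] <;> norm_num
  calc _ ≤ (‖dW f z‖ * ‖v‖) * 1 + 1 * (sC z * ‖QQ f z‖ * ‖v‖) := by
        gcongr
        exact c.trans (by gcongr)
    _ = _ := by ring

lemma alc_norm (f : ℂ → ℝ) (hs : HasCompactSupport f) (hf : ContDiff ℝ 1 f) (z : ℂ) :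
    ‖fderiv ℝ (alc f) z‖ ≤ ‖dW f z‖ + sC z * ‖QQ f z‖ := by
  have hp := sC_pos z
  have h1 := sC_one_le z
  refine ContinuousLinearMap.opNorm_le_bound _ (by positivity) fun v => ?_
  rw [alc_fderiv f hs hf]
  refine (norm_add_le _ _).trans ?_
  have t0 := norm_sub_le (((dW f z v * (2 / sC z) : ℝ) : ℂ) * z) (((sC z / 4 : ℝ) : ℂ) * (starRingEnd ℂ) (QQ f z * v))
  have a := (dW f z).le_opNorm v
  rw [Real.norm_eq_abs] at a
  have hz : 2 / sC z * ‖z‖ ≤ 1 := by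
    rw [div_mul_eq_mul_div, div_le_one hp]; unfold sC; nlinarith [sq_nonneg (‖z‖ - 1)]
  have t1 : ‖((dW f z v * (2 / sC z) : ℝ) : ℂ) * z‖ ≤ ‖dW f z‖ * ‖v‖ := by
    rw [norm_mul, Complex.norm_real, norm_mul, Real.norm_eq_abs, Real.norm_of_nonneg (by positivity), mul_assoc]
    calc _ ≤ (‖dW f z‖ * ‖v‖) * 1 := by gcongr
      _ = _ := by ring
  have t2 : ‖((sC z / 4 : ℝ) : ℂ) * (starRingEnd ℂ) (QQ f z * v)‖ = sC z / 4 * (‖QQ f z‖ * ‖v‖) := by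
    rw [norm_mul, Complex.norm_real, RCLike.norm_conj, norm_mul, Real.norm_of_nonneg (by positivity)]
  have t3 : ‖((1/2 * (z * QQ f z * v).re : ℝ) : ℂ) * z‖ ≤ 1/2 * sC z * (‖QQ f z‖ * ‖v‖) := by
    have c := Complex.abs_re_le_norm (z * QQ f z * v)
    rw [norm_mul, norm_mul] at c
    rw [norm_mul, Complex.norm_real, norm_mul, Real.norm_of_nonneg (by norm_num), Real.norm_eq_abs]
    calc _ ≤ 1/2 * (‖z‖ * ‖QQ f z‖ * ‖v‖) * ‖z‖ := by gcongr
      _ = 1/2 * ‖z‖^2 * (‖QQ f z‖ * ‖v‖) := by ring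
      _ ≤ _ := by gcongr; unfold sC; linarith
  have : 0 ≤ sC z * (‖QQ f z‖ * ‖v‖) := by positivity
  nlinarith

lemma g_id (f : ℂ → ℝ) (z : ℂ) :
    gG f z = (alc f z * (starRingEnd ℂ) z).re * (2 / sC z) + al3 f z * (2 / sC z - 1) := by
  have hne := sC_ne z
  have hs := sC_eq z
  unfold gG al3 alc
  simp
  generalize sC z = s at *
  field_simp
  rw [hs]; ring

lemma A_id (f : ℂ → ℝ) (z : ℂ) :
    ‖alc f z‖ ^ 2 + al3 f z ^ 2 = gG f z ^ 2 + sC z ^ 2 * ‖AA f z‖ ^ 2 / 16 := by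
  have hs := sC_eq z
  rw [Complex.sq_norm, Complex.sq_norm, Complex.normSq_apply, Complex.normSq_apply]
  unfold gG al3 alc
  simp
  rw [hs]; ring

lemma alc_contDiff (f : ℂ → ℝ) (hs : HasCompactSupport f) (hf : ContDiff ℝ 1 f) : ContDiff ℝ 1 (alc f) := by
  have hA := AA_contDiff f hs hf
  have h1 : ContDiff ℝ 1 (fun z => (z * AA f z).re) := Complex.reCLM.contDiff.comp (contDiff_id.mul hA)
  have h2 : ContDiff ℝ 1 (fun z => f z * sC z / 4 + 1/2 * (z * AA f z).re) :=
    ((hf.mul sC_contDiff).div_const 4).add (contDiff_const.mul h1)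
  have h3 : ContDiff ℝ 1 (fun z => ((f z * sC z / 4 + 1/2 * (z * AA f z).re : ℝ) : ℂ)) := Complex.ofRealCLM.contDiff.comp h2
  have h4 : ContDiff ℝ 1 (fun z => ((sC z / 4 : ℝ) : ℂ)) := Complex.ofRealCLM.contDiff.comp (sC_contDiff.div_const 4)
  have h5 : ContDiff ℝ 1 (fun z => (starRingEnd ℂ) (AA f z)) := (Complex.conjCLE : ℂ →L[ℝ] ℂ).contDiff.comp hA
  exact (h3.mul contDiff_id).sub (h4.mul h5)

lemma al3_contDiff (f : ℂ → ℝ) (hs : HasCompactSupport f) (hf : ContDiff ℝ 1 f) : ContDiff ℝ 1 (al3 f) := by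
  have hA := AA_contDiff f hs hf
  have h1 : ContDiff ℝ 1 (fun z => (z * AA f z).re) := Complex.reCLM.contDiff.comp (contDiff_id.mul hA)
  exact (((hf.mul sC_contDiff).mul (contDiff_const.sub sC_contDiff)).div_const 8).add (contDiff_const.mul h1)

lemma sq_supp {X : Type*} [TopologicalSpace X] (f : X → ℝ) (hs : HasCompactSupport f) :
    HasCompactSupport (fun z => f z ^ 2) := by
  have : (fun z => f z ^ 2) = fun z => f z * f z := by ext; ring
  rw [this]; exact hs.mul_left

lemma SPr : ∃ C : ℝ, 0 < C ∧ ∀ α : ℂ → ℝ, ContDiff ℝ 1 α →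
    Integrable (fun z => ((sC z) ^ 3)⁻¹ * ‖fderiv ℝ α z‖ ^ 2) →
    ∃ a : ℝ, Integrable (fun z => ((sC z) ^ 6)⁻¹ * (α z - a) ^ 2) ∧
      ∫ z, ((sC z) ^ 6)⁻¹ * (α z - a) ^ 2 ≤ C * ∫ z, ((sC z) ^ 3)⁻¹ * ‖fderiv ℝ α z‖ ^ 2 := by
  obtain ⟨C, hC, SP⟩ := SP
  refine ⟨C, hC, fun α hα hi => ?_⟩
  have c3 := sC_inv_cont 3
  have c6 := sC_inv_cont 6
  have ca := hα.continuous
  have c := (fC_contDiff α hα).continuous_fderiv (by norm_num)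
  have hn : ∀ z, ‖fderiv ℝ (fC α) z‖ ≤ ‖fderiv ℝ α z‖ := by
    intro z
    refine ContinuousLinearMap.opNorm_le_bound _ (norm_nonneg _) fun v => ?_
    rw [fC_fderiv α z (hα.differentiable (by norm_num) z), Complex.norm_real]
    exact ContinuousLinearMap.le_opNorm _ _
  have hle : ∀ z, ((sC z) ^ 3)⁻¹ * ‖fderiv ℝ (fC α) z‖ ^ 2 ≤ ((sC z) ^ 3)⁻¹ * ‖fderiv ℝ α z‖ ^ 2 := by
    intro z; have := sC_pos z; have := hn z; gcongr
  have hi2 : Integrable (fun z => ((sC z) ^ 3)⁻¹ * ‖fderiv ℝ (fC α) z‖ ^ 2) := by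
    refine hi.mono' (by apply Continuous.aestronglyMeasurable; fun_prop) (Filter.Eventually.of_forall fun z => ?_)
    have := sC_pos z
    rw [Real.norm_of_nonneg (by positivity)]; exact hle z
  obtain ⟨a, h1, h2⟩ := SP (fC α) (fC_contDiff α hα) hi2
  have hle2 : ∀ z, ((sC z) ^ 6)⁻¹ * (α z - a.re) ^ 2 ≤ ((sC z) ^ 6)⁻¹ * ‖fC α z - a‖ ^ 2 := by
    intro z; have := sC_pos z
    have h := Complex.abs_re_le_norm (fC α z - a)
    simp only [fC, Complex.sub_re, Complex.ofReal_re] at h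
    have h3 : (α z - a.re) ^ 2 ≤ ‖fC α z - a‖ ^ 2 := by
      rw [← sq_abs]; simp only [fC]; gcongr
    gcongr
  have i : Integrable (fun z => ((sC z) ^ 6)⁻¹ * (α z - a.re) ^ 2) := by
    refine h1.mono' (by apply Continuous.aestronglyMeasurable; fun_prop) (Filter.Eventually.of_forall fun z => ?_)
    have := sC_pos z
    rw [Real.norm_of_nonneg (by positivity)]; exact hle2 z
  refine ⟨a.re, i, (integral_mono i h1 hle2).trans (h2.trans ?_)⟩
  gcongr
  exact hle

lemma step3 : ∃ C : ℝ, 0 < C ∧ ∀ f : ℂ → ℝ, HasCompactSupport f → ContDiff ℝ 1 f →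
    ∃ (ac : ℂ) (a3 : ℝ), Integrable (fun z => ((sC z) ^ 6)⁻¹ * ‖alc f z - ac‖ ^ 2) ∧
      Integrable (fun z => ((sC z) ^ 6)⁻¹ * (al3 f z - a3) ^ 2) ∧
      ∫ z, ((sC z) ^ 6)⁻¹ * ‖alc f z - ac‖ ^ 2 ≤ C * ∫ z, ((sC z) ^ 2)⁻¹ * ‖dW f z‖ ^ 2 ∧
      ∫ z, ((sC z) ^ 6)⁻¹ * (al3 f z - a3) ^ 2 ≤ C * ∫ z, ((sC z) ^ 2)⁻¹ * ‖dW f z‖ ^ 2 := by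
  obtain ⟨C1, hC1, S1⟩ := step1
  obtain ⟨C, hC, SP⟩ := SP
  obtain ⟨C', hC', SPr⟩ := SPr
  refine ⟨(C + C') * (2 + 2 * C1), by positivity, fun f hs hf => ?_⟩
  obtain ⟨iW, iQ, bQ, -, -⟩ := S1 f hs hf
  set D := ∫ z, ((sC z) ^ 2)⁻¹ * ‖dW f z‖ ^ 2 with hD
  have hD0 : 0 ≤ D := integral_nonneg fun z => by have := sC_pos z; positivity
  have c3 := sC_inv_cont 3
  have key : ∀ (n : ℂ → ℝ), Continuous n → (∀ z, 0 ≤ n z) → (∀ z, n z ≤ ‖dW f z‖ + sC z * ‖QQ f z‖) →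
      Integrable (fun z => ((sC z) ^ 3)⁻¹ * n z ^ 2) ∧ ∫ z, ((sC z) ^ 3)⁻¹ * n z ^ 2 ≤ (2 + 2 * C1) * D := by
    intro n cn n0 hn
    have hle : ∀ z, ((sC z) ^ 3)⁻¹ * n z ^ 2 ≤ 2 * (((sC z) ^ 2)⁻¹ * ‖dW f z‖ ^ 2) + 2 * ((sC z)⁻¹ * ‖QQ f z‖ ^ 2) := by
      intro z
      have hp := sC_pos z
      have h := sq_add_le _ _ _ (hn z) (n0 z)
      have h2 : ((sC z) ^ 3)⁻¹ ≤ ((sC z) ^ 2)⁻¹ := sC_inv_le (by norm_num) z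
      calc _ ≤ ((sC z) ^ 3)⁻¹ * (2 * ‖dW f z‖ ^ 2 + 2 * (sC z * ‖QQ f z‖) ^ 2) := by gcongr
        _ = ((sC z) ^ 3)⁻¹ * (2 * ‖dW f z‖ ^ 2) + 2 * ((sC z)⁻¹ * ‖QQ f z‖ ^ 2) := by field_simp
        _ ≤ ((sC z) ^ 2)⁻¹ * (2 * ‖dW f z‖ ^ 2) + 2 * ((sC z)⁻¹ * ‖QQ f z‖ ^ 2) := by gcongr
        _ = _ := by ring
    have i := (iW.const_mul 2).fun_add (iQ.const_mul 2)
    have i' : Integrable (fun z => ((sC z) ^ 3)⁻¹ * n z ^ 2) := by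
      refine i.mono' (by apply Continuous.aestronglyMeasurable; fun_prop) (Filter.Eventually.of_forall fun z => ?_)
      have := sC_pos z
      rw [Real.norm_of_nonneg (by positivity)]; exact hle z
    refine ⟨i', ?_⟩
    have := integral_mono i' i hle
    rw [integral_add (iW.const_mul 2) (iQ.const_mul 2), integral_const_mul, integral_const_mul] at this
    linarith
  have hc := alc_contDiff f hs hf
  have h3 := al3_contDiff f hs hf
  obtain ⟨k1, k2⟩ := key (fun z => ‖fderiv ℝ (alc f) z‖) (hc.continuous_fderiv (by norm_num)).norm
    (fun z => norm_nonneg _) (alc_norm f hs hf)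
  obtain ⟨l1, l2⟩ := key (fun z => ‖fderiv ℝ (al3 f) z‖) (h3.continuous_fderiv (by norm_num)).norm
    (fun z => norm_nonneg _) (al3_norm f hs hf)
  obtain ⟨ac, p1, p2⟩ := SP (alc f) hc k1
  obtain ⟨a3, q1, q2⟩ := SPr (al3 f) h3 l1
  have hCC : 0 ≤ (2 + 2 * C1) * D := by positivity
  refine ⟨ac, a3, p1, q1, p2.trans ?_, q2.trans ?_⟩
  · calc _ ≤ C * ((2 + 2 * C1) * D) := by gcongr
      _ ≤ (C + C') * ((2 + 2 * C1) * D) := by gcongr; linarith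
      _ = _ := by ring
  · calc _ ≤ C' * ((2 + 2 * C1) * D) := by gcongr
      _ ≤ (C + C') * ((2 + 2 * C1) * D) := by gcongr; linarith
      _ = _ := by ring

lemma odd_zero (φ : ℂ ≃ₗᵢ[ℝ] ℂ) (h : ℂ → ℝ) (hh : ∀ z, h (φ z) = - h z) : ∫ z, h z = 0 := by
  have h1 : ∫ z, h (φ z) = ∫ z, h z :=
    (LinearIsometryEquiv.measurePreserving φ).integral_comp φ.toMeasurableEquiv.measurableEmbedding h
  simp_rw [hh] at h1
  rw [integral_neg] at h1
  linarith

lemma cs_e (e X : ℂ → ℝ) (ce : Continuous e) (cX : Continuous X) (hX : ∀ z, |X z| ≤ 1)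
    (hi : Integrable (fun z => ((sC z) ^ 6)⁻¹ * e z ^ 2)) :
    Integrable (fun z => ((sC z) ^ 4)⁻¹ * e z * X z) ∧
    (∫ z, ((sC z) ^ 4)⁻¹ * e z * X z) ^ 2 ≤ Real.pi * ∫ z, ((sC z) ^ 6)⁻¹ * e z ^ 2 := by
  have c3 := sC_inv_cont 3
  have c4 := sC_inv_cont 4
  have c2 := sC_inv_cont 2
  have c1 : Continuous (fun z => (sC z)⁻¹) := by simpa using sC_inv_cont 1
  have e1 : ∀ z, (((sC z) ^ 3)⁻¹ * e z) ^ 2 = ((sC z) ^ 6)⁻¹ * e z ^ 2 := fun z => by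
    have := sC_ne z; field_simp
  have e2 : ∀ z, (((sC z) ^ 3)⁻¹ * e z) * ((sC z)⁻¹ * X z) = ((sC z) ^ 4)⁻¹ * e z * X z := fun z => by
    have := sC_ne z; field_simp
  have v2 : ∀ z, ((sC z)⁻¹ * X z) ^ 2 ≤ ((sC z) ^ 2)⁻¹ := fun z => by
    have := sC_pos z
    have h : X z ^ 2 ≤ 1 := by rw [← sq_abs]; exact pow_le_one₀ (abs_nonneg _) (hX z)
    calc ((sC z)⁻¹ * X z) ^ 2 = ((sC z) ^ 2)⁻¹ * X z ^ 2 := by field_simp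
      _ ≤ ((sC z) ^ 2)⁻¹ * 1 := by gcongr
      _ = _ := by ring
  have iv : Integrable (fun z => ((sC z)⁻¹ * X z) ^ 2) := by
    refine (integrable_sC_pow (k := 2) le_rfl).mono' (by apply Continuous.aestronglyMeasurable; fun_prop)
      (Filter.Eventually.of_forall fun z => ?_)
    rw [Real.norm_of_nonneg (by positivity)]; exact v2 z
  have iu : Integrable (fun z => (((sC z) ^ 3)⁻¹ * e z) ^ 2) := by simp_rw [e1]; exact hi
  have iuv : Integrable (fun z => (((sC z) ^ 3)⁻¹ * e z) * ((sC z)⁻¹ * X z)) := by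
    refine (iu.add iv).mono' (by apply Continuous.aestronglyMeasurable; fun_prop) (Filter.Eventually.of_forall fun z => ?_)
    rw [Real.norm_eq_abs, abs_le]
    simp only [Pi.add_apply]
    generalize (((sC z) ^ 3)⁻¹ * e z) = a
    generalize ((sC z)⁻¹ * X z) = b
    constructor <;> nlinarith [sq_nonneg (a - b), sq_nonneg (a + b)]
  have h := cs_real volume _ _ iu iv iuv
  simp_rw [e2] at iuv h
  simp_rw [e1] at h
  refine ⟨iuv, h.trans ?_⟩
  have pi1 := int_sC_pow 1 le_rfl
  have : ∫ z, ((sC z)⁻¹ * X z) ^ 2 ≤ Real.pi := by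
    refine (integral_mono iv (integrable_sC_pow (k := 2) le_rfl) v2).trans (le_of_eq ?_)
    simpa using pi1
  rw [mul_comm]
  gcongr

lemma pin_one (X Y Z g e : ℂ → ℝ) (a b c : ℝ) (cX : Continuous X) (cY : Continuous Y) (cZ : Continuous Z)
    (ce : Continuous e) (hX : ∀ z, |X z| ≤ 1) (hY : ∀ z, |Y z| ≤ 1) (hZ : ∀ z, |Z z| ≤ 1)
    (hg : ∀ z, g z = a * X z + b * Y z + c * Z z + e z)
    (hi : Integrable (fun z => ((sC z) ^ 6)⁻¹ * e z ^ 2))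
    (o1 : ∫ z, ((sC z) ^ 4)⁻¹ * Y z * X z = 0) (o2 : ∫ z, ((sC z) ^ 4)⁻¹ * Z z * X z = 0) :
    (a * ∫ z, ((sC z) ^ 4)⁻¹ * X z * X z) ^ 2 ≤ 2 * (∫ z, ((sC z) ^ 4)⁻¹ * g z * X z) ^ 2 +
      2 * Real.pi * ∫ z, ((sC z) ^ 6)⁻¹ * e z ^ 2 := by
  have c4 := sC_inv_cont 4
  have bi : ∀ (Y : ℂ → ℝ), Continuous Y → (∀ z, |Y z| ≤ 1) → Integrable (fun z => ((sC z) ^ 4)⁻¹ * Y z * X z) := by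
    intro Y cY hY
    refine (integrable_sC_pow (k := 4) (by norm_num)).mono' (by apply Continuous.aestronglyMeasurable; fun_prop)
      (Filter.Eventually.of_forall fun z => ?_)
    have := sC_pos z
    rw [norm_mul, norm_mul, Real.norm_of_nonneg (by positivity), Real.norm_eq_abs, Real.norm_eq_abs]
    calc _ ≤ ((sC z) ^ 4)⁻¹ * 1 * 1 := by gcongr; exact hY z; exact hX z
      _ = _ := by ring
  obtain ⟨ie, be⟩ := cs_e e X ce cX hX hi
  have e1 : ∀ z, ((sC z) ^ 4)⁻¹ * g z * X z = a * (((sC z) ^ 4)⁻¹ * X z * X z) + b * (((sC z) ^ 4)⁻¹ * Y z * X z) +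
      c * (((sC z) ^ 4)⁻¹ * Z z * X z) + ((sC z) ^ 4)⁻¹ * e z * X z := fun z => by rw [hg]; ring
  have i1 := (bi X cX hX).const_mul a
  have i2 := (bi Y cY hY).const_mul b
  have i3 := (bi Z cZ hZ).const_mul c
  have e2 : ∫ z, ((sC z) ^ 4)⁻¹ * g z * X z = a * (∫ z, ((sC z) ^ 4)⁻¹ * X z * X z) + ∫ z, ((sC z) ^ 4)⁻¹ * e z * X z := by
    simp_rw [e1]
    rw [integral_add ((i1.fun_add i2).fun_add i3) ie, integral_add (i1.fun_add i2) i3, integral_add i1 i2,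
      integral_const_mul, integral_const_mul, integral_const_mul, o1, o2]
    ring
  have : a * (∫ z, ((sC z) ^ 4)⁻¹ * X z * X z) = (∫ z, ((sC z) ^ 4)⁻¹ * g z * X z) - ∫ z, ((sC z) ^ 4)⁻¹ * e z * X z := by
    linarith
  rw [this]
  nlinarith [sq_nonneg ((∫ z, ((sC z) ^ 4)⁻¹ * g z * X z) + ∫ z, ((sC z) ^ 4)⁻¹ * e z * X z)]

def X3 (z : ℂ) : ℝ := 2 / sC z - 1
def X1 (z : ℂ) : ℝ := 2 * z.re / sC z
def X2 (z : ℂ) : ℝ := 2 * z.im / sC z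

lemma X3_cont : Continuous X3 := by
  unfold X3; exact ((continuous_const.div sC_cont sC_ne).sub continuous_const)
lemma X1_cont : Continuous X1 := by
  unfold X1; exact (continuous_const.mul Complex.continuous_re).div sC_cont sC_ne
lemma X2_cont : Continuous X2 := by
  unfold X2; exact (continuous_const.mul Complex.continuous_im).div sC_cont sC_ne
lemma X_sq (z : ℂ) : X1 z ^ 2 + X2 z ^ 2 + X3 z ^ 2 = 1 := by
  have hs := sC_eq z
  have hne := sC_ne z
  unfold X1 X2 X3
  field_simp
  rw [hs]; ring
lemma X3_le (z : ℂ) : |X3 z| ≤ 1 := by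
  rw [← sq_le_one_iff_abs_le_one]; nlinarith [X_sq z, sq_nonneg (X1 z), sq_nonneg (X2 z)]
lemma X1_le (z : ℂ) : |X1 z| ≤ 1 := by
  rw [← sq_le_one_iff_abs_le_one]; nlinarith [X_sq z, sq_nonneg (X3 z), sq_nonneg (X2 z)]
lemma X2_le (z : ℂ) : |X2 z| ≤ 1 := by
  rw [← sq_le_one_iff_abs_le_one]; nlinarith [X_sq z, sq_nonneg (X1 z), sq_nonneg (X3 z)]

lemma gram_pos (X : ℂ → ℝ) (cX : Continuous X) (hX : ∀ z, |X z| ≤ 1) (z0 : ℂ) (h0 : X z0 ≠ 0) :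
    0 < ∫ z, ((sC z) ^ 4)⁻¹ * X z * X z := by
  have c4 := sC_inv_cont 4
  have cc : Continuous (fun z => ((sC z) ^ 4)⁻¹ * X z * X z) := by fun_prop
  rw [integral_pos_iff_support_of_nonneg]
  · apply IsOpen.measure_pos _ cc.isOpen_support
    refine ⟨z0, ?_⟩
    have := sC_ne z0
    simp [h0, this]
  · intro z
    have := sC_pos z
    have h : 0 ≤ X z * X z := mul_self_nonneg _
    simp only [Pi.zero_apply, mul_assoc]; positivity
  · refine (integrable_sC_pow (k := 4) (by norm_num)).mono' (by apply Continuous.aestronglyMeasurable; fun_prop)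
      (Filter.Eventually.of_forall fun z => ?_)
    have := sC_pos z
    rw [norm_mul, norm_mul, Real.norm_of_nonneg (by positivity), Real.norm_eq_abs]
    calc _ ≤ ((sC z) ^ 4)⁻¹ * 1 * 1 := by gcongr <;> exact hX z
      _ = _ := by ring

lemma pin : ∃ C : ℝ, 0 < C ∧ ∀ (g e : ℂ → ℝ) (a b c : ℝ), Continuous e →
    (∀ z, g z = a * X1 z + b * X2 z + c * X3 z + e z) →
    Integrable (fun z => ((sC z) ^ 6)⁻¹ * e z ^ 2) →
    a ^ 2 + b ^ 2 + c ^ 2 ≤ C * ((∫ z, ((sC z) ^ 4)⁻¹ * g z * X1 z) ^ 2 + (∫ z, ((sC z) ^ 4)⁻¹ * g z * X2 z) ^ 2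
      + (∫ z, ((sC z) ^ 4)⁻¹ * g z * X3 z) ^ 2 + ∫ z, ((sC z) ^ 6)⁻¹ * e z ^ 2) := by
  have p1 := gram_pos X1 X1_cont X1_le 1 (by simp [X1, sC])
  have p2 := gram_pos X2 X2_cont X2_le Complex.I (by simp [X2, sC])
  have p3 := gram_pos X3 X3_cont X3_le 0 (by simp [X3, sC]; norm_num)
  have o13 : ∫ z, ((sC z) ^ 4)⁻¹ * X1 z * X3 z = 0 := odd_zero (LinearIsometryEquiv.neg ℝ) _ fun z => by
    simp [X1, X3, sC]; ring
  have o23 : ∫ z, ((sC z) ^ 4)⁻¹ * X2 z * X3 z = 0 := odd_zero (LinearIsometryEquiv.neg ℝ) _ fun z => by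
    simp [X2, X3, sC]; ring
  have o12 : ∫ z, ((sC z) ^ 4)⁻¹ * X1 z * X2 z = 0 := odd_zero Complex.conjLIE _ fun z => by
    simp [X1, X2, sC]; ring
  have sw : ∀ X Y : ℂ → ℝ, ∫ z, ((sC z) ^ 4)⁻¹ * X z * Y z = ∫ z, ((sC z) ^ 4)⁻¹ * Y z * X z := by
    intro X Y; congr 1; ext z; ring
  set γ1 := ∫ z, ((sC z) ^ 4)⁻¹ * X1 z * X1 z
  set γ2 := ∫ z, ((sC z) ^ 4)⁻¹ * X2 z * X2 z
  set γ3 := ∫ z, ((sC z) ^ 4)⁻¹ * X3 z * X3 z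
  have hpi := Real.pi_pos
  refine ⟨(2 + 2 * Real.pi) * ((γ1 ^ 2)⁻¹ + (γ2 ^ 2)⁻¹ + (γ3 ^ 2)⁻¹), by positivity, fun g e a b c ce hg hi => ?_⟩
  have q1 := pin_one X1 X2 X3 g e a b c X1_cont X2_cont X3_cont ce X1_le X2_le X3_le hg hi (by rw [sw]; exact o12) (by rw [sw]; exact o13)
  have q2 := pin_one X2 X1 X3 g e b a c X2_cont X1_cont X3_cont ce X2_le X1_le X3_le (fun z => by rw [hg]; ring) hi o12 (by rw [sw]; exact o23)
  have q3 := pin_one X3 X1 X2 g e c a b X3_cont X1_cont X2_cont ce X3_le X1_le X2_le (fun z => by rw [hg]; ring) hi o13 o23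
  set I := ∫ z, ((sC z) ^ 6)⁻¹ * e z ^ 2
  have hI : 0 ≤ I := integral_nonneg fun z => by have := sC_pos z; positivity
  set m1 := ∫ z, ((sC z) ^ 4)⁻¹ * g z * X1 z
  set m2 := ∫ z, ((sC z) ^ 4)⁻¹ * g z * X2 z
  set m3 := ∫ z, ((sC z) ^ 4)⁻¹ * g z * X3 z
  have aux : ∀ a γ m : ℝ, 0 < γ → m ^ 2 ≤ m1 ^ 2 + m2 ^ 2 + m3 ^ 2 → (a * γ) ^ 2 ≤ 2 * m ^ 2 + 2 * Real.pi * I →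
      a ^ 2 ≤ (γ ^ 2)⁻¹ * ((2 + 2 * Real.pi) * (m1 ^ 2 + m2 ^ 2 + m3 ^ 2 + I)) := by
    intro a γ m hγ hm h
    have : a ^ 2 = (γ ^ 2)⁻¹ * (a * γ) ^ 2 := by field_simp
    rw [this]
    gcongr
    have : 0 ≤ m1 ^ 2 + m2 ^ 2 + m3 ^ 2 := by positivity
    nlinarith [mul_nonneg hpi.le this]
  have r1 := aux a γ1 m1 p1 (by nlinarith [sq_nonneg m2, sq_nonneg m3]) q1
  have r2 := aux b γ2 m2 p2 (by nlinarith [sq_nonneg m1, sq_nonneg m3]) q2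
  have r3 := aux c γ3 m3 p3 (by nlinarith [sq_nonneg m2, sq_nonneg m1]) q3
  calc _ ≤ _ := add_le_add (add_le_add r1 r2) r3
    _ = _ := by ring

lemma closing (f : ℂ → ℝ) (hs : HasCompactSupport f) (hf : ContDiff ℝ 1 f) :
    2 * (∫ z, ((sC z) ^ 3)⁻¹ * gG f z ^ 2) ≤ 216 * (∫ z, ((sC z) ^ 6)⁻¹ * gG f z ^ 2)
      + (∫ z, ((sC z) ^ 2)⁻¹ * ‖fderiv ℝ (gG f) z‖ ^ 2) ∧
    (∫ z, sC z * f z ^ 2) = 64 * (∫ z, ((sC z) ^ 3)⁻¹ * gG f z ^ 2) ∧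
    (∫ z, sC z ^ 2 * ‖fderiv ℝ f z‖ ^ 2) ≤ 128 * (∫ z, ((sC z) ^ 2)⁻¹ * ‖fderiv ℝ (gG f) z‖ ^ 2)
      + 2048 * (∫ z, ((sC z) ^ 3)⁻¹ * gG f z ^ 2) := by
  have hg := gG_contDiff f hf
  have gs := gG_supp f hs
  have cg := hg.continuous
  have cdg := hg.continuous_fderiv (by norm_num)
  have cdf := hf.continuous_fderiv (by norm_num)
  have cs := sC_cont
  have H := hardy (gG f) gs hg
  have i : ∀ n : ℕ, Integrable (fun z => ((sC z) ^ n)⁻¹ * gG f z ^ 2) := fun n => by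
    have c := sC_inv_cont n
    exact Continuous.integrable_of_hasCompactSupport (by fun_prop) (sq_supp _ gs).mul_left
  have idg : Integrable (fun z => ((sC z) ^ 2)⁻¹ * ‖fderiv ℝ (gG f) z‖ ^ 2) := by
    have c := sC_inv_cont 2
    exact Continuous.integrable_of_hasCompactSupport (by fun_prop) (sq_supp _ (gs.fderiv ℝ).norm).mul_left
  have idf : Integrable (fun z => sC z ^ 2 * ‖fderiv ℝ f z‖ ^ 2) := by
    exact Continuous.integrable_of_hasCompactSupport (by fun_prop) (sq_supp _ (hs.fderiv ℝ).norm).mul_left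
  refine ⟨?_, ?_, ?_⟩
  · have le : ∫ z, ((sC z) ^ 4)⁻¹ * gG f z ^ 2 ≤ 1/6 * (∫ z, ((sC z) ^ 3)⁻¹ * gG f z ^ 2) + 36 * ∫ z, ((sC z) ^ 6)⁻¹ * gG f z ^ 2 := by
      rw [← integral_const_mul, ← integral_const_mul, ← integral_add ((i 3).const_mul _) ((i 6).const_mul _)]
      refine integral_mono (i 4) (((i 3).const_mul _).fun_add ((i 6).const_mul _)) fun z => ?_
      have hp := sC_pos z
      have h : ((sC z) ^ 4)⁻¹ ≤ 1/6 * ((sC z) ^ 3)⁻¹ + 36 * ((sC z) ^ 6)⁻¹ := by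
        simp only [← inv_pow]
        have ht : 0 < (sC z)⁻¹ := by positivity
        generalize (sC z)⁻¹ = t at *
        have h3 : 0 < t ^ 3 := by positivity
        have : 0 ≤ 1/6 - t + 36 * t ^ 3 := by
          rcases le_total t (1/6) with h | h
          · have : 0 ≤ 36 * t ^ 3 := by positivity
            linarith
          · nlinarith [mul_nonneg ht.le (mul_self_nonneg (t - 1/6)), mul_nonneg ht.le (sub_nonneg.2 h)]
        nlinarith [mul_nonneg h3.le this]
      calc _ ≤ (1/6 * ((sC z) ^ 3)⁻¹ + 36 * ((sC z) ^ 6)⁻¹) * gG f z ^ 2 := by gcongr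
        _ = _ := by ring
    linarith
  · rw [← integral_const_mul]
    congr 1; ext z
    have := sC_ne z
    unfold gG; field_simp; ring
  · rw [← integral_const_mul, ← integral_const_mul, ← integral_add (idg.const_mul _) ((i 3).const_mul _)]
    refine integral_mono idf ((idg.const_mul _).fun_add ((i 3).const_mul _)) fun z => ?_
    have hp := sC_pos z
    have hd := hf.differentiable (by norm_num) z
    have hn : ‖fderiv ℝ f z‖ ≤ 8 * (sC z ^ 2)⁻¹ * (‖fderiv ℝ (gG f) z‖ + 4 * |gG f z| * (sC z)⁻¹ * ‖z‖) := by
      have e : fderiv ℝ f z = (8 * (sC z ^ 2)⁻¹) • (fderiv ℝ (gG f) z - (4 * gG f z * (sC z)⁻¹) • innerSL ℝ z) := by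
        rw [(gG_hasFDerivAt f z hd).fderiv]
        ext v
        simp only [smul_apply, sub_apply, add_apply, smul_eq_mul, gG]
        field_simp
        ring
      rw [e, norm_smul, Real.norm_of_nonneg (by positivity)]
      gcongr
      refine (norm_sub_le _ _).trans ?_
      rw [norm_smul, norm_mul, norm_mul, Real.norm_of_nonneg (by norm_num), Real.norm_eq_abs,
        Real.norm_of_nonneg (by positivity), innerSL_apply_norm]
    have h2 := sq_add_le _ _ _ (le_refl (‖fderiv ℝ (gG f) z‖ + 4 * |gG f z| * (sC z)⁻¹ * ‖z‖)) (by positivity)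
    have hz : ‖z‖ ^ 2 ≤ sC z := by unfold sC; linarith
    calc _ ≤ sC z ^ 2 * (8 * (sC z ^ 2)⁻¹ * (‖fderiv ℝ (gG f) z‖ + 4 * |gG f z| * (sC z)⁻¹ * ‖z‖)) ^ 2 := by gcongr
      _ = 64 * (sC z ^ 2)⁻¹ * (‖fderiv ℝ (gG f) z‖ + 4 * |gG f z| * (sC z)⁻¹ * ‖z‖) ^ 2 := by field_simp; ring
      _ ≤ 64 * (sC z ^ 2)⁻¹ * (2 * ‖fderiv ℝ (gG f) z‖ ^ 2 + 2 * (4 * |gG f z| * (sC z)⁻¹ * ‖z‖) ^ 2) := by gcongr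
      _ = 128 * ((sC z ^ 2)⁻¹ * ‖fderiv ℝ (gG f) z‖ ^ 2) + 2048 * ((sC z ^ 4)⁻¹ * gG f z ^ 2 * ‖z‖ ^ 2) := by
        rw [← sq_abs (gG f z)]; field_simp; ring
      _ ≤ 128 * ((sC z ^ 2)⁻¹ * ‖fderiv ℝ (gG f) z‖ ^ 2) + 2048 * ((sC z ^ 4)⁻¹ * gG f z ^ 2 * sC z) := by gcongr
      _ = _ := by field_simp

def mo (f X : ℂ → ℝ) : ℝ := ∫ z, ((sC z) ^ 4)⁻¹ * gG f z * X z
def mm (f : ℂ → ℝ) : ℝ := mo f X1 ^ 2 + mo f X2 ^ 2 + mo f X3 ^ 2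

lemma int6 : ∫ z : ℂ, ((sC z) ^ 6)⁻¹ ≤ Real.pi := by
  have := int_sC_pow 5 (by norm_num)
  rw [show (5+1) = 6 by rfl] at this
  rw [this]
  have := Real.pi_pos
  push_cast; linarith

lemma step4 : ∃ C : ℝ, 0 < C ∧ ∀ f : ℂ → ℝ, HasCompactSupport f → ContDiff ℝ 1 f →
    ∫ z, ((sC z) ^ 6)⁻¹ * gG f z ^ 2 ≤ C * ((∫ z, ((sC z) ^ 2)⁻¹ * ‖dW f z‖ ^ 2) + mm f) ∧
    Integrable (fun z => ((sC z) ^ 4)⁻¹ * ‖AA f z‖ ^ 2) ∧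
    ∫ z, ((sC z) ^ 4)⁻¹ * ‖AA f z‖ ^ 2 ≤ C * ((∫ z, ((sC z) ^ 2)⁻¹ * ‖dW f z‖ ^ 2) + mm f) := by
  obtain ⟨C3, hC3, S3⟩ := step3
  obtain ⟨Cp, hCp, P⟩ := pin
  have hpi := Real.pi_pos
  refine ⟨16 * (4 * C3 + 2 * Cp * (1 + 2 * C3) * Real.pi), by positivity, fun f hs hf => ?_⟩
  obtain ⟨ac, a3, ic, i3, bc, b3⟩ := S3 f hs hf
  set D := ∫ z, ((sC z) ^ 2)⁻¹ * ‖dW f z‖ ^ 2 with hD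
  have hD0 : 0 ≤ D := integral_nonneg fun z => by have := sC_pos z; positivity
  have hm0 : 0 ≤ mm f := by unfold mm; positivity
  have c6 := sC_inv_cont 6
  have c4 := sC_inv_cont 4
  have calc' := (alc_contDiff f hs hf).continuous
  have cal3 := (al3_contDiff f hs hf).continuous
  have cA := (AA_contDiff f hs hf).continuous
  have cg := (gG_contDiff f hf).continuous
  have cre := Complex.continuous_re
  have cim := Complex.continuous_im
  have cX1 := X1_cont
  have cX2 := X2_cont
  have cX3 := X3_cont
  set e : ℂ → ℝ := fun z => (alc f z - ac).re * X1 z + (alc f z - ac).im * X2 z + (al3 f z - a3) * X3 z with he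
  have ce : Continuous e := by
    have u1 : Continuous (fun z => (alc f z - ac).re) := cre.comp (calc'.sub continuous_const)
    have u2 : Continuous (fun z => (alc f z - ac).im) := cim.comp (calc'.sub continuous_const)
    have u3 : Continuous (fun z => al3 f z - a3) := by fun_prop
    exact ((u1.mul cX1).add (u2.mul cX2)).add (u3.mul cX3)
  have hg : ∀ z, gG f z = ac.re * X1 z + ac.im * X2 z + a3 * X3 z + e z := by
    intro z
    rw [g_id]
    simp only [he, X1, X2, X3, Complex.mul_re, Complex.conj_re, Complex.conj_im, Complex.sub_re, Complex.sub_im]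
    ring
  have esq : ∀ z, e z ^ 2 ≤ ‖alc f z - ac‖ ^ 2 + (al3 f z - a3) ^ 2 := by
    intro z
    rw [Complex.sq_norm, Complex.normSq_apply]
    simp only [he]
    have hx := X_sq z
    generalize (alc f z - ac).re = p
    generalize (alc f z - ac).im = q
    generalize (al3 f z - a3) = r
    generalize X1 z = x at *
    generalize X2 z = y at *
    generalize X3 z = w at *
    have : (p * p + q * q + r ^ 2) * (x ^ 2 + y ^ 2 + w ^ 2) - (p * x + q * y + r * w) ^ 2 =
      (p * y - q * x) ^ 2 + (p * w - r * x) ^ 2 + (q * w - r * y) ^ 2 := by ring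
    rw [hx] at this
    nlinarith [sq_nonneg (p * y - q * x), sq_nonneg (p * w - r * x), sq_nonneg (q * w - r * y)]
  have le1 : ∀ z, ((sC z) ^ 6)⁻¹ * e z ^ 2 ≤ ((sC z) ^ 6)⁻¹ * ‖alc f z - ac‖ ^ 2 + ((sC z) ^ 6)⁻¹ * (al3 f z - a3) ^ 2 := by
    intro z
    have := sC_pos z
    rw [← mul_add]
    have := esq z
    gcongr
  have ie : Integrable (fun z => ((sC z) ^ 6)⁻¹ * e z ^ 2) := by
    refine (ic.add i3).mono' (by apply Continuous.aestronglyMeasurable; fun_prop) (Filter.Eventually.of_forall fun z => ?_)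
    have := sC_pos z
    rw [Real.norm_of_nonneg (by positivity)]; exact le1 z
  have be : ∫ z, ((sC z) ^ 6)⁻¹ * e z ^ 2 ≤ 2 * C3 * D := by
    have := integral_mono ie (ic.fun_add i3) le1
    rw [integral_add ic i3] at this
    linarith
  have hp := P (gG f) e ac.re ac.im a3 ce hg ie
  have hp2 : ac.re ^ 2 + ac.im ^ 2 + a3 ^ 2 ≤ Cp * (mm f + 2 * C3 * D) := by
    refine hp.trans ?_
    unfold mm mo
    gcongr
  -- total
  have tot : ∀ z, ((sC z) ^ 6)⁻¹ * gG f z ^ 2 + ((sC z) ^ 4)⁻¹ * ‖AA f z‖ ^ 2 / 16 ≤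
      2 * (((sC z) ^ 6)⁻¹ * ‖alc f z - ac‖ ^ 2) + 2 * (((sC z) ^ 6)⁻¹ * (al3 f z - a3) ^ 2) +
        (2 * (ac.re ^ 2 + ac.im ^ 2 + a3 ^ 2)) * ((sC z) ^ 6)⁻¹ := by
    intro z
    have hps := sC_pos z
    have h1 : ((sC z) ^ 6)⁻¹ * gG f z ^ 2 + ((sC z) ^ 4)⁻¹ * ‖AA f z‖ ^ 2 / 16 = ((sC z) ^ 6)⁻¹ * (‖alc f z‖ ^ 2 + al3 f z ^ 2) := by
      rw [A_id]; field_simp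
    have h2 : ‖alc f z‖ ^ 2 ≤ 2 * ‖alc f z - ac‖ ^ 2 + 2 * (ac.re ^ 2 + ac.im ^ 2) := by
      have h : ‖alc f z‖ ≤ ‖alc f z - ac‖ + ‖ac‖ := by
        have := norm_add_le (alc f z - ac) ac
        simpa using this
      have h' := sq_add_le _ _ _ h (norm_nonneg _)
      rw [Complex.sq_norm ac, Complex.normSq_apply] at h'
      linarith
    have h3 : al3 f z ^ 2 ≤ 2 * (al3 f z - a3) ^ 2 + 2 * a3 ^ 2 := by nlinarith [sq_nonneg (al3 f z - a3 - a3)]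
    rw [h1]
    calc _ ≤ ((sC z) ^ 6)⁻¹ * ((2 * ‖alc f z - ac‖ ^ 2 + 2 * (ac.re ^ 2 + ac.im ^ 2)) + (2 * (al3 f z - a3) ^ 2 + 2 * a3 ^ 2)) := by gcongr
      _ = _ := by ring
  have i6 := integrable_sC_pow (k := 6) (by norm_num)
  have it := ((ic.const_mul 2).fun_add (i3.const_mul 2)).fun_add (i6.const_mul (2 * (ac.re ^ 2 + ac.im ^ 2 + a3 ^ 2)))
  have bt : ∫ z, (2 * (((sC z) ^ 6)⁻¹ * ‖alc f z - ac‖ ^ 2) + 2 * (((sC z) ^ 6)⁻¹ * (al3 f z - a3) ^ 2) +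
        (2 * (ac.re ^ 2 + ac.im ^ 2 + a3 ^ 2)) * ((sC z) ^ 6)⁻¹) ≤ (4 * C3 + 2 * Cp * (1 + 2 * C3) * Real.pi) * (D + mm f) := by
    rw [integral_add ((ic.const_mul 2).fun_add (i3.const_mul 2)) (i6.const_mul _), integral_add (ic.const_mul 2) (i3.const_mul 2),
      integral_const_mul, integral_const_mul, integral_const_mul]
    have h1 : 2 * (ac.re ^ 2 + ac.im ^ 2 + a3 ^ 2) * ∫ z : ℂ, ((sC z) ^ 6)⁻¹ ≤ 2 * (Cp * (mm f + 2 * C3 * D)) * Real.pi := by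
      have := int6
      gcongr
    have h2 : 2 * (Cp * (mm f + 2 * C3 * D)) * Real.pi ≤ 2 * Cp * (1 + 2 * C3) * Real.pi * (D + mm f) := by
      have a1 : 0 ≤ Cp * Real.pi * D := by positivity
      have a2 : 0 ≤ Cp * Real.pi * C3 * mm f := by positivity
      nlinarith
    have h3 : 0 ≤ C3 * mm f := by positivity
    nlinarith
  have hK : 0 ≤ (4 * C3 + 2 * Cp * (1 + 2 * C3) * Real.pi) * (D + mm f) := by positivity
  refine ⟨?_, ?_, ?_⟩
  · have : ∫ z, ((sC z) ^ 6)⁻¹ * gG f z ^ 2 ≤ _ := integral_mono_of_nonneg (Filter.Eventually.of_forall fun z => by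
        have := sC_pos z; simp only [Pi.zero_apply]; positivity) it (Filter.Eventually.of_forall fun z => by
        have h := tot z
        have h0 : 0 ≤ ((sC z) ^ 4)⁻¹ * ‖AA f z‖ ^ 2 / 16 := by have := sC_pos z; positivity
        simp only
        linarith)
    linarith
  · refine (it.const_mul 16).mono' (by apply Continuous.aestronglyMeasurable; fun_prop) (Filter.Eventually.of_forall fun z => ?_)
    have := sC_pos z
    rw [Real.norm_of_nonneg (by positivity)]
    have h := tot z
    have h0 : 0 ≤ ((sC z) ^ 6)⁻¹ * gG f z ^ 2 := by positivity
    linarith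
  · have : ∫ z, ((sC z) ^ 4)⁻¹ * ‖AA f z‖ ^ 2 ≤ _ := integral_mono_of_nonneg (Filter.Eventually.of_forall fun z => by
        have := sC_pos z; simp only [Pi.zero_apply]; positivity) (it.const_mul 16) (Filter.Eventually.of_forall fun z => by
        have h := tot z
        have h0 : 0 ≤ ((sC z) ^ 6)⁻¹ * gG f z ^ 2 := by have := sC_pos z; positivity
        simp only
        linarith)
    rw [integral_const_mul] at this
    linarith

def NN (f : ℂ → ℝ) : ℝ := (∫ z, sC z ^ 2 * ‖fderiv ℝ f z‖ ^ 2) + ∫ z, sC z * f z ^ 2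

lemma core : ∃ C : ℝ, 0 < C ∧ ∀ f : ℂ → ℝ, HasCompactSupport f → ContDiff ℝ 1 f →
    NN f ≤ C * ((∫ z, ((sC z) ^ 2)⁻¹ * ‖dW f z‖ ^ 2) + mm f) := by
  obtain ⟨C1, hC1, S4⟩ := step4
  obtain ⟨C2, hC2, S1⟩ := step1
  set ε := (32 * C2)⁻¹ with hε
  have hε0 : 0 < ε := by positivity
  set K := 216 * C1 + 2 + 1/2 * (ε ^ 2)⁻¹ * C1 with hK
  have hK0 : 0 < K := by positivity
  refine ⟨128 * (K + K) + 2112 * K, by positivity, fun f hs hf => ?_⟩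
  obtain ⟨b1, iA4, b2⟩ := S4 f hs hf
  obtain ⟨iW, -, -, iA1, b3⟩ := S1 f hs hf
  obtain ⟨h1, h2, h3⟩ := closing f hs hf
  set D := ∫ z, ((sC z) ^ 2)⁻¹ * ‖dW f z‖ ^ 2 with hD
  have hD0 : 0 ≤ D := integral_nonneg fun z => by have := sC_pos z; positivity
  have hm0 : 0 ≤ mm f := by unfold mm; positivity
  set N := ∫ z, ((sC z) ^ 3)⁻¹ * gG f z ^ 2
  have hN0 : 0 ≤ N := integral_nonneg fun z => by have := sC_pos z; positivity
  set T := ∫ z, ((sC z) ^ 2)⁻¹ * ‖fderiv ℝ (gG f) z‖ ^ 2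
  have hT : T ≤ 2 * D + 1/2 * (ε * (∫ z, (sC z)⁻¹ * ‖AA f z‖ ^ 2) + (ε ^ 2)⁻¹ * ∫ z, ((sC z) ^ 4)⁻¹ * ‖AA f z‖ ^ 2) := by
    have e : 2 * D + 1/2 * (ε * (∫ z, (sC z)⁻¹ * ‖AA f z‖ ^ 2) + (ε ^ 2)⁻¹ * ∫ z, ((sC z) ^ 4)⁻¹ * ‖AA f z‖ ^ 2)
      = ∫ z, (2 * (((sC z) ^ 2)⁻¹ * ‖dW f z‖ ^ 2) + ((1/2 * ε) * ((sC z)⁻¹ * ‖AA f z‖ ^ 2) + (1/2 * (ε ^ 2)⁻¹) * (((sC z) ^ 4)⁻¹ * ‖AA f z‖ ^ 2))) := by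
      rw [integral_add (iW.const_mul 2) ((iA1.const_mul _).fun_add (iA4.const_mul _)), integral_add (iA1.const_mul _) (iA4.const_mul _),
        integral_const_mul, integral_const_mul, integral_const_mul]
      ring
    rw [e]
    refine integral_mono_of_nonneg (Filter.Eventually.of_forall fun z => by
        have := sC_pos z; simp only [Pi.zero_apply]; positivity) ((iW.const_mul 2).fun_add ((iA1.const_mul _).fun_add (iA4.const_mul _)))
        (Filter.Eventually.of_forall fun z => ?_)
    have hp := sC_pos z
    have hd := sq_add_le _ _ _ (dg_norm_le f z) (norm_nonneg _)
    have ht : ((sC z) ^ 2)⁻¹ ≤ ε * (sC z)⁻¹ + (ε ^ 2)⁻¹ * ((sC z) ^ 4)⁻¹ := by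
      simp only [← inv_pow]
      have ht : 0 < (sC z)⁻¹ := by positivity
      generalize (sC z)⁻¹ = t at *
      rcases le_total t ε with h | h
      · have : 0 ≤ ε⁻¹ ^ 2 * t ^ 4 := by positivity
        nlinarith
      · have : 1 ≤ ε⁻¹ * t := by rw [← div_eq_inv_mul, le_div_iff₀ hε0]; linarith
        have : 1 ≤ (ε⁻¹ * t) ^ 2 := one_le_pow₀ this
        have : t ^ 2 * 1 ≤ t ^ 2 * (ε⁻¹ * t) ^ 2 := by gcongr
        have : 0 ≤ ε * t := by positivity
        nlinarith
    simp only
    calc _ ≤ ((sC z) ^ 2)⁻¹ * (2 * ‖dW f z‖ ^ 2 + 2 * (1/2 * ‖AA f z‖) ^ 2) := by gcongr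
      _ = 2 * (((sC z) ^ 2)⁻¹ * ‖dW f z‖ ^ 2) + ((sC z) ^ 2)⁻¹ * (1/2 * ‖AA f z‖ ^ 2) := by ring
      _ ≤ 2 * (((sC z) ^ 2)⁻¹ * ‖dW f z‖ ^ 2) + (ε * (sC z)⁻¹ + (ε ^ 2)⁻¹ * ((sC z) ^ 4)⁻¹) * (1/2 * ‖AA f z‖ ^ 2) := by gcongr
      _ = _ := by ring
  have hT2 : T ≤ 2 * D + N + 1/2 * (ε ^ 2)⁻¹ * C1 * (D + mm f) := by
    have a1 : ε * (∫ z, (sC z)⁻¹ * ‖AA f z‖ ^ 2) ≤ 2 * N := by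
      calc _ ≤ ε * (C2 * (64 * N)) := by rw [← h2]; gcongr
        _ = 2 * N := by rw [hε]; field_simp; ring
    have a2 : (ε ^ 2)⁻¹ * ∫ z, ((sC z) ^ 4)⁻¹ * ‖AA f z‖ ^ 2 ≤ (ε ^ 2)⁻¹ * (C1 * (D + mm f)) := by gcongr
    linarith
  have hNK : N ≤ K * (D + mm f) := by rw [hK]; linarith
  have hTK : T ≤ (K + K) * (D + mm f) := by
    have : 0 ≤ 216 * C1 * (D + mm f) := by positivity
    rw [hK] at *; linarith
  unfold NN
  rw [h2]
  linarith

set_option maxHeartbeats 1000000 in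
lemma core_junk : ∃ C : ℝ, 0 < C ∧ ∀ f : ℂ → ℝ, HasCompactSupport f → ContDiff ℝ 1 f →
    NN f ≤ C * ((∫ z, ((sC z) ^ 2)⁻¹ * ‖fderiv ℝ (gG f) z‖ ^ 2) + mm f) := by
  obtain ⟨C, hC, SPr⟩ := SPr
  have hpi := Real.pi_pos
  set K := 72 * (1 + Real.pi * C) * (Real.pi ^ 2)⁻¹ with hK
  have hK0 : 0 < K := by positivity
  set B := 2 * C + 2 * K * Real.pi with hB
  refine ⟨128 + 2112 * (216 * B + 1), by positivity, fun f hs hf => ?_⟩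
  obtain ⟨h1, h2, h3⟩ := closing f hs hf
  have hg := gG_contDiff f hf
  have cg := hg.continuous
  have c2 := sC_inv_cont 2
  have c3 := sC_inv_cont 3
  have c4 := sC_inv_cont 4
  have gs := gG_supp f hs
  have cdg := hg.continuous_fderiv (by norm_num)
  have i3 : Integrable (fun z => ((sC z) ^ 3)⁻¹ * ‖fderiv ℝ (gG f) z‖ ^ 2) := by
    exact Continuous.integrable_of_hasCompactSupport (by fun_prop) (sq_supp _ (gs.fderiv ℝ).norm).mul_left
  have i2 : Integrable (fun z => ((sC z) ^ 2)⁻¹ * ‖fderiv ℝ (gG f) z‖ ^ 2) := by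
    exact Continuous.integrable_of_hasCompactSupport (by fun_prop) (sq_supp _ (gs.fderiv ℝ).norm).mul_left
  set T := ∫ z, ((sC z) ^ 2)⁻¹ * ‖fderiv ℝ (gG f) z‖ ^ 2
  have hT0 : 0 ≤ T := integral_nonneg fun z => by have := sC_pos z; positivity
  have hm0 : 0 ≤ mm f := by unfold mm; positivity
  have h32 : ∫ z, ((sC z) ^ 3)⁻¹ * ‖fderiv ℝ (gG f) z‖ ^ 2 ≤ T := integral_mono i3 i2 fun z => by
    have := sC_inv_le (show 2 ≤ 3 by norm_num) z
    simp only; gcongr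
  obtain ⟨a, ia, ba⟩ := SPr (gG f) hg i3
  have ba' : ∫ z, ((sC z) ^ 6)⁻¹ * (gG f z - a) ^ 2 ≤ C * T := ba.trans (by gcongr)
  obtain ⟨ie, be⟩ := cs_e (fun z => gG f z - a) X3 (by fun_prop) X3_cont X3_le ia
  have iX : Integrable (fun z => ((sC z) ^ 4)⁻¹ * X3 z) := by
    refine (integrable_sC_pow (k := 4) (by norm_num)).mono' (by have := X3_cont; apply Continuous.aestronglyMeasurable; fun_prop)
      (Filter.Eventually.of_forall fun z => ?_)
    have := sC_pos z
    rw [norm_mul, Real.norm_of_nonneg (by positivity), Real.norm_eq_abs]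
    calc _ ≤ ((sC z) ^ 4)⁻¹ * 1 := by gcongr; exact X3_le z
      _ = _ := by ring
  have pX : ∫ z, ((sC z) ^ 4)⁻¹ * X3 z = Real.pi / 6 := by
    have e : ∀ z, ((sC z) ^ 4)⁻¹ * X3 z = 2 * ((sC z) ^ (4+1))⁻¹ - ((sC z) ^ (3+1))⁻¹ := fun z => by
      have := sC_ne z; unfold X3; field_simp; ring
    simp_rw [e]
    rw [integral_sub ((integrable_sC_pow (by norm_num)).const_mul 2) (integrable_sC_pow (by norm_num)), integral_const_mul,
      int_sC_pow 4 (by norm_num), int_sC_pow 3 (by norm_num)]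
    push_cast; ring
  have em : mo f X3 = a * (Real.pi / 6) + ∫ z, ((sC z) ^ 4)⁻¹ * (gG f z - a) * X3 z := by
    rw [← pX, ← integral_const_mul, ← integral_add (iX.const_mul a) ie]
    unfold mo; congr 1; ext z; ring
  have ha : a ^ 2 ≤ K * (T + mm f) := by
    have h5 : (a * (Real.pi / 6)) ^ 2 ≤ 2 * mo f X3 ^ 2 + 2 * (Real.pi * (C * T)) := by
      have be' := be.trans (mul_le_mul_of_nonneg_left ba' hpi.le)
      have : a * (Real.pi / 6) = mo f X3 - ∫ z, ((sC z) ^ 4)⁻¹ * (gG f z - a) * X3 z := by linarith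
      rw [this]
      nlinarith [sq_nonneg (mo f X3 + ∫ z, ((sC z) ^ 4)⁻¹ * (gG f z - a) * X3 z)]
    have h6 : mo f X3 ^ 2 ≤ mm f := by unfold mm; nlinarith [sq_nonneg (mo f X1), sq_nonneg (mo f X2)]
    have : a ^ 2 = 36 * (Real.pi ^ 2)⁻¹ * (a * (Real.pi / 6)) ^ 2 := by field_simp; ring
    rw [this, hK]
    have h7 : (a * (Real.pi / 6)) ^ 2 ≤ 2 * (1 + Real.pi * C) * (T + mm f) := by
      have : 0 ≤ Real.pi * C * mm f := by positivity
      nlinarith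
    calc _ ≤ 36 * (Real.pi ^ 2)⁻¹ * (2 * (1 + Real.pi * C) * (T + mm f)) := by gcongr
      _ = _ := by ring
  have b6 : ∫ z, ((sC z) ^ 6)⁻¹ * gG f z ^ 2 ≤ B * (T + mm f) := by
    have i6 := integrable_sC_pow (k := 6) (by norm_num)
    have : ∫ z, ((sC z) ^ 6)⁻¹ * gG f z ^ 2 ≤ ∫ z, (2 * (((sC z) ^ 6)⁻¹ * (gG f z - a) ^ 2) + (2 * a ^ 2) * ((sC z) ^ 6)⁻¹) := by
      refine integral_mono_of_nonneg (Filter.Eventually.of_forall fun z => by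
        have := sC_pos z; simp only [Pi.zero_apply]; positivity) ((ia.const_mul 2).fun_add (i6.const_mul _)) (Filter.Eventually.of_forall fun z => ?_)
      have := sC_pos z
      have h : gG f z ^ 2 ≤ 2 * (gG f z - a) ^ 2 + 2 * a ^ 2 := by nlinarith [sq_nonneg (gG f z - a - a)]
      simp only
      calc _ ≤ ((sC z) ^ 6)⁻¹ * (2 * (gG f z - a) ^ 2 + 2 * a ^ 2) := by gcongr
        _ = _ := by ring
    rw [integral_add (ia.const_mul 2) (i6.const_mul _), integral_const_mul, integral_const_mul] at this
    have h9 : 2 * a ^ 2 * ∫ z : ℂ, ((sC z) ^ 6)⁻¹ ≤ 2 * (K * (T + mm f)) * Real.pi := by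
      have := int6
      gcongr
    have : 0 ≤ C * mm f := by positivity
    rw [hB]; nlinarith
  unfold NN
  rw [h2]
  have hB0 : 0 ≤ B := by positivity
  clear_value T B K
  generalize (∫ z, ((sC z) ^ 3)⁻¹ * gG f z ^ 2) = N at *
  generalize (∫ z, ((sC z) ^ 6)⁻¹ * gG f z ^ 2) = N6 at *
  generalize mm f = m at *
  have e1 : 0 ≤ B * (T + m) := by positivity
  have hN : 2 * N ≤ (216 * B + 1) * (T + m) := by linarith
  linarith

def trC (t : ℂ) : C(ℂ, ℂ) := ⟨fun x => x - t, by fun_prop⟩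

lemma trC_cont : Continuous trC := by
  apply ContinuousMap.continuous_of_continuous_uncurry
  show Continuous (fun p : ℂ × ℂ => p.2 - p.1)
  fun_prop

lemma transl {F : Type*} [NormedAddCommGroup F] (K : ℂ → F) (hK : MemLp K 2 (volume : Measure ℂ)) (ε : ℝ≥0∞) (hε : 0 < ε) :
    ∃ δ > 0, ∀ t : ℂ, ‖t‖ < δ → ∫⁻ x, ‖K (x - t) - K x‖ₑ ^ 2 ≤ ε := by
  have hm : ∀ t, MeasurePreserving (trC t) (volume : Measure ℂ) volume := fun t => measurePreserving_sub_right volume t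
  have h := Filter.Tendsto.compMeasurePreservingLp (p := 2) (l := nhds (0:ℂ)) (f := fun _ => hK.toLp K) (f₀ := hK.toLp K)
    (g := trC) (g₀ := trC 0) tendsto_const_nhds trC_cont.continuousAt hm (hm 0) (by norm_num)
  have h2 := tendsto_iff_edist_tendsto_0.1 h
  have h3 := h2.eventually (gt_mem_nhds (show (0:ℝ≥0∞) < ε ^ (1/2:ℝ) from ENNReal.rpow_pos_of_nonneg hε (by norm_num)))
  obtain ⟨δ, hδ, hh⟩ := Metric.eventually_nhds_iff.1 h3
  refine ⟨δ, hδ, fun t ht => ?_⟩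
  have h4 := hh (y := t) (by simpa using ht)
  rw [Lp.edist_def] at h4
  have h5 : eLpNorm (fun x => K (x - t) - K x) 2 volume < ε ^ (1/2:ℝ) := by
    refine lt_of_eq_of_lt (eLpNorm_congr_ae ?_) h4
    have a1 := Lp.coeFn_compMeasurePreserving (hK.toLp K) (hm t)
    have a2 := Lp.coeFn_compMeasurePreserving (hK.toLp K) (hm 0)
    have a3 := (hm t).quasiMeasurePreserving.ae_eq_comp hK.coeFn_toLp
    have a4 := (hm 0).quasiMeasurePreserving.ae_eq_comp hK.coeFn_toLp
    filter_upwards [a1, a2, a3, a4] with x b1 b2 b3 b4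
    simp only [Pi.sub_apply]
    rw [b1, b2, b3, b4]
    simp [trC]
  have h6 := eLpNorm_nnreal_pow_eq_lintegral (μ := (volume:Measure ℂ)) (f := fun x => K (x - t) - K x) (p := 2) (by norm_num)
  have e2 : ∀ x : ℝ≥0∞, x ^ (((2:NNReal)):ℝ) = x ^ 2 := fun x => by norm_num
  simp only [e2] at h6
  rw [← h6]
  have h7 : eLpNorm (fun x => K (x - t) - K x) ((2:NNReal):ℝ≥0∞) volume ≤ ε ^ (1/2:ℝ) := h5.le
  calc _ ≤ (ε ^ (1/2:ℝ)) ^ 2 := by gcongr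
    _ = ε := by rw [← ENNReal.rpow_natCast, ← ENNReal.rpow_mul]; norm_num

lemma moll {F : Type*} [NormedAddCommGroup F] [NormedSpace ℝ F] [CompleteSpace F] (K : ℂ → F) (hKm : StronglyMeasurable K)
    (hK : MemLp K 2 (volume : Measure ℂ)) (ε : ℝ≥0∞) (hε : 0 < ε) :
    ∃ δ > 0, ∀ φ : ContDiffBump (0:ℂ), φ.rOut ≤ δ →
      ∫⁻ x, ‖(∫ t, φ.normed volume t • K (x - t)) - K x‖ₑ ^ 2 ≤ ε := by
  obtain ⟨δ, hδ, H⟩ := transl K hK ε hε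
  refine ⟨δ, hδ, fun φ hφ => ?_⟩
  set ρ := φ.normed (volume : Measure ℂ) with hρ
  have ρc : Continuous ρ := φ.continuous_normed
  have ρ0 : ∀ t, 0 ≤ ρ t := φ.nonneg_normed
  have ρ1 : ∫⁻ t, ‖ρ t‖ₑ = 1 := by
    have h := φ.integral_normed (μ := (volume:Measure ℂ))
    have h2 := ofReal_integral_norm_eq_lintegral_enorm (φ.integrable_normed (μ := (volume : Measure ℂ)))
    rw [← h2]
    simp_rw [Real.norm_of_nonneg (φ.nonneg_normed (μ := (volume:Measure ℂ)) _)]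
    rw [h]; simp
  have hloc : LocallyIntegrable K volume := hK.locallyIntegrable (by norm_num)
  have hint : ∀ x, Integrable (fun t => ρ t • K (x - t)) := by
    intro x
    have h1 : LocallyIntegrable (fun t => K (x - t)) volume := by
      have := (Measure.measurePreserving_sub_left (volume : Measure ℂ) x)
      have h2 : MemLp (fun t => K (x - t)) 2 volume := hK.comp_measurePreserving this
      exact h2.locallyIntegrable (by norm_num)
    exact h1.integrable_smul_left_of_hasCompactSupport ρc φ.hasCompactSupport_normed
  have jm : StronglyMeasurable (fun p : ℂ × ℂ => K (p.1 - p.2) - K p.1) := by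
    exact (hKm.comp_measurable (by fun_prop)).sub (hKm.comp_measurable (by fun_prop))
  have jm2 : Measurable (fun p : ℂ × ℂ => ‖ρ p.2‖ₑ * ‖K (p.1 - p.2) - K p.1‖ₑ ^ 2) :=
    ((ρc.measurable.comp measurable_snd).enorm).mul (jm.enorm.pow_const 2)
  have pt : ∀ x, ‖(∫ t, ρ t • K (x - t)) - K x‖ₑ ^ 2 ≤ ∫⁻ t, ‖ρ t‖ₑ * ‖K (x - t) - K x‖ₑ ^ 2 := by
    intro x
    have e : (∫ t, ρ t • K (x - t)) - K x = ∫ t, ρ t • (K (x - t) - K x) := by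
      simp_rw [smul_sub]
      rw [integral_sub (hint x) (φ.integrable_normed.smul_const _), integral_smul_const, φ.integral_normed, one_smul]
    rw [e]
    have jx : Measurable (fun t => ‖K (x - t) - K x‖ₑ) := (jm.comp_measurable (g := fun t => (x, t)) (by fun_prop)).enorm
    have h1 : ‖∫ t, ρ t • (K (x - t) - K x)‖ₑ ≤ ∫⁻ t, ‖ρ t‖ₑ ^ (1/2:ℝ) * (‖ρ t‖ₑ ^ (1/2:ℝ) * ‖K (x - t) - K x‖ₑ) := by
      refine (enorm_integral_le_lintegral_enorm _).trans (le_of_eq ?_)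
      congr 1; ext t
      rw [enorm_smul, ← mul_assoc, ← ENNReal.rpow_add_of_nonneg _ _ (by norm_num) (by norm_num)]
      norm_num
    have e3 : ∀ t, (‖ρ t‖ₑ ^ (1/2:ℝ)) ^ 2 = ‖ρ t‖ₑ := fun t => by
      rw [← ENNReal.rpow_natCast, ← ENNReal.rpow_mul]; norm_num
    have ρm : AEMeasurable (fun t => ‖ρ t‖ₑ ^ (1/2:ℝ)) (volume : Measure ℂ) := (ρc.measurable.enorm.pow_const _).aemeasurable
    have h2 := cs_lint (volume : Measure ℂ) ρm (ρm.mul jx.aemeasurable)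
    refine (pow_le_pow_left' h1 2).trans (h2.trans ?_)
    simp only [mul_pow, e3, ρ1, one_mul, Pi.mul_apply]
    exact le_rfl
  calc _ ≤ ∫⁻ x, ∫⁻ t, ‖ρ t‖ₑ * ‖K (x - t) - K x‖ₑ ^ 2 := lintegral_mono pt
    _ = ∫⁻ t, ∫⁻ x, ‖ρ t‖ₑ * ‖K (x - t) - K x‖ₑ ^ 2 := lintegral_lintegral_swap jm2.aemeasurable
    _ ≤ ∫⁻ t, ‖ρ t‖ₑ * ε := by
        refine lintegral_mono fun t => ?_
        rw [lintegral_const_mul' _ _ (by simp)]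
        by_cases ht : ‖t‖ < δ
        · gcongr; exact H t ht
        · have : ρ t = 0 := by
            by_contra hne
            have : t ∈ Function.support ρ := hne
            rw [hρ, φ.support_normed_eq] at this
            simp at this
            linarith
          simp [this]
    _ = ε := by rw [lintegral_mul_const _ ρc.measurable.enorm, ρ1, one_mul]

structure WW (f : ℂ → ℝ) : Prop where
  d : Differentiable ℝ f
  i0 : Integrable (fun z => sC z * f z ^ 2)
  i1 : Integrable (fun z => sC z ^ 2 * ‖fderiv ℝ f z‖ ^ 2)

lemma WW_cc (f : ℂ → ℝ) (hs : HasCompactSupport f) (hf : ContDiff ℝ 1 f) : WW f := by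
  have c := hf.continuous
  have cd := hf.continuous_fderiv (by norm_num)
  have s := sC_cont
  refine ⟨hf.differentiable (by norm_num), ?_, ?_⟩
  · exact Continuous.integrable_of_hasCompactSupport (by fun_prop) (sq_supp _ hs).mul_left
  · exact Continuous.integrable_of_hasCompactSupport (by fun_prop) (sq_supp _ (hs.fderiv ℝ).norm).mul_left

lemma fderiv_meas (f : ℂ → ℝ) : Measurable (fderiv ℝ f) := measurable_fderiv ℝ f

lemma WW_add (a b : ℂ → ℝ) (ha : WW a) (hb : WW b) : WW (fun z => a z + b z) ∧
    NN (fun z => a z + b z) ≤ 2 * NN a + 2 * NN b := by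
  have s := sC_cont
  have ca := ha.d.continuous
  have cb := hb.d.continuous
  have hd : Differentiable ℝ (fun z => a z + b z) := ha.d.add hb.d
  have i0 := (ha.i0.const_mul 2).fun_add (hb.i0.const_mul 2)
  have i1 := (ha.i1.const_mul 2).fun_add (hb.i1.const_mul 2)
  have l0 : ∀ z, sC z * (a z + b z) ^ 2 ≤ 2 * (sC z * a z ^ 2) + 2 * (sC z * b z ^ 2) := by
    intro z
    have := sC_pos z
    have h : (a z + b z) ^ 2 ≤ 2 * a z ^ 2 + 2 * b z ^ 2 := by nlinarith [sq_nonneg (a z - b z)]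
    calc _ ≤ sC z * (2 * a z ^ 2 + 2 * b z ^ 2) := by gcongr
      _ = _ := by ring
  have l1 : ∀ z, sC z ^ 2 * ‖fderiv ℝ (fun z => a z + b z) z‖ ^ 2 ≤
      2 * (sC z ^ 2 * ‖fderiv ℝ a z‖ ^ 2) + 2 * (sC z ^ 2 * ‖fderiv ℝ b z‖ ^ 2) := by
    intro z
    have := sC_pos z
    rw [fderiv_fun_add ha.d.differentiableAt hb.d.differentiableAt]
    have h := sq_add_le _ _ _ (norm_add_le (fderiv ℝ a z) (fderiv ℝ b z)) (norm_nonneg _)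
    calc _ ≤ sC z ^ 2 * (2 * ‖fderiv ℝ a z‖ ^ 2 + 2 * ‖fderiv ℝ b z‖ ^ 2) := by gcongr
      _ = _ := by ring
  have j0 : Integrable (fun z => sC z * (a z + b z) ^ 2) := by
    refine i0.mono' (Continuous.aestronglyMeasurable (by fun_prop)) (Filter.Eventually.of_forall fun z => ?_)
    have := sC_pos z
    rw [Real.norm_of_nonneg (by positivity)]; exact l0 z
  have j1 : Integrable (fun z => sC z ^ 2 * ‖fderiv ℝ (fun z => a z + b z) z‖ ^ 2) := by
    refine i1.mono' ?_ (Filter.Eventually.of_forall fun z => ?_)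
    · have h := fderiv_meas (fun z => a z + b z)
      have s' := s.measurable
      exact ((s'.pow_const 2).mul (h.norm.pow_const 2)).aestronglyMeasurable
    have := sC_pos z
    rw [Real.norm_of_nonneg (by positivity)]; exact l1 z
  refine ⟨⟨hd, j0, j1⟩, ?_⟩
  have k0 := integral_mono j0 i0 l0
  have k1 := integral_mono j1 i1 l1
  rw [integral_add (ha.i0.const_mul 2) (hb.i0.const_mul 2), integral_const_mul, integral_const_mul] at k0
  rw [integral_add (ha.i1.const_mul 2) (hb.i1.const_mul 2), integral_const_mul, integral_const_mul] at k1
  unfold NN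
  linarith

lemma WW_neg (a : ℂ → ℝ) (ha : WW a) : WW (fun z => - a z) ∧ NN (fun z => - a z) = NN a := by
  have e : ∀ z, fderiv ℝ (fun z => - a z) z = - fderiv ℝ a z := fun z => by rw [fderiv_fun_neg]
  refine ⟨⟨ha.d.neg, by simpa using ha.i0, by simpa [e] using ha.i1⟩, by simp [NN, e]⟩

lemma WW_sub (a b : ℂ → ℝ) (ha : WW a) (hb : WW b) : WW (fun z => a z - b z) ∧
    NN (fun z => a z - b z) ≤ 2 * NN a + 2 * NN b := by
  have := WW_add a _ ha (WW_neg b hb).1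
  rw [(WW_neg b hb).2] at this
  simpa [sub_eq_add_neg] using this

lemma int_of_lint {F : Type*} [NormedAddCommGroup F] (u : ℂ → F) (hu : StronglyMeasurable u) (a : ℝ) (ha : 0 ≤ a)
    (h : ∫⁻ x, ‖u x‖ₑ ^ 2 ≤ ENNReal.ofReal a) : Integrable (fun z => ‖u z‖ ^ 2) ∧ ∫ z, ‖u z‖ ^ 2 ≤ a := by
  have e : ∀ x, ‖u x‖ₑ ^ 2 = ENNReal.ofReal (‖u x‖ ^ 2) := fun x => by
    rw [ENNReal.ofReal_pow (norm_nonneg _), ofReal_norm]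
  simp_rw [e] at h
  have i : Integrable (fun z => ‖u z‖ ^ 2) := by
    refine ⟨(hu.norm.pow 2).aestronglyMeasurable, ?_⟩
    rw [hasFiniteIntegral_iff_ofReal (Filter.Eventually.of_forall fun z => by simp only [Pi.zero_apply]; positivity)]
    exact h.trans_lt ENNReal.ofReal_lt_top
  refine ⟨i, ?_⟩
  rw [integral_eq_lintegral_of_nonneg_ae (Filter.Eventually.of_forall fun z => by simp only [Pi.zero_apply]; positivity) i.aestronglyMeasurable]
  exact ENNReal.toReal_le_of_le_ofReal ha h

lemma moll_fderiv (f : ℂ → ℝ) (hs : HasCompactSupport f) (hd : Differentiable ℝ f)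
    (hi : LocallyIntegrable (fderiv ℝ f) volume) (φ : ContDiffBump (0:ℂ)) :
    ContDiff ℝ 1 (fun x => ∫ t, φ.normed volume t • f (x - t)) ∧
    ∀ x, fderiv ℝ (fun x => ∫ t, φ.normed volume t • f (x - t)) x = ∫ t, φ.normed volume t • fderiv ℝ f (x - t) := by
  set ρ := φ.normed (volume : Measure ℂ) with hρ
  have ρc : Continuous ρ := φ.continuous_normed
  have ρd : ContDiff ℝ 1 ρ := φ.contDiff_normed (n := 1)
  have ρs : HasCompactSupport ρ := φ.hasCompactSupport_normed
  have fl : LocallyIntegrable f (volume : Measure ℂ) := hd.continuous.locallyIntegrable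
  have e : (fun x => ∫ t, ρ t • f (x - t)) = convolution f ρ (ContinuousLinearMap.mul ℝ ℝ) volume := by
    ext x
    rw [convolution_def, ← integral_sub_left_eq_self _ volume x]
    congr 1; ext t
    simp [mul_comm]
  refine ⟨by rw [e]; exact ρs.contDiff_convolution_right _ fl ρd, fun x => ?_⟩
  rw [e, (ρs.hasFDerivAt_convolution_right (ContinuousLinearMap.mul ℝ ℝ) fl ρd x).fderiv]
  have rs : HasCompactSupport (fun t => ρ (x - t)) := ρs.comp_homeomorph (Homeomorph.subLeft x)
  have rc : Continuous (fun t => ρ (x - t)) := by fun_prop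
  have gi0 : Integrable (fun t => ρ (x - t) • fderiv ℝ f t) := hi.integrable_smul_left_of_hasCompactSupport rc rs
  have gi : Integrable (fun t => ρ t • fderiv ℝ f (x - t)) := by
    simpa using gi0.comp_sub_left x
  ext v
  rw [convolution_precompR_apply _ fl (ρs.fderiv ℝ) (ρd.continuous_fderiv (by norm_num)), convolution_def,
    ContinuousLinearMap.integral_apply gi, ← integral_sub_left_eq_self (fun t => (ρ t • fderiv ℝ f (x - t)) v) volume x]
  have fd : ∀ t, fderiv ℝ (fun t => ρ (x - t)) t v = - fderiv ℝ ρ (x - t) v := by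
    intro t
    have h1 : HasFDerivAt ρ (fderiv ℝ ρ (x - t)) (x - t) := (ρd.differentiable (by norm_num) _).hasFDerivAt
    have h2 : HasFDerivAt (fun t : ℂ => x - t) (-(ContinuousLinearMap.id ℝ ℂ)) t := (hasFDerivAt_id t).const_sub x
    have h3 : HasFDerivAt (fun t => ρ (x - t)) ((fderiv ℝ ρ (x - t)).comp (-(ContinuousLinearMap.id ℝ ℂ))) t := h1.comp t h2
    rw [h3.fderiv]
    simp
  have cdρ : Continuous (fun t => fderiv ℝ ρ (x - t) v) := by
    have := ρd.continuous_fderiv (by norm_num)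
    fun_prop
  have fc := hd.continuous
  have ibp := integral_mul_fderiv_eq_neg_fderiv_mul_of_integrable (μ := (volume : Measure ℂ)) (f := f) (g := fun t => ρ (x - t)) (v := v)
    (by
      have := gi0.apply_continuousLinearMap v
      simpa [mul_comm] using this)
    (by
      simp only [fd]
      exact Continuous.integrable_of_hasCompactSupport (by fun_prop) hs.mul_right)
    (Continuous.integrable_of_hasCompactSupport (by fun_prop) hs.mul_right)
    (fun x _ => hd x)
    (fun y _ => ((ρd.differentiable (by norm_num)).comp (by fun_prop : Differentiable ℝ (fun t : ℂ => x - t))) y)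
  simp only [fd] at ibp
  simp only [mul_neg, integral_neg, neg_inj] at ibp
  simp only [ContinuousLinearMap.mul_apply', sub_sub_cancel]
  rw [ibp]
  congr 1; ext t; simp [mul_comm]

lemma dens_c (f : ℂ → ℝ) (hs : HasCompactSupport f) (hf : WW f) (ε : ℝ) (hε : 0 < ε) :
    ∃ φ : ℂ → ℝ, HasCompactSupport φ ∧ ContDiff ℝ 1 φ ∧ NN (fun z => f z - φ z) ≤ ε := by
  obtain ⟨R, hR⟩ : ∃ R : ℝ, ∀ z, R < ‖z‖ → f z = 0 := by
    obtain ⟨R, hR⟩ := hs.isCompact.isBounded.subset_closedBall (0:ℂ)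
    refine ⟨R, fun z hz => ?_⟩
    by_contra h
    have := hR (subset_tsupport f h)
    simp at this
    linarith
  set M := (1 + (|R| + 1) ^ 2) ^ 2 with hM
  have hM1 : 1 ≤ M := one_le_pow₀ (by nlinarith [sq_nonneg (|R| + 1)])
  set η := ε / (2 * M) with hη
  have hη0 : 0 < η := by positivity
  have fc := hf.d.continuous
  have dm := (fderiv_meas f).stronglyMeasurable
  have m0 : MemLp f 2 (volume : Measure ℂ) := by
    rw [memLp_two_iff_integrable_sq fc.aestronglyMeasurable]
    exact Continuous.integrable_of_hasCompactSupport (by fun_prop) (sq_supp _ hs)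
  have m1 : MemLp (fderiv ℝ f) 2 (volume : Measure ℂ) := by
    rw [memLp_two_iff_integrable_sq_norm dm.aestronglyMeasurable]
    refine hf.i1.mono' (dm.norm.pow 2).aestronglyMeasurable (Filter.Eventually.of_forall fun z => ?_)
    rw [Real.norm_of_nonneg (by positivity)]
    have := one_le_pow₀ (sC_one_le z) (n := 2)
    nlinarith [sq_nonneg ‖fderiv ℝ f z‖]
  obtain ⟨δ0, hδ0, H0⟩ := moll f fc.stronglyMeasurable m0 (ENNReal.ofReal η) (by simpa using hη0)
  obtain ⟨δ1, hδ1, H1⟩ := moll (fderiv ℝ f) dm m1 (ENNReal.ofReal η) (by simpa using hη0)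
  set δ := min (min δ0 δ1) 1 with hδ
  have hδp : 0 < δ := by positivity
  let φ : ContDiffBump (0:ℂ) := ⟨δ / 2, δ, by positivity, by linarith⟩
  have r0 : φ.rOut ≤ δ0 := (min_le_left _ _).trans (min_le_left _ _)
  have r1 : φ.rOut ≤ δ1 := (min_le_left _ _).trans (min_le_right _ _)
  have r2 : φ.rOut ≤ 1 := min_le_right _ _
  obtain ⟨hc, hfd⟩ := moll_fderiv f hs hf.d (m1.locallyIntegrable (by norm_num)) φ
  have k0 := H0 φ r0
  have k1 := H1 φ r1
  set m := (fun x => ∫ t, φ.normed volume t • f (x - t)) with hm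
  have mz : ∀ z, |R| + 1 < ‖z‖ → m z = 0 := by
    intro z hz
    rw [hm]; simp only
    rw [← integral_zero ℂ ℝ]
    congr 1; ext t
    by_cases ht : ‖t‖ < 1
    · rw [hR, smul_zero]
      have := norm_sub_norm_le z t
      have := le_abs_self R
      linarith
    · have : φ.normed volume t = 0 := by
        by_contra hne
        have : t ∈ Function.support (φ.normed volume) := hne
        rw [φ.support_normed_eq] at this
        simp at this
        linarith
      rw [this, zero_smul]
  have ms : HasCompactSupport m := by
    refine HasCompactSupport.intro (isCompact_closedBall (0:ℂ) (|R| + 1)) fun z hz => mz z ?_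
    simpa using hz
  refine ⟨m, ms, hc, ?_⟩
  set h := fun z => f z - m z with hh
  have hhd : Differentiable ℝ h := hf.d.sub (hc.differentiable (by norm_num))
  have hz : ∀ z, |R| + 1 < ‖z‖ → h z = 0 := by
    intro z hz'
    rw [hh]; simp only
    rw [mz z hz', hR z (by have := le_abs_self R; linarith), sub_zero]
  have hdz : ∀ z, |R| + 1 < ‖z‖ → fderiv ℝ h z = 0 := by
    intro z hz'
    have : h =ᶠ[nhds z] fun _ => 0 := by
      have : {w : ℂ | |R| + 1 < ‖w‖} ∈ nhds z := (isOpen_lt continuous_const continuous_norm).mem_nhds hz'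
      filter_upwards [this] with w hw using hz w hw
    rw [this.fderiv_eq]; simp
  have dh : ∀ z, fderiv ℝ h z = fderiv ℝ f z - ∫ t, φ.normed volume t • fderiv ℝ f (z - t) := by
    intro z
    rw [← hfd z]
    exact fderiv_fun_sub hf.d.differentiableAt (hc.differentiable (by norm_num)).differentiableAt
  have sM : ∀ z : ℂ, ‖z‖ ≤ |R| + 1 → sC z ≤ M ∧ sC z ^ 2 ≤ M := by
    intro z hz'
    have h1 : sC z ≤ 1 + (|R| + 1) ^ 2 := by unfold sC; gcongr
    have h0 := sC_one_le z
    have h2 : sC z ^ 2 ≤ M := by rw [hM]; gcongr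
    exact ⟨by nlinarith, h2⟩
  have g0 := int_of_lint h hhd.continuous.stronglyMeasurable η hη0.le (by
    refine le_trans (le_of_eq ?_) k0
    congr 1; ext z
    have : h z = f z - m z := rfl
    rw [this, ← enorm_neg, neg_sub])
  have g1 := int_of_lint (fderiv ℝ h) (fderiv_meas h).stronglyMeasurable η hη0.le (by
    refine le_trans (le_of_eq ?_) k1
    congr 1; ext z; rw [dh, ← enorm_neg, neg_sub])
  have q0 : ∫ z, sC z * h z ^ 2 ≤ M * η := by
    have : ∫ z, sC z * h z ^ 2 ≤ ∫ z, M * ‖h z‖ ^ 2 := by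
      refine integral_mono_of_nonneg (Filter.Eventually.of_forall fun z => ?_) (g0.1.const_mul M) (Filter.Eventually.of_forall fun z => ?_)
      · have := sC_pos z; simp only [Pi.zero_apply]; positivity
      · simp only [Real.norm_eq_abs, sq_abs]
        rcases le_or_gt ‖z‖ (|R| + 1) with h' | h'
        · have := (sM z h').1; gcongr
        · rw [hz z h']; simp
    rw [integral_const_mul] at this
    have h2 := g0.2
    exact this.trans (by gcongr)
  have q1 : ∫ z, sC z ^ 2 * ‖fderiv ℝ h z‖ ^ 2 ≤ M * η := by
    have : ∫ z, sC z ^ 2 * ‖fderiv ℝ h z‖ ^ 2 ≤ ∫ z, M * ‖fderiv ℝ h z‖ ^ 2 := by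
      refine integral_mono_of_nonneg (Filter.Eventually.of_forall fun z => ?_) (g1.1.const_mul M) (Filter.Eventually.of_forall fun z => ?_)
      · have := sC_pos z; simp only [Pi.zero_apply]; positivity
      · simp only
        rcases le_or_gt ‖z‖ (|R| + 1) with h' | h'
        · have := (sM z h').2; gcongr
        · rw [hdz z h']; simp
    rw [integral_const_mul] at this
    have h2 := g1.2
    exact this.trans (by gcongr)
  have : M * η = ε / 2 := by rw [hη]; field_simp
  unfold NN
  linarith

def bC : ContDiffBump (0:ℂ) := ⟨1, 2, by norm_num, by norm_num⟩
def cut (n : ℕ) (z : ℂ) : ℝ := bC (((n:ℝ) + 1)⁻¹ • z)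

lemma cut_contDiff (n : ℕ) : ContDiff ℝ 1 (cut n) := by
  have h : ContDiff ℝ 1 (bC : ℂ → ℝ) := bC.contDiff
  exact h.comp (by fun_prop : ContDiff ℝ 1 (fun z : ℂ => ((n:ℝ) + 1)⁻¹ • z))

lemma cut_nn (n : ℕ) (z : ℂ) : 0 ≤ cut n z := bC.nonneg
lemma cut_le (n : ℕ) (z : ℂ) : cut n z ≤ 1 := bC.le_one
lemma cut_zero (n : ℕ) (z : ℂ) (h : 2 * ((n:ℝ) + 1) ≤ ‖z‖) : cut n z = 0 := by
  apply bC.zero_of_le_dist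
  have hp : (0:ℝ) < n + 1 := by positivity
  rw [dist_zero_right, norm_smul, norm_inv, Real.norm_of_nonneg hp.le, ← div_eq_inv_mul, le_div_iff₀ hp]
  exact h
lemma cut_one (n : ℕ) (z : ℂ) (h : ‖z‖ ≤ (n:ℝ) + 1) : cut n z = 1 := by
  apply bC.one_of_mem_closedBall
  have hp : (0:ℝ) < n + 1 := by positivity
  rw [mem_closedBall_zero_iff, norm_smul, norm_inv, Real.norm_of_nonneg hp.le, ← div_eq_inv_mul, div_le_iff₀ hp]
  simpa [bC] using h

lemma cut_supp (n : ℕ) : HasCompactSupport (cut n) := by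
  refine HasCompactSupport.intro (isCompact_closedBall (0:ℂ) (2 * ((n:ℝ) + 1))) fun z hz => cut_zero n z ?_
  simp only [mem_closedBall_zero_iff, not_le] at hz; exact hz.le

lemma cut_fd_bound : ∃ M : ℝ, 0 < M ∧ ∀ n z, sC z * ‖fderiv ℝ (cut n) z‖ ^ 2 ≤ M := by
  have hb : ContDiff ℝ 1 (bC : ℂ → ℝ) := bC.contDiff
  have cb : Continuous (fderiv ℝ (bC : ℂ → ℝ)) := hb.continuous_fderiv (by norm_num)
  obtain ⟨M, hM⟩ := (bC.hasCompactSupport.fderiv ℝ).exists_bound_of_continuous cb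
  have hM0 : 0 ≤ M := (norm_nonneg _).trans (hM 0)
  refine ⟨5 * M ^ 2 + 1, by positivity, fun n z => ?_⟩
  have hp : (0:ℝ) < n + 1 := by positivity
  rcases le_or_gt ‖z‖ (2 * ((n:ℝ) + 1)) with h | h
  · have h1 : HasFDerivAt (bC : ℂ → ℝ) (fderiv ℝ bC (((n:ℝ) + 1)⁻¹ • z)) (((n:ℝ) + 1)⁻¹ • z) :=
      (hb.differentiable (by norm_num) _).hasFDerivAt
    have h2 : HasFDerivAt (fun z : ℂ => ((n:ℝ) + 1)⁻¹ • z) (((n:ℝ) + 1)⁻¹ • (ContinuousLinearMap.id ℝ ℂ)) z := (hasFDerivAt_id (𝕜 := ℝ) z).fun_const_smul (((n:ℝ) + 1)⁻¹)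
    have h3 : HasFDerivAt (cut n) ((fderiv ℝ bC (((n:ℝ) + 1)⁻¹ • z)).comp (((n:ℝ) + 1)⁻¹ • (ContinuousLinearMap.id ℝ ℂ))) z := h1.comp z h2
    rw [h3.fderiv, ContinuousLinearMap.comp_smul, ContinuousLinearMap.comp_id, norm_smul, norm_inv, Real.norm_of_nonneg hp.le]
    have h4 : sC z ≤ 5 * ((n:ℝ) + 1) ^ 2 := by
      unfold sC
      have : ‖z‖ ^ 2 ≤ (2 * ((n:ℝ) + 1)) ^ 2 := by gcongr
      have : (0:ℝ) ≤ n := by positivity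
      nlinarith
    have := hM (((n:ℝ) + 1)⁻¹ • z)
    have := sC_pos z
    calc _ ≤ 5 * ((n:ℝ) + 1) ^ 2 * (((n:ℝ) + 1)⁻¹ * M) ^ 2 := by gcongr
      _ = 5 * M ^ 2 := by field_simp
      _ ≤ _ := by linarith
  · have : cut n =ᶠ[nhds z] fun _ => 0 := by
      have : {w : ℂ | 2 * ((n:ℝ) + 1) < ‖w‖} ∈ nhds z := (isOpen_lt continuous_const continuous_norm).mem_nhds h
      filter_upwards [this] with w hw using cut_zero n w (le_of_lt hw)
    rw [this.fderiv_eq]; simp; positivity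

lemma cut_dens (f : ℂ → ℝ) (hf : WW f) (ε : ℝ) (hε : 0 < ε) :
    ∃ φ : ℂ → ℝ, HasCompactSupport φ ∧ WW φ ∧ WW (fun z => f z - φ z) ∧ NN (fun z => f z - φ z) ≤ ε := by
  obtain ⟨M, hM, hb⟩ := cut_fd_bound
  set g : ℕ → ℂ → ℝ := fun n z => f z - cut n z * f z with hg
  have fc := hf.d.continuous
  have sc := sC_cont
  have cd : ∀ n, Differentiable ℝ (cut n) := fun n => (cut_contDiff n).differentiable (by norm_num)
  have gd : ∀ n, Differentiable ℝ (g n) := fun n => hf.d.sub ((cd n).mul hf.d)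
  have gc : ∀ n, Continuous (g n) := fun n => (gd n).continuous
  have l0 : ∀ n z, sC z * g n z ^ 2 ≤ sC z * f z ^ 2 := by
    intro n z
    have := sC_pos z
    have h : g n z ^ 2 ≤ f z ^ 2 := by
      have e : g n z = (1 - cut n z) * f z := by simp only [hg]; ring
      rw [e, mul_pow]
      have : (1 - cut n z) ^ 2 ≤ 1 := by have := cut_nn n z; have := cut_le n z; nlinarith
      nlinarith [sq_nonneg (f z)]
    gcongr
  have fg : ∀ n z, ‖fderiv ℝ (g n) z‖ ≤ ‖fderiv ℝ f z‖ + |f z| * ‖fderiv ℝ (cut n) z‖ := by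
    intro n z
    have h1 : HasFDerivAt (g n) (fderiv ℝ f z - (cut n z • fderiv ℝ f z + f z • fderiv ℝ (cut n) z)) z :=
      (hf.d z).hasFDerivAt.fun_sub ((cd n z).hasFDerivAt.fun_mul (hf.d z).hasFDerivAt)
    rw [h1.fderiv]
    have e : fderiv ℝ f z - (cut n z • fderiv ℝ f z + f z • fderiv ℝ (cut n) z) = (1 - cut n z) • fderiv ℝ f z - f z • fderiv ℝ (cut n) z := by
      rw [sub_smul, one_smul]; abel
    rw [e]
    refine (norm_sub_le _ _).trans ?_
    rw [norm_smul, norm_smul, Real.norm_eq_abs, Real.norm_eq_abs]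
    have : |1 - cut n z| ≤ 1 := by have := cut_nn n z; have := cut_le n z; rw [abs_le]; constructor <;> linarith
    nlinarith [norm_nonneg (fderiv ℝ f z)]
  have l1 : ∀ n z, sC z ^ 2 * ‖fderiv ℝ (g n) z‖ ^ 2 ≤ 2 * (sC z ^ 2 * ‖fderiv ℝ f z‖ ^ 2) + (2 * M) * (sC z * f z ^ 2) := by
    intro n z
    have hs := sC_pos z
    have h := sq_add_le _ _ _ (fg n z) (norm_nonneg _)
    have h2 := hb n z
    calc _ ≤ sC z ^ 2 * (2 * ‖fderiv ℝ f z‖ ^ 2 + 2 * (|f z| * ‖fderiv ℝ (cut n) z‖) ^ 2) := by gcongr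
      _ = 2 * (sC z ^ 2 * ‖fderiv ℝ f z‖ ^ 2) + 2 * (sC z * ‖fderiv ℝ (cut n) z‖ ^ 2) * (sC z * f z ^ 2) := by
        rw [mul_pow, sq_abs]; ring
      _ ≤ _ := by gcongr
  have m1 : ∀ n, AEStronglyMeasurable (fun z => sC z ^ 2 * ‖fderiv ℝ (g n) z‖ ^ 2) volume := fun n =>
    ((sc.measurable.pow_const 2).mul ((fderiv_meas (g n)).norm.pow_const 2)).aestronglyMeasurable
  have m0 : ∀ n, AEStronglyMeasurable (fun z => sC z * (g n z) ^ 2) volume := fun n =>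
    (sc.mul ((gc n).pow 2)).aestronglyMeasurable
  have i1 : Integrable (fun z => 2 * (sC z ^ 2 * ‖fderiv ℝ f z‖ ^ 2) + (2 * M) * (sC z * f z ^ 2)) :=
    (hf.i1.const_mul 2).fun_add (hf.i0.const_mul (2 * M))
  have n0 : ∀ n, ∀ᵐ z : ℂ, ‖sC z * g n z ^ 2‖ ≤ sC z * f z ^ 2 := fun n => Filter.Eventually.of_forall fun z => by
    have := sC_pos z
    rw [Real.norm_of_nonneg (by positivity)]; exact l0 n z
  have n1 : ∀ n, ∀ᵐ z : ℂ, ‖sC z ^ 2 * ‖fderiv ℝ (g n) z‖ ^ 2‖ ≤ 2 * (sC z ^ 2 * ‖fderiv ℝ f z‖ ^ 2) + (2 * M) * (sC z * f z ^ 2) := fun n => Filter.Eventually.of_forall fun z => by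
    have := sC_pos z
    rw [Real.norm_of_nonneg (by positivity)]; exact l1 n z
  have wg : ∀ n, WW (g n) := fun n => ⟨gd n, hf.i0.mono' (m0 n) (n0 n), i1.mono' (m1 n) (n1 n)⟩
  have ev : ∀ z : ℂ, ∀ᶠ n : ℕ in Filter.atTop, g n =ᶠ[nhds z] fun _ => 0 := by
    intro z
    filter_upwards [Filter.eventually_gt_atTop ⌈‖z‖⌉₊] with n hn
    have h1 : ‖z‖ < (n:ℝ) + 1 := by
      have := Nat.le_ceil ‖z‖
      have : ((⌈‖z‖⌉₊ : ℕ) : ℝ) < n := by exact_mod_cast hn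
      linarith
    have : {w : ℂ | ‖w‖ < (n:ℝ) + 1} ∈ nhds z := (isOpen_lt continuous_norm continuous_const).mem_nhds h1
    filter_upwards [this] with w hw
    simp only [hg]
    rw [cut_one n w (le_of_lt hw)]; ring
  have t0 := tendsto_integral_of_dominated_convergence (f := fun _ : ℂ => (0:ℝ)) _ m0 hf.i0 n0 (Filter.Eventually.of_forall fun z => by
    refine tendsto_const_nhds.congr' ?_
    filter_upwards [ev z] with n hn
    rw [hn.eq_of_nhds]; simp)
  have t1 := tendsto_integral_of_dominated_convergence (f := fun _ : ℂ => (0:ℝ)) _ m1 i1 n1 (Filter.Eventually.of_forall fun z => by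
    refine tendsto_const_nhds.congr' ?_
    filter_upwards [ev z] with n hn
    rw [hn.fderiv_eq]; simp)
  have t := t1.add t0
  simp only [integral_zero, add_zero] at t
  obtain ⟨n, hn⟩ := (t.eventually (gt_mem_nhds hε)).exists
  have e1 : (fun z => f z - g n z) = fun z => cut n z * f z := by ext z; simp only [hg]; ring
  have := (WW_sub f (g n) hf (wg n)).1
  rw [e1] at this
  exact ⟨fun z => cut n z * f z, (cut_supp n).mul_right, this, wg n, hn.le⟩

lemma dens (f : ℂ → ℝ) (hf : WW f) (ε : ℝ) (hε : 0 < ε) :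
    ∃ φ : ℂ → ℝ, HasCompactSupport φ ∧ ContDiff ℝ 1 φ ∧ NN (fun z => f z - φ z) ≤ ε := by
  obtain ⟨ψ, hs, hw, hw2, hn⟩ := cut_dens f hf (ε / 4) (by positivity)
  obtain ⟨φ, h1, h2, h3⟩ := dens_c ψ hs hw (ε / 4) (by positivity)
  refine ⟨φ, h1, h2, ?_⟩
  have := (WW_add _ _ hw2 (WW_sub ψ φ hw (WW_cc φ h1 h2)).1).2
  have e : (fun z => f z - ψ z + (ψ z - φ z)) = fun z => f z - φ z := by ext z; ring
  rw [e] at this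
  linarith

def dT (θ : ℝ) (f : ℂ → ℝ) (z : ℂ) : ℂ →L[ℝ] ℝ := fderiv ℝ (gG f) z + (θ/2) • LA (AA f z)

lemma LA_add (a b : ℂ) : LA (a + b) = LA a + LA b := by
  ext v; simp [LA_apply]; ring
lemma LA_cont : Continuous LA := by
  apply AddMonoidHomClass.continuous_of_bound (⟨⟨LA, by ext v; simp [LA_apply]⟩, LA_add⟩ : ℂ →+ (ℂ →L[ℝ] ℝ)) 1
  intro x; simpa using LA_norm x

lemma NN_nonneg (f : ℂ → ℝ) : 0 ≤ NN f := by
  unfold NN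
  have h1 : 0 ≤ ∫ z, sC z ^ 2 * ‖fderiv ℝ f z‖ ^ 2 := integral_nonneg fun z => by have := sC_pos z; positivity
  have h2 : 0 ≤ ∫ z, sC z * f z ^ 2 := integral_nonneg fun z => by have := sC_pos z; positivity
  linarith

lemma AA_facts : ∃ C : ℝ, 0 < C ∧ ∀ f, WW f → (∀ᵐ x : ℂ, Integrable (fun y => fC f y / (x - y))) ∧
    AEStronglyMeasurable (AA f) volume ∧ Integrable (fun z => (sC z)⁻¹ * ‖AA f z‖ ^ 2) ∧
    ∫ z, (sC z)⁻¹ * ‖AA f z‖ ^ 2 ≤ C * ∫ z, sC z * f z ^ 2 := by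
  obtain ⟨C0, hC0, KL⟩ := KL
  have hpi := Real.pi_pos
  refine ⟨Real.pi⁻¹ ^ 2 * C0, by positivity, fun f hf => ?_⟩
  have fm : Measurable (fC f) := by
    have := hf.d.continuous.measurable
    unfold fC; fun_prop
  have en : ∀ y, ‖fC f y‖ ^ 2 = f y ^ 2 := fun y => by simp [fC]
  obtain ⟨k1, k2, k3⟩ := KL (fC f) fm (by simpa only [en] using hf.i0)
  simp only [en] at k3
  have e : ∀ z, (sC z)⁻¹ * ‖AA f z‖ ^ 2 = Real.pi⁻¹ ^ 2 * ((sC z)⁻¹ * ‖CT (fC f) z‖ ^ 2) := fun z => by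
    unfold AA
    rw [norm_mul, Complex.norm_real, Real.norm_of_nonneg (by positivity)]; ring
  refine ⟨k1, ?_, ?_, ?_⟩
  · exact (CT_meas (fC f) fm).const_mul _
  · simp only [e]; exact k2.const_mul _
  · simp only [e]; rw [integral_const_mul, mul_assoc]; gcongr

lemma AA_sub (f g : ℂ → ℝ) (hf : WW f) (hg : WW g) : ∀ᵐ z : ℂ, AA (fun z => f z + g z) z = AA f z + AA g z := by
  obtain ⟨C, _, H⟩ := AA_facts
  filter_upwards [(H f hf).1, (H g hg).1] with z h1 h2
  unfold AA CT
  rw [← mul_add, ← integral_add h1 h2]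
  congr 2; ext y; simp [fC]; ring

lemma dT_bound : ∃ C : ℝ, 0 < C ∧ ∀ θ : ℝ, |θ| ≤ 1 → ∀ f, WW f →
    Integrable (fun z => ((sC z) ^ 2)⁻¹ * ‖dT θ f z‖ ^ 2) ∧ ∫ z, ((sC z) ^ 2)⁻¹ * ‖dT θ f z‖ ^ 2 ≤ C * NN f := by
  obtain ⟨C, hC, H⟩ := AA_facts
  refine ⟨1 + C, by positivity, fun θ hθ f hf => ?_⟩
  obtain ⟨-, am, ai, ab⟩ := H f hf
  have pt : ∀ z, ((sC z) ^ 2)⁻¹ * ‖dT θ f z‖ ^ 2 ≤ (sC z ^ 2 * ‖fderiv ℝ f z‖ ^ 2 + sC z * f z ^ 2) + (sC z)⁻¹ * ‖AA f z‖ ^ 2 := by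
    intro z
    have hs := sC_pos z
    have hs1 := sC_one_le z
    have h1 : ‖dT θ f z‖ ≤ sC z ^ 2 / 8 * ‖fderiv ℝ f z‖ + (|f z| * sC z / 2 * ‖z‖ + 1 / 2 * ‖AA f z‖) := by
      unfold dT
      rw [(gG_hasFDerivAt f z (hf.d z)).fderiv]
      refine (norm_add_le _ _).trans ?_
      have a1 : ‖(sC z ^ 2 / 8) • fderiv ℝ f z + (f z * sC z / 2) • innerSL ℝ z‖ ≤ sC z ^ 2 / 8 * ‖fderiv ℝ f z‖ + |f z| * sC z / 2 * ‖z‖ := by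
        refine (norm_add_le _ _).trans ?_
        rw [norm_smul, norm_smul, innerSL_apply_norm, Real.norm_of_nonneg (by positivity), Real.norm_eq_abs, abs_div, abs_mul, abs_of_pos hs]
        simp
      have a2 : ‖(θ/2) • LA (AA f z)‖ ≤ 1 / 2 * ‖AA f z‖ := by
        rw [norm_smul, Real.norm_eq_abs, abs_div]
        have := LA_norm (AA f z)
        have : |θ| / |2| ≤ 1 / 2 := by rw [abs_of_pos (by norm_num : (0:ℝ) < 2)]; linarith
        gcongr
      linarith
    have h2 := sq_add_le _ _ _ h1 (norm_nonneg _)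
    have h3 := sq_add_le _ _ _ (le_refl (|f z| * sC z / 2 * ‖z‖ + 1 / 2 * ‖AA f z‖)) (by positivity)
    have hz : ‖z‖ ^ 2 ≤ sC z := by unfold sC; linarith
    have h4 : (|f z| * sC z / 2 * ‖z‖) ^ 2 ≤ f z ^ 2 * sC z ^ 3 / 4 := by
      calc _ = f z ^ 2 * sC z ^ 2 / 4 * ‖z‖ ^ 2 := by rw [mul_pow, div_pow, mul_pow, sq_abs]; ring
        _ ≤ f z ^ 2 * sC z ^ 2 / 4 * sC z := by gcongr
        _ = _ := by ring
    have h5 : ‖dT θ f z‖ ^ 2 ≤ sC z ^ 4 * ‖fderiv ℝ f z‖ ^ 2 / 32 + f z ^ 2 * sC z ^ 3 + ‖AA f z‖ ^ 2 := by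
      nlinarith
    have h6 : ((sC z) ^ 2)⁻¹ ≤ (sC z)⁻¹ := by simpa using sC_inv_le (show 1 ≤ 2 by norm_num) z
    calc _ ≤ ((sC z) ^ 2)⁻¹ * (sC z ^ 4 * ‖fderiv ℝ f z‖ ^ 2 / 32 + f z ^ 2 * sC z ^ 3 + ‖AA f z‖ ^ 2) := by gcongr
      _ = (sC z ^ 2 * ‖fderiv ℝ f z‖ ^ 2 / 32 + sC z * f z ^ 2) + ((sC z) ^ 2)⁻¹ * ‖AA f z‖ ^ 2 := by field_simp
      _ ≤ _ := by
        have : 0 ≤ sC z ^ 2 * ‖fderiv ℝ f z‖ ^ 2 := by positivity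
        gcongr
        linarith
  have i : Integrable (fun z => (sC z ^ 2 * ‖fderiv ℝ f z‖ ^ 2 + sC z * f z ^ 2) + (sC z)⁻¹ * ‖AA f z‖ ^ 2) := (hf.i1.fun_add hf.i0).fun_add ai
  have j : Integrable (fun z => ((sC z) ^ 2)⁻¹ * ‖dT θ f z‖ ^ 2) := by
    refine i.mono' ?_ (Filter.Eventually.of_forall fun z => ?_)
    · have c2 := (sC_inv_cont 2).aestronglyMeasurable (μ := (volume : Measure ℂ))
      have d1 : AEStronglyMeasurable (fderiv ℝ (gG f)) (volume : Measure ℂ) := (fderiv_meas (gG f)).stronglyMeasurable.aestronglyMeasurable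
      have d2 : AEStronglyMeasurable (fun z => LA (AA f z)) (volume : Measure ℂ) := LA_cont.comp_aestronglyMeasurable am
      exact c2.mul ((d1.add (d2.const_smul (θ/2))).norm.pow 2)
    have := sC_pos z
    rw [Real.norm_of_nonneg (by positivity)]; exact pt z
  refine ⟨j, (integral_mono j i pt).trans ?_⟩
  rw [integral_add (hf.i1.fun_add hf.i0) ai, integral_add hf.i1 hf.i0]
  have h1 : 0 ≤ ∫ z, sC z ^ 2 * ‖fderiv ℝ f z‖ ^ 2 := integral_nonneg fun z => by have := sC_pos z; positivity
  unfold NN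
  nlinarith

lemma gG_add (f g : ℂ → ℝ) (z : ℂ) : gG (fun z => f z + g z) z = gG f z + gG g z := by unfold gG; ring

lemma dT_add (θ : ℝ) (f g : ℂ → ℝ) (hf : WW f) (hg : WW g) : ∀ᵐ z : ℂ, dT θ (fun z => f z + g z) z = dT θ f z + dT θ g z := by
  filter_upwards [AA_sub f g hf hg] with z hz
  unfold dT
  rw [hz, LA_add]
  have : gG (fun z => f z + g z) = fun z => gG f z + gG g z := by ext z; exact gG_add f g z
  rw [this, fderiv_fun_add (gG_hasFDerivAt f z (hf.d z)).differentiableAt (gG_hasFDerivAt g z (hg.d z)).differentiableAt, smul_add]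
  abel

lemma mo_int (f X : ℂ → ℝ) (hf : WW f) (hX : Continuous X) (hb : ∀ z, |X z| ≤ 1) :
    Integrable (fun z => ((sC z) ^ 4)⁻¹ * gG f z * X z) ∧ mo f X ^ 2 ≤ Real.pi * NN f := by
  have fc := hf.d.continuous
  have sc := sC_cont
  have c2 := sC_inv_cont 2
  have e : ∀ z, ((sC z) ^ 4)⁻¹ * gG f z * X z = f z * (((sC z) ^ 2)⁻¹ * X z / 8) := fun z => by
    have := sC_ne z; unfold gG; field_simp
  have lf : ∀ z, f z ^ 2 ≤ sC z * f z ^ 2 := fun z => by nlinarith [sC_one_le z, sq_nonneg (f z)]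
  have iff : Integrable (fun z => f z ^ 2) := by
    refine hf.i0.mono' (Continuous.aestronglyMeasurable (by fun_prop)) (Filter.Eventually.of_forall fun z => ?_)
    rw [Real.norm_of_nonneg (by positivity)]; exact lf z
  have i2 := integrable_sC_pow (k := 2) le_rfl
  have lX : ∀ z, (((sC z) ^ 2)⁻¹ * X z / 8) ^ 2 ≤ ((sC z) ^ 2)⁻¹ := fun z => by
    have hs := sC_pos z
    have h1 : X z ^ 2 ≤ 1 := by rw [sq_le_one_iff_abs_le_one]; exact hb z
    have h2 : ((sC z) ^ 2)⁻¹ ≤ 1 := inv_le_one_of_one_le₀ (one_le_pow₀ (sC_one_le z))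
    have h0 : 0 < ((sC z) ^ 2)⁻¹ := by positivity
    calc _ = ((sC z) ^ 2)⁻¹ * (((sC z) ^ 2)⁻¹ * X z ^ 2 / 64) := by ring
      _ ≤ ((sC z) ^ 2)⁻¹ * (1 * 1 / 64) := by gcongr
      _ ≤ _ := by linarith
  have iX : Integrable (fun z => (((sC z) ^ 2)⁻¹ * X z / 8) ^ 2) := by
    refine i2.mono' (Continuous.aestronglyMeasurable (by fun_prop)) (Filter.Eventually.of_forall fun z => ?_)
    rw [Real.norm_of_nonneg (by positivity)]; exact lX z
  have ip : Integrable (fun z => f z * (((sC z) ^ 2)⁻¹ * X z / 8)) := by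
    refine (iff.fun_add iX).mono' (Continuous.aestronglyMeasurable (by fun_prop)) (Filter.Eventually.of_forall fun z => ?_)
    rw [Real.norm_eq_abs, abs_mul, ← sq_abs (f z), ← sq_abs (((sC z) ^ 2)⁻¹ * X z / 8)]
    nlinarith [sq_nonneg (|f z| - |((sC z) ^ 2)⁻¹ * X z / 8|), abs_nonneg (f z), abs_nonneg (((sC z) ^ 2)⁻¹ * X z / 8)]
  refine ⟨by simpa only [e] using ip, ?_⟩
  unfold mo
  simp only [e]
  refine (cs_real volume _ _ iff iX ip).trans ?_
  have k1 : ∫ z, f z ^ 2 ≤ NN f := by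
    have h1 : 0 ≤ ∫ z, sC z ^ 2 * ‖fderiv ℝ f z‖ ^ 2 := integral_nonneg fun z => by have := sC_pos z; positivity
    have := integral_mono iff hf.i0 lf
    unfold NN; linarith
  have k2 : ∫ z, (((sC z) ^ 2)⁻¹ * X z / 8) ^ 2 ≤ Real.pi := by
    have := integral_mono iX i2 lX
    have h := int_sC_pow 1 le_rfl
    rw [show (1+1) = 2 by rfl] at h
    rw [h] at this
    simpa using this
  have k3 : 0 ≤ ∫ z, (((sC z) ^ 2)⁻¹ * X z / 8) ^ 2 := integral_nonneg fun z => by positivity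
  have k4 := NN_nonneg f
  have hpi := Real.pi_pos
  calc _ ≤ NN f * Real.pi := by gcongr
    _ = _ := by ring

lemma mm_bound (f : ℂ → ℝ) (hf : WW f) : mm f ≤ 3 * Real.pi * NN f := by
  have h1 := (mo_int f X1 hf X1_cont X1_le).2
  have h2 := (mo_int f X2 hf X2_cont X2_le).2
  have h3 := (mo_int f X3 hf X3_cont X3_le).2
  unfold mm; linarith

lemma mo_add (f g X : ℂ → ℝ) (hf : WW f) (hg : WW g) (hX : Continuous X) (hb : ∀ z, |X z| ≤ 1) :
    mo (fun z => f z + g z) X = mo f X + mo g X := by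
  unfold mo
  rw [← integral_add (mo_int f X hf hX hb).1 (mo_int g X hg hX hb).1]
  congr 1; ext z; rw [gG_add]; ring

lemma mm_add (f g : ℂ → ℝ) (hf : WW f) (hg : WW g) : mm (fun z => f z + g z) ≤ 2 * mm f + 2 * mm g := by
  unfold mm
  rw [mo_add f g X1 hf hg X1_cont X1_le, mo_add f g X2 hf hg X2_cont X2_le, mo_add f g X3 hf hg X3_cont X3_le]
  nlinarith [sq_nonneg (mo f X1 - mo g X1), sq_nonneg (mo f X2 - mo g X2), sq_nonneg (mo f X3 - mo g X3)]

lemma extend (θ : ℝ) (hθ : |θ| ≤ 1) (C : ℝ) (hC : 0 < C) (H : ∀ f : ℂ → ℝ, HasCompactSupport f → ContDiff ℝ 1 f →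
    NN f ≤ C * ((∫ z, ((sC z) ^ 2)⁻¹ * ‖dT θ f z‖ ^ 2) + mm f)) (f : ℂ → ℝ) (hf : WW f) :
    NN f ≤ 4 * C * ((∫ z, ((sC z) ^ 2)⁻¹ * ‖dT θ f z‖ ^ 2) + mm f) := by
  obtain ⟨C1, hC1, B⟩ := dT_bound
  have hpi := Real.pi_pos
  apply le_of_forall_pos_le_add
  intro ε hε
  set K := 2 + 4 * C * (C1 + 3 * Real.pi) with hK
  have hK0 : 0 < K := by positivity
  obtain ⟨φ, h1, h2, h3⟩ := dens f hf (ε / K) (by positivity)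
  have wφ := WW_cc φ h1 h2
  set h := fun z => f z - φ z with hh
  have wh : WW h := (WW_sub f φ hf wφ).1
  have wn := WW_neg h wh
  have e1 : (fun z => f z + -h z) = φ := by ext z; simp [hh]
  have e2 : (fun z => φ z + h z) = f := by ext z; simp [hh]
  have q1 := (WW_add φ h wφ wh).2
  rw [e2] at q1
  have q2 := mm_add f (fun z => - h z) hf wn.1
  rw [e1] at q2
  have q3 := mm_bound (fun z => - h z) wn.1
  rw [wn.2] at q3
  obtain ⟨bf, -⟩ := B θ hθ f hf
  obtain ⟨bφ, -⟩ := B θ hθ φ wφ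
  obtain ⟨bh, bh2⟩ := B θ hθ (fun z => - h z) wn.1
  rw [wn.2] at bh2
  have q4 : ∫ z, ((sC z) ^ 2)⁻¹ * ‖dT θ φ z‖ ^ 2 ≤ 2 * (∫ z, ((sC z) ^ 2)⁻¹ * ‖dT θ f z‖ ^ 2) + 2 * (C1 * NN h) := by
    have : ∫ z, ((sC z) ^ 2)⁻¹ * ‖dT θ φ z‖ ^ 2 ≤ ∫ z, (2 * (((sC z) ^ 2)⁻¹ * ‖dT θ f z‖ ^ 2) + 2 * (((sC z) ^ 2)⁻¹ * ‖dT θ (fun z => - h z) z‖ ^ 2)) := by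
      refine integral_mono_ae bφ ((bf.const_mul 2).fun_add (bh.const_mul 2)) ?_
      have := dT_add θ f (fun z => - h z) hf wn.1
      rw [e1] at this
      filter_upwards [this] with z hz
      have hs := sC_pos z
      rw [hz]
      have h := sq_add_le _ _ _ (norm_add_le (dT θ f z) (dT θ (fun z => - h z) z)) (norm_nonneg _)
      refine (mul_le_mul_of_nonneg_left h (by positivity : 0 ≤ ((sC z) ^ 2)⁻¹)).trans (le_of_eq (by ring))
    rw [integral_add (bf.const_mul 2) (bh.const_mul 2), integral_const_mul, integral_const_mul] at this
    linarith
  have q5 := H φ h1 h2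
  have q6 : K * NN h ≤ ε := by
    rw [le_div_iff₀ hK0] at h3; linarith
  have q7 := mul_le_mul_of_nonneg_left (add_le_add q4 (q2.trans (add_le_add_right (mul_le_mul_of_nonneg_left q3 (by norm_num : (0:ℝ) ≤ 2)) _))) hC.le
  rw [hK] at q6
  nlinarith

lemma main_C : ∃ C : ℝ, 0 < C ∧ ∀ f, WW f →
    NN f ≤ C * ((∫ z, ((sC z) ^ 2)⁻¹ * ‖dW f z‖ ^ 2) + mm f) ∧
    NN f ≤ C * ((∫ z, ((sC z) ^ 2)⁻¹ * ‖fderiv ℝ (gG f) z‖ ^ 2) + mm f) := by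
  obtain ⟨C, hC, H⟩ := core
  obtain ⟨C', hC', H'⟩ := core_junk
  have e1 : ∀ f z, dT 1 f z = dW f z := fun f z => rfl
  have e0 : ∀ f z, dT 0 f z = fderiv ℝ (gG f) z := fun f z => by simp [dT]
  refine ⟨4 * C + 4 * C', by positivity, fun f hf => ?_⟩
  have a := extend 1 (by simp) C hC (by simpa only [e1] using H) f hf
  have a' := extend 0 (by simp) C' hC' (by simpa only [e0] using H') f hf
  simp only [e1, e0] at a a'
  have m0 : 0 ≤ mm f := by unfold mm; positivity
  have d0 : 0 ≤ ∫ z, ((sC z) ^ 2)⁻¹ * ‖dW f z‖ ^ 2 := integral_nonneg fun z => by have := sC_pos z; positivity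
  have d1 : 0 ≤ ∫ z, ((sC z) ^ 2)⁻¹ * ‖fderiv ℝ (gG f) z‖ ^ 2 := integral_nonneg fun z => by have := sC_pos z; positivity
  refine ⟨a.trans ?_, a'.trans ?_⟩
  · gcongr; linarith
  · gcongr; linarith

def LP (f : ℂ → ℝ) (x : ℂ) : ℝ := ∫ y, Real.log ‖x - y‖ * f y
def lE (ε : ℝ) (t : ℂ) : ℝ := 1/2 * Real.log (‖t‖ ^ 2 + ε ^ 2)
def eK (ε : ℝ) (t : ℂ) : ℝ := ε ^ 2 * (‖t‖⁻¹ * (‖t‖ ^ 2 + ε ^ 2)⁻¹)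

lemma eK_int (ε : ℝ) (hε : 0 < ε) : Integrable (eK ε) ∧ ∫ t, eK ε t = ε * ∫ t : ℂ, ‖t‖⁻¹ * (sC t)⁻¹ := by
  have e : eK ε = fun t => ε⁻¹ * ((fun t : ℂ => ‖t‖⁻¹ * (sC t)⁻¹) (ε⁻¹ • t)) := by
    ext t
    unfold eK sC
    simp only [norm_smul, norm_inv, Real.norm_of_nonneg hε.le]
    rcases eq_or_ne ‖t‖ 0 with h | h
    · simp [h]
    have : ‖t‖ ^ 2 + ε ^ 2 ≠ 0 := by positivity
    have : 1 + (ε⁻¹ * ‖t‖) ^ 2 ≠ 0 := by positivity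
    field_simp
    ring
  have i : Integrable (fun t : ℂ => (fun t : ℂ => ‖t‖⁻¹ * (sC t)⁻¹) (ε⁻¹ • t)) := kern_zero.comp_smul (by positivity)
  rw [e]
  refine ⟨i.const_mul _, ?_⟩
  rw [integral_const_mul, Measure.integral_comp_smul volume (fun t : ℂ => ‖t‖⁻¹ * (sC t)⁻¹) ε⁻¹, Complex.finrank_real_complex, abs_of_nonneg (by positivity), smul_eq_mul]
  field_simp

lemma lE_bound (ε : ℝ) (hε : 0 < ε) (h1 : ε ≤ 1) (t : ℂ) (ht : t ≠ 0) : |lE ε t| ≤ |Real.log ‖t‖| + 1 := by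
  have hr : 0 < ‖t‖ := norm_pos_iff.2 ht
  have hl2 : Real.log 2 ≤ 1 := by have := Real.log_two_lt_d9; linarith
  have lo : Real.log ‖t‖ ≤ lE ε t := by
    unfold lE
    have : Real.log (‖t‖ ^ 2) ≤ Real.log (‖t‖ ^ 2 + ε ^ 2) := Real.log_le_log (by positivity) (by nlinarith)
    rw [Real.log_pow] at this
    push_cast at this
    linarith
  have hi : lE ε t ≤ |Real.log ‖t‖| + 1 := by
    unfold lE
    rcases le_total 1 ‖t‖ with h | h
    · have : Real.log (‖t‖ ^ 2 + ε ^ 2) ≤ Real.log (2 * ‖t‖ ^ 2) := Real.log_le_log (by positivity) (by nlinarith)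
      rw [Real.log_mul (by norm_num) (by positivity), Real.log_pow] at this
      push_cast at this
      have := le_abs_self (Real.log ‖t‖)
      linarith
    · have : Real.log (‖t‖ ^ 2 + ε ^ 2) ≤ Real.log 2 := Real.log_le_log (by positivity) (by nlinarith)
      have := abs_nonneg (Real.log ‖t‖)
      linarith
  rw [abs_le]
  exact ⟨by have := neg_abs_le (Real.log ‖t‖); linarith, hi⟩

lemma lE_hasFDerivAt (ε : ℝ) (hε : 0 < ε) (t : ℂ) : HasFDerivAt (lE ε) (LA (kE ε t)) t := by
  have hp : ‖t‖ ^ 2 + ε ^ 2 ≠ 0 := by positivity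
  have h := (((hasStrictFDerivAt_norm_sq t).hasFDerivAt.add_const (ε ^ 2)).log hp).const_mul (1/2 : ℝ)
  refine h.congr_fderiv ?_
  ext v
  simp only [LA_apply, kE, Complex.re_mul_ofReal, Complex.im_mul_ofReal, Complex.conj_re, Complex.conj_im]
  simp [Complex.inner]
  ring

lemma lE_cont (ε : ℝ) (hε : 0 < ε) : Continuous (lE ε) :=
  continuous_iff_continuousAt.2 fun t => (lE_hasFDerivAt ε hε t).continuousAt

lemma kE_cont' (ε : ℝ) (hε : 0 < ε) : Continuous (kE ε) :=
  continuous_iff_continuousAt.2 fun t => (kE_hasFDerivAt ε hε t).continuousAt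

lemma kE_le_inv (ε : ℝ) (hε : 0 < ε) (t : ℂ) : ‖kE ε t‖ ≤ ε⁻¹ := by
  unfold kE
  rw [norm_mul, RCLike.norm_conj, Complex.norm_real, Real.norm_of_nonneg (by positivity), ← div_eq_mul_inv, div_le_iff₀ (by positivity),
    inv_mul_eq_div, le_div_iff₀ hε]
  nlinarith [sq_nonneg (‖t‖ - ε), norm_nonneg t]

lemma kE_diff (ε : ℝ) (hε : 0 < ε) (t : ℂ) : ‖kE ε t - t⁻¹‖ = eK ε t := by
  rcases eq_or_ne t 0 with rfl | h
  · simp [kE, eK]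
  have hr : 0 < ‖t‖ := norm_pos_iff.2 h
  have e : kE ε t - t⁻¹ = -((starRingEnd ℂ) t * ((ε ^ 2 * (‖t‖ ^ 2)⁻¹ * (‖t‖ ^ 2 + ε ^ 2)⁻¹ : ℝ) : ℂ)) := by
    rw [Complex.inv_def, Complex.normSq_eq_norm_sq]
    unfold kE
    rw [← mul_sub, ← mul_neg, ← Complex.ofReal_sub, ← Complex.ofReal_neg]
    congr 2
    have : ‖t‖ ^ 2 + ε ^ 2 ≠ 0 := by positivity
    field_simp
    ring
  rw [e, norm_neg, norm_mul, RCLike.norm_conj, Complex.norm_real, Real.norm_of_nonneg (by positivity)]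
  unfold eK
  field_simp

lemma loc_bd (f : ℂ → ℝ) (hf : Continuous f) (x : ℂ) (R : ℝ) : ∃ M, 0 ≤ M ∧ ∀ y, ‖x - y‖ ≤ R → |f y| ≤ M := by
  obtain ⟨M, hM⟩ := (isCompact_closedBall x R).exists_bound_of_continuousOn hf.continuousOn
  refine ⟨|M|, abs_nonneg _, fun y hy => (hM y ?_).trans (le_abs_self M)⟩
  rw [mem_closedBall_iff_norm']; exact hy

lemma sC_le_two (t : ℂ) (h : ‖t‖ ≤ 1) : 1 ≤ 2 * (sC t)⁻¹ := by
  have := sC_pos t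
  rw [← div_eq_mul_inv, le_div_iff₀ this]
  unfold sC; nlinarith [norm_nonneg t]

lemma inv_int (f : ℂ → ℝ) (hf : Continuous f) (h1 : Integrable f) (x : ℂ) : Integrable (fun y => f y * ‖x - y‖⁻¹) := by
  obtain ⟨M, hM, hb⟩ := loc_bd f hf x 1
  have i : Integrable (fun y => (2 * M) * (‖x - y‖⁻¹ * (sC (x - y))⁻¹) + |f y|) := ((kern_zero.comp_sub_left x).const_mul _).fun_add h1.norm
  have fm := hf.measurable
  refine i.mono' (Measurable.aestronglyMeasurable (by fun_prop)) (Filter.Eventually.of_forall fun y => ?_)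
  rw [norm_mul, norm_inv, norm_norm, Real.norm_eq_abs]
  have h0 := abs_nonneg (f y)
  have hk : 0 ≤ ‖x - y‖⁻¹ := by positivity
  have hs : 0 < (sC (x - y))⁻¹ := inv_pos.2 (sC_pos _)
  rcases le_or_gt ‖x - y‖ 1 with h | h
  · have h2 := hb y h
    have h3 := sC_le_two _ h
    have : |f y| * ‖x - y‖⁻¹ ≤ M * ‖x - y‖⁻¹ * (2 * (sC (x - y))⁻¹) := by
      calc _ ≤ M * ‖x - y‖⁻¹ := by gcongr
        _ = M * ‖x - y‖⁻¹ * 1 := by ring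
        _ ≤ _ := by gcongr
    linarith
  · have : ‖x - y‖⁻¹ ≤ 1 := inv_le_one_of_one_le₀ h.le
    have : 0 ≤ (2 * M) * (‖x - y‖⁻¹ * (sC (x - y))⁻¹) := by positivity
    nlinarith

lemma log_L1 (f : ℂ → ℝ) (hf : Continuous f) (x : ℂ) (h : Integrable (fun y => Real.log ‖x - y‖ * f y)) : Integrable f := by
  obtain ⟨M, hM, hb⟩ := loc_bd f hf x 3
  have i2 := (integrable_sC_pow (k := 2) le_rfl).comp_sub_left x
  have i : Integrable (fun y => |Real.log ‖x - y‖ * f y| + (100 * M) * ((sC (x - y)) ^ 2)⁻¹) := h.norm.fun_add (i2.const_mul _)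
  refine i.mono' hf.aestronglyMeasurable (Filter.Eventually.of_forall fun y => ?_)
  rw [Real.norm_eq_abs]
  have hs := sC_pos (x - y)
  rcases le_or_gt ‖x - y‖ 3 with h' | h'
  · have h2 := hb y h'
    have h3 : 1 ≤ 100 * ((sC (x - y)) ^ 2)⁻¹ := by
      rw [← div_eq_mul_inv, le_div_iff₀ (by positivity)]
      have : sC (x - y) ≤ 10 := by unfold sC; nlinarith [norm_nonneg (x - y)]
      nlinarith
    have := abs_nonneg (Real.log ‖x - y‖ * f y)
    nlinarith
  · have : 1 ≤ Real.log ‖x - y‖ := by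
      rw [Real.le_log_iff_exp_le (by linarith)]
      have := Real.exp_one_lt_d9
      linarith
    rw [abs_mul]
    have h4 : 1 ≤ |Real.log ‖x - y‖| := this.trans (le_abs_self _)
    have : 0 ≤ (100 * M) * ((sC (x - y)) ^ 2)⁻¹ := by positivity
    nlinarith [abs_nonneg (f y)]

lemma log_all (f : ℂ → ℝ) (hf : Continuous f) (x0 : ℂ) (h : Integrable (fun y => Real.log ‖x0 - y‖ * f y)) (x : ℂ) :
    Integrable (fun y => Real.log ‖x - y‖ * f y) := by
  have h1 := log_L1 f hf x0 h
  have i : Integrable (fun y => |f y * ‖x - y‖⁻¹| + (|Real.log ‖x0 - y‖ * f y| + Real.log (1 + ‖x - x0‖) * |f y|)) :=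
    (inv_int f hf h1 x).norm.fun_add (h.norm.fun_add (h1.norm.const_mul _))
  have fm := hf.measurable
  refine i.mono' (Measurable.aestronglyMeasurable (by fun_prop)) (Filter.Eventually.of_forall fun y => ?_)
  rw [norm_mul, Real.norm_eq_abs, Real.norm_eq_abs]
  have hd : 0 ≤ Real.log (1 + ‖x - x0‖) := Real.log_nonneg (by have := norm_nonneg (x - x0); linarith)
  have h0 := abs_nonneg (f y)
  have p3 : 0 ≤ Real.log (1 + ‖x - x0‖) * |f y| := by positivity
  rcases le_or_gt ‖x - y‖ 1 with h' | h'
  · have : |Real.log ‖x - y‖| ≤ ‖x - y‖⁻¹ := by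
      rcases eq_or_ne ‖x - y‖ 0 with e | e
      · simp [e]
      have hp : 0 < ‖x - y‖ := lt_of_le_of_ne (norm_nonneg _) e.symm
      rw [abs_of_nonpos (Real.log_nonpos hp.le h'), ← Real.log_inv]
      exact (Real.log_le_sub_one_of_pos (by positivity)).trans (by linarith)
    have e2 : |f y * ‖x - y‖⁻¹| = ‖x - y‖⁻¹ * |f y| := by rw [abs_mul, abs_inv, abs_norm, mul_comm]
    have := abs_nonneg (Real.log ‖x0 - y‖ * f y)
    have : |Real.log ‖x - y‖| * |f y| ≤ ‖x - y‖⁻¹ * |f y| := by gcongr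
    rw [e2]; linarith
  · have : |Real.log ‖x - y‖| ≤ |Real.log ‖x0 - y‖| + Real.log (1 + ‖x - x0‖) := by
      rw [abs_of_nonneg (Real.log_nonneg h'.le)]
      have tri : ‖x - y‖ ≤ ‖x - x0‖ + ‖x0 - y‖ := norm_sub_le_norm_sub_add_norm_sub x x0 y
      have nd := norm_nonneg (x - x0)
      rcases le_or_gt ‖x0 - y‖ 1 with h3 | h3
      · have : Real.log ‖x - y‖ ≤ Real.log (1 + ‖x - x0‖) := Real.log_le_log (by linarith) (by linarith)
        have := abs_nonneg (Real.log ‖x0 - y‖)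
        linarith
      · have : Real.log ‖x - y‖ ≤ Real.log (‖x0 - y‖ * (1 + ‖x - x0‖)) := Real.log_le_log (by linarith) (by nlinarith)
        rw [Real.log_mul (by linarith) (by linarith)] at this
        have := le_abs_self (Real.log ‖x0 - y‖)
        linarith
    have h5 : |Real.log ‖x - y‖| * |f y| ≤ (|Real.log ‖x0 - y‖| + Real.log (1 + ‖x - x0‖)) * |f y| := by gcongr
    have := abs_nonneg (f y * ‖x - y‖⁻¹)
    rw [abs_mul (Real.log ‖x0 - y‖)]
    linarith

def LAc : ℂ →L[ℝ] (ℂ →L[ℝ] ℝ) := AddMonoidHom.toRealLinearMap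
  (⟨⟨LA, by ext v; simp [LA_apply]⟩, LA_add⟩ : ℂ →+ (ℂ →L[ℝ] ℝ)) LA_cont
lemma LAc_apply (a : ℂ) : LAc a = LA a := rfl

lemma LA_smul (r : ℝ) (a : ℂ) : LA ((r : ℂ) * a) = r • LA a := by
  rw [← LAc_apply, ← LAc_apply, ← map_smul]; simp

def kI (ε : ℝ) (f : ℂ → ℝ) (x : ℂ) : ℂ := ∫ y, (f y : ℂ) * kE ε (x - y)
def lI (ε : ℝ) (f : ℂ → ℝ) (x : ℂ) : ℝ := ∫ y, lE ε (x - y) * f y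

lemma ae_ne (x : ℂ) : ∀ᵐ y : ℂ, x - y ≠ 0 := by
  have : ∀ᵐ y : ℂ, y ≠ x := by
    rw [ae_iff]; simp
  filter_upwards [this] with y hy
  exact sub_ne_zero.2 hy.symm

lemma kI_int (ε : ℝ) (hε : 0 < ε) (f : ℂ → ℝ) (hf : Continuous f) (h1 : Integrable f) (x : ℂ) :
    Integrable (fun y => (f y : ℂ) * kE ε (x - y)) := by
  have kc := kE_cont' ε hε
  have kc2 : Continuous (fun y => kE ε (x - y)) := kc.comp (by fun_prop)
  refine (h1.norm.mul_const ε⁻¹).mono' ?_ (Filter.Eventually.of_forall fun y => ?_)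
  · exact ((Complex.continuous_ofReal.comp hf).mul kc2).aestronglyMeasurable
  · rw [norm_mul, Complex.norm_real]
    gcongr
    exact kE_le_inv ε hε _

lemma lI_int (ε : ℝ) (hε : 0 < ε) (h2 : ε ≤ 1) (f : ℂ → ℝ) (hf : Continuous f) (h1 : Integrable f) (x : ℂ)
    (hl : Integrable (fun y => Real.log ‖x - y‖ * f y)) :
    Integrable (fun y => lE ε (x - y) * f y) := by
  have lc2 : Continuous (fun y => lE ε (x - y)) := (lE_cont ε hε).comp (by fun_prop)
  refine (hl.norm.fun_add h1.norm).mono' (lc2.mul hf).aestronglyMeasurable ?_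
  filter_upwards [ae_ne x] with y hy
  rw [norm_mul, norm_mul]
  have := lE_bound ε hε h2 _ hy
  simp only [Real.norm_eq_abs]
  nlinarith [abs_nonneg (f y)]

lemma lI_fderiv (ε : ℝ) (hε : 0 < ε) (h2 : ε ≤ 1) (f : ℂ → ℝ) (hf : Continuous f) (h1 : Integrable f) (x : ℂ)
    (hl : Integrable (fun y => Real.log ‖x - y‖ * f y)) :
    HasFDerivAt (lI ε f) (LA (kI ε f x)) x := by
  have ki := kI_int ε hε f hf h1 x
  have e : LA (kI ε f x) = ∫ y, LA ((f y : ℂ) * kE ε (x - y)) :=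
    (ContinuousLinearMap.integral_comp_comm LAc ki).symm
  rw [e]
  refine hasFDerivAt_integral_of_dominated_of_fderiv_le (s := Set.univ) (bound := fun y => ‖f y‖ * ε⁻¹)
    (F' := fun x y => LA ((f y : ℂ) * kE ε (x - y)))
    Filter.univ_mem ?_ (lI_int ε hε h2 f hf h1 x hl) ?_ ?_ (h1.norm.mul_const ε⁻¹) ?_
  · refine Filter.Eventually.of_forall fun z => ?_
    have lc2 : Continuous (fun y => lE ε (z - y)) := (lE_cont ε hε).comp (by fun_prop)
    exact (lc2.mul hf).aestronglyMeasurable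
  · exact LA_cont.comp_aestronglyMeasurable ki.aestronglyMeasurable
  · refine Filter.Eventually.of_forall fun y z _ => (LA_norm _).trans ?_
    rw [norm_mul, Complex.norm_real]
    gcongr
    exact kE_le_inv ε hε _
  · refine Filter.Eventually.of_forall fun y z _ => ?_
    have h := (lE_hasFDerivAt ε hε (z - y)).comp z ((hasFDerivAt_id z).sub_const y)
    have h3 : HasFDerivAt (fun z => lE ε (z - y) * f y) (f y • (LA (kE ε (z - y))).comp (ContinuousLinearMap.id ℝ ℂ)) z :=
      h.mul_const (f y)
    rw [LA_smul]
    exact h3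

lemma lE_tendsto (t : ℂ) (ht : t ≠ 0) :
    Filter.Tendsto (fun n : ℕ => lE (1 / ((n:ℝ) + 1)) t) Filter.atTop (nhds (Real.log ‖t‖)) := by
  have hr : 0 < ‖t‖ := norm_pos_iff.2 ht
  have h0 : Filter.Tendsto (fun n : ℕ => 1 / ((n:ℝ) + 1)) Filter.atTop (nhds 0) := tendsto_one_div_add_atTop_nhds_zero_nat
  have h : ContinuousAt (fun e : ℝ => lE e t) 0 := by
    unfold lE
    refine ContinuousAt.mul continuousAt_const (ContinuousAt.log (by fun_prop) ?_)
    positivity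
  have h2 := h.tendsto.comp h0
  have : lE 0 t = Real.log ‖t‖ := by
    simp [lE]
  rw [this] at h2
  exact h2

lemma eps_pos (n : ℕ) : 0 < 1 / ((n:ℝ) + 1) := by positivity
lemma eps_le (n : ℕ) : 1 / ((n:ℝ) + 1) ≤ 1 := by
  rw [div_le_one (by positivity)]; have : (0:ℝ) ≤ n := by positivity
  linarith

lemma lI_tendsto (f : ℂ → ℝ) (hf : Continuous f) (h1 : Integrable f) (x : ℂ)
    (hl : Integrable (fun y => Real.log ‖x - y‖ * f y)) :
    Filter.Tendsto (fun n : ℕ => lI (1 / ((n:ℝ) + 1)) f x) Filter.atTop (nhds (LP f x)) := by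
  refine tendsto_integral_of_dominated_convergence (fun y => ‖Real.log ‖x - y‖ * f y‖ + ‖f y‖) (fun n => ?_)
    (hl.norm.fun_add h1.norm) (fun n => ?_) ?_
  · exact (lI_int _ (eps_pos n) (eps_le n) f hf h1 x hl).aestronglyMeasurable
  · filter_upwards [ae_ne x] with y hy
    rw [norm_mul, norm_mul]
    have := lE_bound _ (eps_pos n) (eps_le n) _ hy
    simp only [Real.norm_eq_abs]
    nlinarith [abs_nonneg (f y)]
  · filter_upwards [ae_ne x] with y hy
    exact (lE_tendsto _ hy).mul_const _

lemma eK_far (ε : ℝ) (t : ℂ) (h : 1 ≤ ‖t‖) : eK ε t ≤ ε ^ 2 := by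
  unfold eK
  have h1 : ‖t‖⁻¹ ≤ 1 := inv_le_one_of_one_le₀ h
  have h2 : (‖t‖ ^ 2 + ε ^ 2)⁻¹ ≤ 1 := inv_le_one_of_one_le₀ (by nlinarith [sq_nonneg ε])
  have h3 : ‖t‖⁻¹ * (‖t‖ ^ 2 + ε ^ 2)⁻¹ ≤ 1 := mul_le_one₀ h1 (by positivity) h2
  nlinarith [sq_nonneg ε]

lemma eK_nonneg (ε : ℝ) (t : ℂ) : 0 ≤ eK ε t := by unfold eK; positivity

lemma kI_diff (ε : ℝ) (hε : 0 < ε) (f : ℂ → ℝ) (hf : Continuous f) (h1 : Integrable f) (x : ℂ)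
    (M : ℝ) (hM0 : 0 ≤ M) (hM : ∀ y, ‖x - y‖ ≤ 1 → |f y| ≤ M) :
    ‖kI ε f x - CT (fC f) x‖ ≤ M * (ε * ∫ t : ℂ, ‖t‖⁻¹ * (sC t)⁻¹) + ε ^ 2 * ∫ y, |f y| := by
  have ki := kI_int ε hε f hf h1 x
  have ii := inv_int f hf h1 x
  have ci : Integrable (fun y => fC f y / (x - y)) := by
    refine ii.mono ?_ (Filter.Eventually.of_forall fun y => ?_)
    · have fm := hf.measurable
      have : Measurable (fC f) := Complex.measurable_ofReal.comp fm
      exact Measurable.aestronglyMeasurable (by fun_prop)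
    · unfold fC; simp [div_eq_mul_inv]
  have h1n : Integrable (fun y => |f y|) := h1.norm
  have e1 := eK_int ε hε
  have e2 : Integrable (fun y => eK ε (x - y)) := e1.1.comp_sub_left x
  have e3 : ∫ y, eK ε (x - y) = ε * ∫ t : ℂ, ‖t‖⁻¹ * (sC t)⁻¹ := by
    rw [integral_sub_left_eq_self (eK ε) volume x, e1.2]
  have : kI ε f x - CT (fC f) x = ∫ y, ((f y : ℂ) * kE ε (x - y) - fC f y / (x - y)) := (integral_sub ki ci).symm
  rw [this, ← e3, ← integral_const_mul, ← integral_const_mul, ← integral_add (e2.const_mul M) (h1n.const_mul (ε ^ 2))]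
  refine norm_integral_le_of_norm_le ((e2.const_mul M).fun_add (h1n.const_mul (ε ^ 2))) (Filter.Eventually.of_forall fun y => ?_)
  have : (f y : ℂ) * kE ε (x - y) - fC f y / (x - y) = (f y : ℂ) * (kE ε (x - y) - (x - y)⁻¹) := by
    unfold fC; rw [div_eq_mul_inv]; ring
  rw [this, norm_mul, Complex.norm_real, kE_diff ε hε, Real.norm_eq_abs]
  have p := eK_nonneg ε (x - y)
  have q := abs_nonneg (f y)
  show |f y| * eK ε (x - y) ≤ M * eK ε (x - y) + ε ^ 2 * |f y|
  rcases le_total ‖x - y‖ 1 with h | h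
  · have := hM y h
    nlinarith [mul_nonneg (sq_nonneg ε) q]
  · have := eK_far ε _ h
    nlinarith [mul_nonneg hM0 p]

lemma LP_hasFDerivAt (f : ℂ → ℝ) (hf : Continuous f) (x0 : ℂ) (h : Integrable (fun y => Real.log ‖x0 - y‖ * f y)) (x : ℂ) :
    HasFDerivAt (LP f) (LA (CT (fC f) x)) x := by
  have h1 := log_L1 f hf x0 h
  have hl := log_all f hf x0 h
  obtain ⟨M, hM0, hM⟩ := loc_bd f hf x 2
  refine hasFDerivAt_of_tendstoUniformlyOn (l := Filter.atTop) (s := Metric.ball x 1) Metric.isOpen_ball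
    (f := fun n : ℕ => lI (1 / ((n:ℝ) + 1)) f) (f' := fun n : ℕ => fun z => LA (kI (1 / ((n:ℝ) + 1)) f z))
    (g' := fun z => LA (CT (fC f) z)) ?_ ?_ ?_ (Metric.mem_ball_self one_pos)
  · rw [Metric.tendstoUniformlyOn_iff]
    intro η hη
    have h0 : Filter.Tendsto (fun n : ℕ => 1 / ((n:ℝ) + 1)) Filter.atTop (nhds 0) := tendsto_one_div_add_atTop_nhds_zero_nat
    have c0 : Continuous (fun ε : ℝ => M * (ε * ∫ t : ℂ, ‖t‖⁻¹ * (sC t)⁻¹) + ε ^ 2 * ∫ y, |f y|) := by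
      generalize (∫ t : ℂ, ‖t‖⁻¹ * (sC t)⁻¹) = a
      fun_prop
    have h3 := (c0.tendsto 0).comp h0
    have h4 : Filter.Tendsto (fun n : ℕ => M * ((1 / ((n:ℝ) + 1)) * ∫ t : ℂ, ‖t‖⁻¹ * (sC t)⁻¹) + (1 / ((n:ℝ) + 1)) ^ 2 * ∫ y, |f y|)
       Filter.atTop (nhds 0) := by
      have z0 : M * (0 * ∫ t : ℂ, ‖t‖⁻¹ * (sC t)⁻¹) + 0 ^ 2 * ∫ y, |f y| = 0 := by simp
      rw [z0] at h3
      exact h3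
    filter_upwards [h4.eventually (gt_mem_nhds hη)] with n hn z hz
    rw [dist_comm, dist_eq_norm]
    have : LA (kI (1 / ((n:ℝ) + 1)) f z) - LA (CT (fC f) z) = LA (kI (1 / ((n:ℝ) + 1)) f z - CT (fC f) z) := by
      rw [← LAc_apply, ← LAc_apply, ← LAc_apply, map_sub]
    rw [this]
    refine (LA_norm _).trans_lt (lt_of_le_of_lt (kI_diff _ (eps_pos n) f hf h1 z M hM0 fun y hy => hM y ?_) hn)
    have hz2 : ‖x - z‖ < 1 := by rwa [mem_ball_iff_norm'] at hz
    have : x - y = (x - z) + (z - y) := by ring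
    rw [this]
    exact (norm_add_le _ _).trans (by linarith)
  · intro n z _
    exact lI_fderiv _ (eps_pos n) (eps_le n) f hf h1 z (hl z)
  · intro z _
    exact lI_tendsto f hf h1 z (hl z)

def PsC (f : ℂ → ℝ) (x : ℂ) : ℝ := -(1 / (2 * Real.pi)) * LP f x

lemma tot_fderiv (f : ℂ → ℝ) (hf : Differentiable ℝ f) :
    (∀ x, HasFDerivAt (fun z => gG f z - PsC f z) (dW f x) x) ∨
    (∀ x, HasFDerivAt (fun z => gG f z - PsC f z) (fderiv ℝ (gG f) x) x) := by
  by_cases h : ∃ x0, Integrable (fun y => Real.log ‖x0 - y‖ * f y)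
  · left
    intro x
    obtain ⟨x0, h⟩ := h
    have a := LP_hasFDerivAt f hf.continuous x0 h x
    have g := (gG_hasFDerivAt f x (hf x)).differentiableAt.hasFDerivAt
    have := g.fun_sub (a.const_mul (-(1 / (2 * Real.pi))))
    have e : dW f x = fderiv ℝ (gG f) x - (-(1 / (2 * Real.pi))) • LA (CT (fC f) x) := by
      unfold dW AA
      rw [LA_smul, smul_smul, sub_eq_add_neg, ← neg_smul]
      congr 2
      field_simp
    rw [e]
    exact this
  · right
    intro x
    push Not at h
    have : (fun z => gG f z - PsC f z) = gG f := by
      ext z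
      unfold PsC LP
      rw [integral_undef (h z)]; simp
    rw [this]
    exact (gG_hasFDerivAt f x (hf x)).differentiableAt.hasFDerivAt

def eI : ℂ ≃ₗᵢ[ℝ] E2 := Complex.orthonormalBasisOneI.repr

lemma eI_zero (z : ℂ) : eI z 0 = z.re := by simp [eI]
lemma eI_one (z : ℂ) : eI z 1 = z.im := by simp [eI]

lemma eI_int (G : E2 → ℝ) : ∫ y, G y = ∫ z, G (eI z) :=
  (eI.measurePreserving.integral_comp eI.toHomeomorph.measurableEmbedding G).symm

lemma eI_integrable (G : E2 → ℝ) (h : Integrable G) : Integrable (fun z => G (eI z)) :=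
  (eI.measurePreserving.integrable_comp_emb eI.toHomeomorph.measurableEmbedding).2 h

lemma grad_norm (f : E2 → ℝ) (z : ℂ) : ‖gradient f (eI z)‖ = ‖fderiv ℝ (fun z => f (eI z)) z‖ := by
  have h1 : ‖gradient f (eI z)‖ = ‖fderiv ℝ f (eI z)‖ := by
    unfold gradient; rw [LinearIsometryEquiv.norm_map]
  have h2 : fderiv ℝ (fun z => f (eI z)) z = (fderiv ℝ f (eI z)).comp (eI.toContinuousLinearEquiv : ℂ →L[ℝ] E2) :=
    eI.toContinuousLinearEquiv.comp_right_fderiv (f := f) (x := z)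
  rw [h1, h2]
  exact (ContinuousLinearMap.opNorm_comp_linearIsometryEquiv (fderiv ℝ f (eI z)) eI).symm

lemma U2_eI (z : ℂ) : U2 (eI z) = 8 / sC z ^ 2 := by
  unfold U2 sC; rw [LinearIsometryEquiv.norm_map]

lemma Psi_eI (f : E2 → ℝ) (z : ℂ) : Psi f (eI z) = PsC (fun z => f (eI z)) z := by
  unfold Psi PsC LP
  rw [eI_int]
  simp_rw [← map_sub, LinearIsometryEquiv.norm_map]

lemma gG_eI (f : E2 → ℝ) (z : ℂ) : f (eI z) / U2 (eI z) = gG (fun z => f (eI z)) z := by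
  rw [U2_eI]; unfold gG
  have := sC_ne z
  field_simp

lemma U2_fderiv (y : E2) : HasFDerivAt U2 ((-32 * ((1 + ‖y‖ ^ 2) ^ 3)⁻¹) • innerSL ℝ y) y := by
  have h1 : HasFDerivAt (fun y : E2 => 1 + ‖y‖ ^ 2) (2 • innerSL ℝ y) y :=
    ((hasStrictFDerivAt_norm_sq y).hasFDerivAt).const_add 1
  have hp : 1 + ‖y‖ ^ 2 ≠ 0 := by positivity
  have h2 : HasDerivAt (fun t : ℝ => 8 / t ^ 2) (-16 / (1 + ‖y‖ ^ 2) ^ 3) (1 + ‖y‖ ^ 2) := by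
    have := (hasDerivAt_const (1 + ‖y‖ ^ 2) (8:ℝ)).fun_div ((hasDerivAt_id (1 + ‖y‖ ^ 2)).fun_pow 2) (by simpa using hp)
    refine this.congr_deriv ?_
    simp only [id]
    field_simp
    norm_num
    ring
  have h3 := h2.comp_hasFDerivAt y h1
  refine h3.congr_fderiv ?_
  ext v
  simp only [smul_apply, smul_eq_mul, two_smul, add_apply]
  field_simp
  ring

lemma Lam_eI (z : ℂ) : Lam U2 (eI z) = 16 * (2 - sC z) * ((sC z) ^ 3)⁻¹ := by
  unfold Lam
  have h : ⟪eI z, gradient U2 (eI z)⟫ = fderiv ℝ U2 (eI z) (eI z) := by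
    rw [real_inner_comm]; exact InnerProductSpace.toDual_symm_apply
  rw [h, (U2_fderiv _).fderiv, U2_eI]
  have := sC_ne z
  have e : ‖z‖ ^ 2 = sC z - 1 := by unfold sC; ring
  simp only [smul_apply, smul_eq_mul, innerSL_apply_apply, real_inner_self_eq_norm_sq, LinearIsometryEquiv.norm_map]
  rw [e]
  have e2 : 1 + (sC z - 1) = sC z := by ring
  rw [e2]
  field_simp
  ring

lemma pd_eI (i : Fin 2) (z : ℂ) : pd i U2 (eI z) = -32 * eI z i * ((sC z) ^ 3)⁻¹ := by
  unfold pd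
  rw [(U2_fderiv _).fderiv]
  simp only [smul_apply, smul_eq_mul, innerSL_apply_apply, LinearIsometryEquiv.norm_map, EuclideanSpace.inner_single_right]
  simp [sC]
  ring

lemma m3 (f : E2 → ℝ) : ∫ y, f y * Lam U2 y = 128 * mo (fun z => f (eI z)) X3 := by
  rw [eI_int]; unfold mo
  rw [← integral_const_mul]
  congr 1; ext z
  rw [Lam_eI]; unfold gG X3
  have := sC_ne z
  field_simp
  ring

lemma m1 (f : E2 → ℝ) : ∫ y, f y * pd 0 U2 y = -128 * mo (fun z => f (eI z)) X1 := by
  rw [eI_int]; unfold mo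
  rw [← integral_const_mul]
  congr 1; ext z
  rw [pd_eI, eI_zero]; unfold gG X1
  have := sC_ne z
  field_simp
  ring

lemma m2 (f : E2 → ℝ) : ∫ y, f y * pd 1 U2 y = -128 * mo (fun z => f (eI z)) X2 := by
  rw [eI_int]; unfold mo
  rw [← integral_const_mul]
  congr 1; ext z
  rw [pd_eI, eI_one]; unfold gG X2
  have := sC_ne z
  field_simp
  ring

/-- coercivity of `∫ U |∇M f|²` up to the kernel directions. -/
theorem stmt2 :
    ∃ c : ℝ, 0 < c ∧ ∃ C : ℝ, 0 < C ∧
      ∀ f : E2 → ℝ, Differentiable ℝ f →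
        Integrable (fun y : E2 => (1 + ‖y‖ ^ 2) * (f y) ^ 2) →
        Integrable (fun y : E2 => ‖gradient f y‖ ^ 2 / U2 y) →
        (∫ y : E2, U2 y * ‖gradient (fun z => f z / U2 z - Psi f z) y‖ ^ 2)
          ≥ c * (∫ y : E2, ‖gradient f y‖ ^ 2 / U2 y)
            - C * ((∫ y : E2, f y * Lam U2 y) ^ 2
                + (∫ y : E2, f y * pd 0 U2 y) ^ 2
                + (∫ y : E2, f y * pd 1 U2 y) ^ 2) := by
  obtain ⟨C, hC, H⟩ := main_C
  refine ⟨64 / C, by positivity, 8 / 128 ^ 2, by positivity, fun f hf i0 i1 => ?_⟩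
  have hd : Differentiable ℝ (fun z => f (eI z)) := hf.comp eI.toContinuousLinearEquiv.differentiable
  have j0 := eI_integrable _ i0
  have j1 := (eI_integrable _ i1).const_mul 8
  have w : WW (fun z => f (eI z)) := by
    refine ⟨hd, ?_, ?_⟩
    · refine j0.congr (Filter.Eventually.of_forall fun z => ?_)
      simp [sC]
    · refine j1.congr (Filter.Eventually.of_forall fun z => ?_)
      have := sC_ne z
      simp only [grad_norm, U2_eI]
      field_simp
  have hI : ∫ y : E2, ‖gradient f y‖ ^ 2 / U2 y = (1/8) * ∫ z, sC z ^ 2 * ‖fderiv ℝ (fun z => f (eI z)) z‖ ^ 2 := by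
    rw [eI_int, ← integral_const_mul]
    congr 1; ext z
    have := sC_ne z
    rw [grad_norm, U2_eI]
    field_simp
  have hL : ∫ y : E2, U2 y * ‖gradient (fun z => f z / U2 z - Psi f z) y‖ ^ 2 =
      8 * ∫ z, ((sC z) ^ 2)⁻¹ * ‖fderiv ℝ (fun z => gG (fun z => f (eI z)) z - PsC (fun z => f (eI z)) z) z‖ ^ 2 := by
    rw [eI_int, ← integral_const_mul]
    congr 1; ext z
    rw [grad_norm, U2_eI]
    simp_rw [gG_eI, Psi_eI]
    ring
  have key : NN (fun z => f (eI z)) ≤ C * ((∫ z, ((sC z) ^ 2)⁻¹ *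
      ‖fderiv ℝ (fun z => gG (fun z => f (eI z)) z - PsC (fun z => f (eI z)) z) z‖ ^ 2) + mm (fun z => f (eI z))) := by
    obtain ⟨a, b⟩ := H _ w
    rcases tot_fderiv _ hd with h | h
    · simp_rw [fun x => (h x).fderiv]; exact a
    · simp_rw [fun x => (h x).fderiv]; exact b
  have hN : ∫ z, sC z ^ 2 * ‖fderiv ℝ (fun z => f (eI z)) z‖ ^ 2 ≤ NN (fun z => f (eI z)) := by
    unfold NN
    have : 0 ≤ ∫ z, sC z * f (eI z) ^ 2 := integral_nonneg fun z => by have := sC_pos z; positivity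
    linarith
  rw [hL, hI, m1, m2, m3]
  have k2 := hN.trans key
  unfold mm at k2
  generalize (∫ z, sC z ^ 2 * ‖fderiv ℝ (fun z => f (eI z)) z‖ ^ 2) = I at *
  generalize (∫ z, ((sC z) ^ 2)⁻¹ *
      ‖fderiv ℝ (fun z => gG (fun z => f (eI z)) z - PsC (fun z => f (eI z)) z) z‖ ^ 2) = D at *
  have k3 : I / C ≤ D + (mo (fun z => f (eI z)) X1 ^ 2 + mo (fun z => f (eI z)) X2 ^ 2 + mo (fun z => f (eI z)) X3 ^ 2) := by
    rw [div_le_iff₀ hC]; linarith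
  have k4 : 64 / C * (1/8 * I) = 8 * (I / C) := by ring
  rw [k4]
  linarith
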